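/- Let P(X) = X(X+1). Then the limiting pair correlation function of the sequence (F_{Q,P})_{Q≥1} exists: for every Λ > 0, lim_{Q→∞} S_{F_{Q,P}}(Λ) = ∫_0^Λ g₂(λ) dλ, where g₂(λ) = (1/(ζ(2)·λ²)) · Σ_{d₂,d₄ ≥ 1} [μ(d₂)·μ(d₄)/(d₂·d₄·φ(d₂)·φ(d₄))] · Σ_{1 ≤ m < 2λ/β_P} 𝔥(m)·log(2λ/(m·β_P)), with 𝔥(m) = Σ n·μ(d₁)·μ(d₃)·d·D·G₁·G₂ · ∏_{p | d₂d₄/(d·D·G₁·G₂)} (1 + 1/p)^{−1}, the inner sum being over all quadruples of positive integers n, δ, d₁, d₃ with n·δ·d₁·d₃ = m satisfying gcd(d₂/(d·G₁), d₄/(D·G₂)) = 1, where d = gcd(d₁,d₂), D = gcd(d₃,d₄), G₁ = gcd(δ, d₂/d), G₂ = gcd(δ, d₄/D). In particular the limiting pair correlation is non-Poissonian. -/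

import Mathlib

open Finset Filter

/-- The pairs `(a, q)` with `1 ≤ a ≤ q ≤ Q` and `gcd (P(a), q) = 1`, indexing the
polynomial Farey fractions `a / q` of order `Q`. -/
def fareyPairs (P : Polynomial ℤ) (Q : ℕ) : Finset (ℕ × ℕ) :=
  (Finset.Icc 1 Q ×ˢ Finset.Icc 1 Q).filter
    (fun x => x.1 ≤ x.2 ∧ Int.gcd (P.eval (x.1 : ℤ)) (x.2 : ℤ) = 1)

/-- The set of polynomial Farey fractions of order `Q`. -/
def fareySet (P : Polynomial ℤ) (Q : ℕ) : Finset ℚ :=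
  (fareyPairs P Q).image (fun x => (x.1 : ℚ) / (x.2 : ℚ))

/-- `f_P(m)` is the number of `1 ≤ d ≤ m` with `P(d) ≡ 0 (mod m)`. -/
def fP (P : Polynomial ℤ) (m : ℕ) : ℕ :=
  ((Finset.Icc 1 m).filter (fun d : ℕ => (m : ℤ) ∣ P.eval (d : ℤ))).card

/-- `β_P = ∏_p (1 - f_P(p)/p²)`, the product over all primes. -/
noncomputable def betaP (P : Polynomial ℤ) : ℝ :=
  ∏' p : Nat.Primes, (1 - (fP P (p : ℕ) : ℝ) / ((p : ℕ) : ℝ) ^ 2)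

open scoped Classical in
/-- Pair correlation measure `S_F(Λ)` of a finite set `F ⊂ ℝ/ℤ` (represented by
rationals): `(1/N) · #{(a,b) ∈ F² : a ≠ b, a - b ∈ (1/N)(0,Λ) + ℤ}`. -/
noncomputable def pairCorr (F : Finset ℚ) (Λ : ℝ) : ℝ :=
  (((F ×ˢ F).filter (fun x => x.1 ≠ x.2 ∧
      ∃ k : ℤ, ((x.1 : ℝ) - (x.2 : ℝ) - (k : ℝ)) * (F.card : ℝ) ∈ Set.Ioo 0 Λ)).card : ℝ) /
    (F.card : ℝ)

/-- The polynomial `P(X) = X(X+1)`. -/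
noncomputable def Pxx : Polynomial ℤ := Polynomial.X * (Polynomial.X + 1)

open scoped Classical in
/-- `𝔥(m)` (depending on the outer variables `d₂, d₄`): the sum over quadruples
`((n,δ),(d₁,d₃))` of positive integers with `n·δ·d₁·d₃ = m` and
`gcd(d₂/(d·G₁), d₄/(D·G₂)) = 1` of
`n·μ(d₁)·μ(d₃)·d·D·G₁·G₂·∏_{p ∣ d₂d₄/(d·D·G₁·G₂)} (1+1/p)⁻¹`, where
`d = gcd(d₁,d₂)`, `D = gcd(d₃,d₄)`, `G₁ = gcd(δ, d₂/d)`, `G₂ = gcd(δ, d₄/D)`. -/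
noncomputable def frakH (d₂ d₄ m : ℕ) : ℝ :=
  ∑ x ∈ ((Finset.Icc 1 m ×ˢ Finset.Icc 1 m) ×ˢ (Finset.Icc 1 m ×ˢ Finset.Icc 1 m)).filter
      (fun x =>
        x.1.1 * x.1.2 * x.2.1 * x.2.2 = m ∧
        Nat.gcd (d₂ / (Nat.gcd x.2.1 d₂ * Nat.gcd x.1.2 (d₂ / Nat.gcd x.2.1 d₂)))
          (d₄ / (Nat.gcd x.2.2 d₄ * Nat.gcd x.1.2 (d₄ / Nat.gcd x.2.2 d₄))) = 1),
    (x.1.1 : ℝ) * (ArithmeticFunction.moebius x.2.1 : ℝ) *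
      (ArithmeticFunction.moebius x.2.2 : ℝ) *
      (Nat.gcd x.2.1 d₂ : ℝ) * (Nat.gcd x.2.2 d₄ : ℝ) *
      (Nat.gcd x.1.2 (d₂ / Nat.gcd x.2.1 d₂) : ℝ) *
      (Nat.gcd x.1.2 (d₄ / Nat.gcd x.2.2 d₄) : ℝ) *
      ∏ p ∈ ((d₂ * d₄) / (Nat.gcd x.2.1 d₂ * Nat.gcd x.2.2 d₄ *
          Nat.gcd x.1.2 (d₂ / Nat.gcd x.2.1 d₂) *
          Nat.gcd x.1.2 (d₄ / Nat.gcd x.2.2 d₄))).primeFactors,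
        (1 + 1 / (p : ℝ))⁻¹

open scoped Classical in
/-- The limiting pair correlation function `𝔤₂(λ)` for the polynomial `P(X) = X(X+1)`;
here `ζ(2) = π²/6`. -/
noncomputable def gTwo (lam : ℝ) : ℝ :=
  (1 / ((Real.pi ^ 2 / 6) * lam ^ 2)) *
    ∑' d₂ : ℕ+, ∑' d₄ : ℕ+,
      ((ArithmeticFunction.moebius (d₂ : ℕ) : ℝ) * (ArithmeticFunction.moebius (d₄ : ℕ) : ℝ) /
          (((d₂ : ℕ) : ℝ) * ((d₄ : ℕ) : ℝ) * (Nat.totient (d₂ : ℕ) : ℝ) *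
            (Nat.totient (d₄ : ℕ) : ℝ))) *
        ∑ m ∈ (Finset.Icc 1 (Nat.floor (2 * lam / betaP Pxx))).filter
            (fun m : ℕ => (m : ℝ) < 2 * lam / betaP Pxx),
          frakH (d₂ : ℕ) (d₄ : ℕ) m * Real.log (2 * lam / ((m : ℝ) * betaP Pxx))


lemma per_sum (v : ℕ → ℝ) (W : ℕ) (hW : 0 < W) (hv : ∀ x, v (x + W) = v x) (V : ℝ)
    (hV : ∀ x, |v x| ≤ V) (n : ℕ) :
    |∑ y ∈ range n, (v y - (∑ y ∈ range W, v y) / W)| ≤ 2 * W * V := by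
  set vb := (∑ y ∈ range W, v y) / W with hvb
  have hWR : (0:ℝ) < W := by exact_mod_cast hW
  have hV0 : 0 ≤ V := le_trans (abs_nonneg _) (hV 0)
  have hvbV : |vb| ≤ V := by
    rw [hvb, abs_div, abs_of_pos hWR, div_le_iff₀ hWR]
    calc |∑ y ∈ range W, v y| ≤ ∑ y ∈ range W, |v y| := abs_sum_le_sum_abs _ _
      _ ≤ ∑ y ∈ range W, V := sum_le_sum (fun y _ => hV y)
      _ = V * W := by simp [mul_comm]
  have hSW : ∑ y ∈ range W, (v y - vb) = 0 := by
    rw [sum_sub_distrib, hvb]; simp; field_simp; ring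
  induction n using Nat.strong_induction_on with
  | _ n ih =>
    by_cases h : n < W
    · calc |∑ y ∈ range n, (v y - vb)| ≤ ∑ y ∈ range n, |v y - vb| := abs_sum_le_sum_abs _ _
        _ ≤ ∑ y ∈ range n, (2 * V) := sum_le_sum (fun y _ => by
            have := abs_sub (v y) vb
            linarith [hV y])
        _ = n * (2 * V) := by simp
        _ ≤ W * (2 * V) := by
            have : (n:ℝ) ≤ W := by exact_mod_cast h.le
            gcongr
        _ = 2 * W * V := by ring
    · obtain ⟨k, rfl⟩ := Nat.exists_eq_add_of_le (not_lt.mp h)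
      rw [sum_range_add, hSW, zero_add]
      have : ∀ x, v (W + x) = v x := fun x => by rw [add_comm, hv]
      simp only [this]
      exact ih k (by omega)

lemma per_sum_Ioc (v : ℕ → ℝ) (W : ℕ) (hW : 0 < W) (hv : ∀ x, v (x + W) = v x) (V : ℝ)
    (hV : ∀ x, |v x| ≤ V) (l n : ℕ) (hln : l ≤ n) :
    |∑ y ∈ Ioc l n, v y - ((n:ℝ) - l) * ((∑ y ∈ range W, v y) / W)| ≤ 4 * W * V := by
  set vb := (∑ y ∈ range W, v y) / W with hvb
  have h1 := per_sum v W hW hv V hV (n + 1)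
  have h2 := per_sum v W hW hv V hV (l + 1)
  rw [← hvb] at h1 h2
  have h3 : ∑ y ∈ Ioc l n, v y - ((n:ℝ) - l) * vb
      = ∑ y ∈ range (n+1), (v y - vb) - ∑ y ∈ range (l+1), (v y - vb) := by
    have : Ioc l n = Ico (l+1) (n+1) := by ext x; simp only [mem_Ioc, mem_Ico]; omega
    rw [this, sum_Ico_eq_sub _ (by omega)]
    simp only [sum_sub_distrib, sum_const, card_range, nsmul_eq_mul]
    push_cast; ring
  rw [h3]
  have := abs_sub (∑ y ∈ range (n+1), (v y - vb)) (∑ y ∈ range (l+1), (v y - vb))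
  linarith

lemma abel_bound (d f : ℕ → ℝ) (B K F : ℝ) (hS : ∀ n, |∑ y ∈ range n, d y| ≤ B)
    (n : ℕ) (hf : ∀ x, |f (x + 1) - f x| ≤ K) (hF : |f n| ≤ F) :
    |∑ x ∈ range n, d x * f x| ≤ B * F + n * (B * K) := by
  have hB : 0 ≤ B := le_trans (abs_nonneg _) (hS 0)
  have key : ∀ n, ∑ x ∈ range n, d x * f x = (∑ y ∈ range n, d y) * f n
      - ∑ x ∈ range n, (∑ y ∈ range (x+1), d y) * (f (x+1) - f x) := by
    intro n
    induction n with
    | zero => simp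
    | succ k ih =>
      rw [sum_range_succ, ih, sum_range_succ (fun x => (∑ y ∈ range (x+1), d y) * (f (x+1) - f x)),
        sum_range_succ d k]
      ring
  rw [key]
  refine (abs_sub _ _).trans (add_le_add ?_ ?_)
  · rw [abs_mul]; exact mul_le_mul (hS n) hF (abs_nonneg _) hB
  · refine (abs_sum_le_sum_abs _ _).trans ?_
    calc _ ≤ ∑ x ∈ range n, B * K := sum_le_sum (fun x _ => by
            rw [abs_mul]; exact mul_le_mul (hS _) (hf x) (abs_nonneg _) hB)
      _ = _ := by simp

lemma riemann (φ : ℝ → ℝ) (K : ℝ) (hK : ∀ x y, |φ x - φ y| ≤ K * |x - y|)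
    (hc : Continuous φ) (Q : ℕ) (hQ : 0 < Q) :
    |(∑ x ∈ range Q, φ ((x:ℝ) / Q)) / Q - ∫ t in (0:ℝ)..1, φ t| ≤ K / Q := by
  have hQR : (0:ℝ) < Q := by exact_mod_cast hQ
  have h1 : ∑ k ∈ range Q, ∫ t in (((k:ℕ):ℝ)/Q)..(((k+1:ℕ):ℝ)/Q), φ t = ∫ t in (0:ℝ)..1, φ t := by
    have := intervalIntegral.sum_integral_adjacent_intervals (f := φ) (μ := MeasureTheory.volume)
      (a := fun k : ℕ => (k:ℝ)/Q) (n := Q) (fun k _ => hc.intervalIntegrable _ _)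
    rw [this]; simp [hQR.ne']
  rw [← h1, sum_div, ← sum_sub_distrib]
  refine (abs_sum_le_sum_abs _ _).trans ?_
  have h2 : ∀ x ∈ range Q, |φ ((x:ℝ)/Q) / Q - ∫ t in (((x:ℕ):ℝ)/Q)..(((x+1:ℕ):ℝ)/Q), φ t|
      ≤ K / Q * (1 / Q) := by
    intro x _
    have e1 : φ ((x:ℝ)/Q) / Q = ∫ t in (((x:ℕ):ℝ)/Q)..(((x+1:ℕ):ℝ)/Q), φ ((x:ℝ)/Q) := by
      rw [intervalIntegral.integral_const]; push_cast; simp; field_simp; ring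
    rw [e1, ← intervalIntegral.integral_sub (by simp) (hc.intervalIntegrable _ _)]
    have := intervalIntegral.norm_integral_le_of_norm_le_const (C := K / Q)
      (f := fun t => φ ((x:ℝ)/Q) - φ t) (a := ((x:ℕ):ℝ)/Q) (b := ((x+1:ℕ):ℝ)/Q) ?_
    · rw [Real.norm_eq_abs] at this
      refine this.trans (le_of_eq ?_)
      rw [← sub_div]; push_cast
      rw [show ((x:ℝ) + 1 - x) = 1 by ring, abs_of_pos (by positivity)]
    · intro t ht
      have hle : ((x:ℕ):ℝ)/Q ≤ ((x+1:ℕ):ℝ)/Q := by gcongr; omega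
      rw [Set.uIoc_of_le hle] at ht
      rw [Real.norm_eq_abs]
      have hK0 : 0 ≤ K := by
        have := hK 1 0; simp at this; exact le_trans (abs_nonneg _) this
      refine (hK _ _).trans ?_
      rw [div_eq_mul_one_div K]
      gcongr
      rw [abs_sub_comm, abs_of_nonneg (by linarith [ht.1])]
      have : ((x+1:ℕ):ℝ)/Q = (x:ℝ)/Q + 1/Q := by push_cast; ring
      linarith [ht.2]
  refine (sum_le_sum h2).trans (le_of_eq ?_)
  simp; field_simp

lemma per_riemann (v : ℕ → ℝ) (W : ℕ) (hW : 0 < W) (hv : ∀ x, v (x + W) = v x) (V : ℝ)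
    (hV : ∀ x, |v x| ≤ V) (φ : ℝ → ℝ) (K : ℝ) (hK : ∀ x y, |φ x - φ y| ≤ K * |x - y|)
    (hc : Continuous φ) :
    Tendsto (fun Q : ℕ => (∑ x ∈ Icc 1 Q, v x * φ ((x:ℝ) / Q)) / Q) atTop
      (nhds (((∑ y ∈ range W, v y) / W) * ∫ t in (0:ℝ)..1, φ t)) := by
  set vb := (∑ y ∈ range W, v y) / W with hvb
  have hV0 : 0 ≤ V := le_trans (abs_nonneg _) (hV 0)
  have hK0 : 0 ≤ K := by
    have := hK 1 0; simp at this; exact le_trans (abs_nonneg _) this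
  set C : ℝ := (2 * W * V) * |φ 1| + (2 * W * V) * K + |vb| * K + V * |φ 0| + V * |φ 1| with hC
  rw [tendsto_iff_norm_sub_tendsto_zero]
  refine squeeze_zero' (g := fun Q : ℕ => C / Q) (Eventually.of_forall fun _ => norm_nonneg _) ?_
    (tendsto_const_div_atTop_nhds_zero_nat C)
  filter_upwards [eventually_gt_atTop 0] with Q hQ
  have hQR : (0:ℝ) < Q := by exact_mod_cast hQ
  rw [Real.norm_eq_abs]
  have h1 := per_sum v W hW hv V hV
  rw [← hvb] at h1
  have h2 := abel_bound (fun x => v x - vb) (fun x : ℕ => φ ((x:ℝ)/Q)) (2 * W * V) (K / Q) |φ 1| h1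
    Q (fun x => by
      refine (hK _ _).trans (le_of_eq ?_)
      rw [← sub_div]; push_cast
      rw [show ((x:ℝ) + 1 - x) = 1 by ring, abs_of_pos (by positivity)]; ring)
    (by rw [div_self hQR.ne'])
  have h3 := riemann φ K hK hc Q hQ
  have e : ∑ x ∈ Icc 1 Q, v x * φ ((x:ℝ) / Q) = ∑ x ∈ range Q, (v x - vb) * φ ((x:ℝ)/Q)
      + vb * ∑ x ∈ range Q, φ ((x:ℝ)/Q) + (v Q * φ 1 - v 0 * φ 0) := by
    have : Icc 1 Q = Ico 1 (Q+1) := by ext x; simp only [mem_Icc, mem_Ico]; omega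
    rw [this, sum_Ico_eq_sub _ (by omega), sum_range_succ, mul_sum, ← sum_add_distrib]
    simp only [sum_range_one]
    rw [div_self hQR.ne']; simp
    have : ∀ x : ℕ, (v x - vb) * φ ((x:ℝ)/Q) + vb * φ ((x:ℝ)/Q) = v x * φ ((x:ℝ)/Q) := fun x => by ring
    simp only [this]; ring
  rw [e]
  set A := ∑ x ∈ range Q, (v x - vb) * φ ((x:ℝ)/Q)
  set R := ∑ x ∈ range Q, φ ((x:ℝ)/Q)
  set I := ∫ t in (0:ℝ)..1, φ t
  have e2 : (A + vb * R + (v Q * φ 1 - v 0 * φ 0)) / Q - vb * I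
    = A / Q + vb * (R / Q - I) + (v Q * φ 1 - v 0 * φ 0) / Q := by ring
  rw [e2]
  have b1 : |A / Q| ≤ ((2 * W * V) * |φ 1| + (2 * W * V) * K) / Q := by
    rw [abs_div, abs_of_pos hQR]
    gcongr
    refine h2.trans (le_of_eq ?_)
    field_simp
  have b2 : |vb * (R / Q - I)| ≤ |vb| * (K / Q) := by
    rw [abs_mul]; gcongr
  have b3 : |(v Q * φ 1 - v 0 * φ 0) / Q| ≤ (V * |φ 1| + V * |φ 0|) / Q := by
    rw [abs_div, abs_of_pos hQR]
    gcongr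
    refine (abs_sub _ _).trans ?_
    rw [abs_mul, abs_mul]
    have := hV Q; have := hV 0
    gcongr
  calc _ ≤ |A / Q| + |vb * (R / Q - I)| + |(v Q * φ 1 - v 0 * φ 0) / Q| := abs_add_three _ _ _
    _ ≤ _ := by
      rw [hC]
      have : ∀ a b c d e : ℝ, (a + b + c * K + d + e) / (Q:ℝ)
        = (a + b) / Q + c * (K / Q) + (e + d) / Q := fun a b c d e => by ring
      rw [this]
      linarith

/-- two dimensional sieve limit -/
lemma sieve_limit (w : ℕ → ℕ → ℝ) (C : ℝ)
    (hw : ∀ ε > 0, ∃ W : ℕ, 0 < W ∧ ∃ u : ℕ → ℕ → ℝ, (∀ x y, u (x + W) y = u x y) ∧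
      (∀ x y, u x (y + W) = u x y) ∧
      |(∑ x ∈ range W, ∑ y ∈ range W, u x y) / (W:ℝ)^2 - C| ≤ ε ∧
      ∀ Q : ℕ, ∑ x ∈ Icc 1 Q, ∑ y ∈ Icc 1 Q, |w x y - u x y| ≤ ε * (Q:ℝ)^2)
    (φ : ℝ → ℝ) (K : ℝ) (hK : ∀ x y, |φ x - φ y| ≤ K * |x - y|)
    (hc : Continuous φ) (l : ℕ → ℕ → ℕ) (hl : ∀ Q x, l Q x ≤ Q) (η : ℕ → ℝ)
    (hη : Tendsto η atTop (nhds 0))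
    (hlφ : ∀ᶠ Q : ℕ in atTop, ∀ x ∈ Icc 1 Q, |((Q:ℝ) - l Q x) - Q * φ ((x:ℝ)/Q)| ≤ η Q * Q) :
    Tendsto (fun Q : ℕ => (∑ x ∈ Icc 1 Q, ∑ y ∈ Ioc (l Q x) Q, w x y) / (Q:ℝ)^2) atTop
      (nhds (C * ∫ t in (0:ℝ)..1, φ t)) := by
  set I := ∫ t in (0:ℝ)..1, φ t with hI
  rw [Metric.tendsto_atTop']
  intro δ hδ
  set ε := δ / (4 * (1 + |I|)) with hε
  have hε0 : 0 < ε := by positivity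
  obtain ⟨W, hW, u, hu1, hu2, hmean, herr⟩ := hw ε hε0
  have hWR : (0:ℝ) < W := by exact_mod_cast hW
  obtain ⟨U, hU⟩ : ∃ U : ℝ, ∀ x y, |u x y| ≤ U := by
    refine ⟨∑ x ∈ range W, ∑ y ∈ range W, |u x y|, fun x y => ?_⟩
    have e1 : ∀ y, Function.Periodic (fun x => u x y) W := fun y x => hu1 x y
    have e2 : ∀ x, Function.Periodic (fun y => u x y) W := fun x y => hu2 x y
    have : u x y = u (x % W) (y % W) := by
      have h1 := (e1 y).map_mod_nat x
      have h2 := (e2 (x % W)).map_mod_nat y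
      rw [h2, h1]
    rw [this]
    have hx : x % W ∈ range W := mem_range.mpr (Nat.mod_lt _ hW)
    have hy : y % W ∈ range W := mem_range.mpr (Nat.mod_lt _ hW)
    refine le_trans ?_ (single_le_sum (f := fun x => ∑ y ∈ range W, |u x y|)
      (fun i _ => sum_nonneg (fun j _ => abs_nonneg _)) hx)
    exact single_le_sum (f := fun y => |u (x % W) y|) (fun i _ => abs_nonneg _) hy
  have hU0 : 0 ≤ U := le_trans (abs_nonneg _) (hU 0 0)
  set v : ℕ → ℝ := fun x => (∑ y ∈ range W, u x y) / W with hv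
  have hvV : ∀ x, |v x| ≤ U := by
    intro x
    rw [hv, abs_div, abs_of_pos hWR, div_le_iff₀ hWR]
    calc |∑ y ∈ range W, u x y| ≤ ∑ y ∈ range W, |u x y| := abs_sum_le_sum_abs _ _
      _ ≤ ∑ y ∈ range W, U := sum_le_sum (fun y _ => hU x y)
      _ = U * W := by simp [mul_comm]
  have hper := per_riemann v W hW (fun x => by simp only [hv, hu1]) U hvV φ K hK hc
  have hmean2 : (∑ y ∈ range W, v y) / W = (∑ x ∈ range W, ∑ y ∈ range W, u x y) / (W:ℝ)^2 := by
    simp only [hv]; rw [← sum_div]; field_simp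
  rw [hmean2, ← hI] at hper
  set mu := (∑ x ∈ range W, ∑ y ∈ range W, u x y) / (W:ℝ)^2 with hmu
  rw [Metric.tendsto_atTop'] at hper
  obtain ⟨N1, hN1⟩ := hper (δ/8) (by positivity)
  have hlim2 : Tendsto (fun Q : ℕ => (4 * W * U) / (Q:ℝ) + U * η Q) atTop (nhds 0) := by
    have := (tendsto_const_div_atTop_nhds_zero_nat (4 * W * U)).add (hη.const_mul U)
    simpa using this
  have h3 : ∀ᶠ Q : ℕ in atTop, (4 * W * U) / (Q:ℝ) + U * η Q < δ/8 :=
    hlim2.eventually (gt_mem_nhds (by positivity))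
  obtain ⟨N2, hN2⟩ := eventually_atTop.mp (h3.and hlφ)
  refine ⟨max N1 (max N2 1), fun Q hQ => ?_⟩
  have hQ1 : N1 < Q := lt_of_le_of_lt (le_max_left _ _) hQ
  have hQ2 : N2 ≤ Q := (lt_of_le_of_lt ((le_max_left _ _).trans (le_max_right _ _)) hQ).le
  have hQ3 : 0 < Q := by omega
  have hQR : (0:ℝ) < Q := by exact_mod_cast hQ3
  obtain ⟨a1, a2⟩ := hN2 Q hQ2
  have a3 := hN1 Q hQ1
  rw [Real.dist_eq] at a3 ⊢
  have c1 : |∑ x ∈ Icc 1 Q, ∑ y ∈ Ioc (l Q x) Q, w x y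
      - ∑ x ∈ Icc 1 Q, ∑ y ∈ Ioc (l Q x) Q, u x y| ≤ ε * (Q:ℝ)^2 := by
    refine le_trans ?_ (herr Q)
    rw [← sum_sub_distrib]
    refine (abs_sum_le_sum_abs _ _).trans (sum_le_sum fun x _ => ?_)
    rw [← sum_sub_distrib]
    refine (abs_sum_le_sum_abs _ _).trans ?_
    refine sum_le_sum_of_subset_of_nonneg ?_ (fun _ _ _ => abs_nonneg _)
    intro y; simp; omega
  have c2 : |∑ x ∈ Icc 1 Q, ∑ y ∈ Ioc (l Q x) Q, u x y
      - Q * ∑ x ∈ Icc 1 Q, v x * φ ((x:ℝ)/Q)| ≤ Q * (4 * W * U + U * (η Q * Q)) := by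
    rw [mul_sum, ← sum_sub_distrib]
    refine (abs_sum_le_sum_abs _ _).trans ?_
    have : ∀ x ∈ Icc 1 Q, |∑ y ∈ Ioc (l Q x) Q, u x y - Q * (v x * φ ((x:ℝ)/Q))|
        ≤ 4 * W * U + U * (η Q * Q) := by
      intro x hx
      have b1 := per_sum_Ioc (u x) W hW (hu2 x) U (hU x) (l Q x) Q (hl Q x)
      have b2 := a2 x hx
      have e : ∑ y ∈ Ioc (l Q x) Q, u x y - Q * (v x * φ ((x:ℝ)/Q))
        = (∑ y ∈ Ioc (l Q x) Q, u x y - ((Q:ℝ) - l Q x) * ((∑ y ∈ range W, u x y) / W))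
          + v x * (((Q:ℝ) - l Q x) - Q * φ ((x:ℝ)/Q)) := by simp only [hv]; ring
      rw [e]
      refine (abs_add_le _ _).trans (add_le_add b1 ?_)
      rw [abs_mul]
      exact mul_le_mul (hvV x) b2 (abs_nonneg _) hU0
    refine (sum_le_sum this).trans (le_of_eq ?_)
    simp; ring
  set A := ∑ x ∈ Icc 1 Q, ∑ y ∈ Ioc (l Q x) Q, w x y
  set B := ∑ x ∈ Icc 1 Q, ∑ y ∈ Ioc (l Q x) Q, u x y
  set D := ∑ x ∈ Icc 1 Q, v x * φ ((x:ℝ)/Q)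
  have e : A / (Q:ℝ)^2 - C * I = (A - B) / (Q:ℝ)^2 + (B - Q * D) / (Q:ℝ)^2 + (D / Q - mu * I)
    + (mu - C) * I := by field_simp; ring
  rw [e]
  have d1 : |(A - B) / (Q:ℝ)^2| ≤ ε := by
    rw [abs_div, abs_of_pos (by positivity : (0:ℝ) < (Q:ℝ)^2), div_le_iff₀ (by positivity)]; exact c1
  have d2 : |(B - Q * D) / (Q:ℝ)^2| < δ / 8 := by
    refine lt_of_le_of_lt ?_ a1
    rw [abs_div, abs_of_pos (by positivity : (0:ℝ) < (Q:ℝ)^2), div_le_iff₀ (by positivity)]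
    refine c2.trans (le_of_eq ?_)
    field_simp
  have d4 : |(mu - C) * I| ≤ ε * |I| := by rw [abs_mul]; gcongr
  have d5 : ε + ε * |I| = δ / 4 := by rw [hε]; field_simp
  have := abs_add_le ((A - B) / (Q:ℝ)^2 + (B - Q * D) / (Q:ℝ)^2 + (D / Q - mu * I)) ((mu - C) * I)
  have := abs_add_three ((A - B) / (Q:ℝ)^2) ((B - Q * D) / (Q:ℝ)^2) (D / Q - mu * I)
  linarith


/-- admissible solution predicate -/
def adm {R : Type} [CommRing R] (μ : R) (z x : R × R) : Prop :=
  x.1 * z.2 - x.2 * z.1 = μ ∧ IsCoprime (x.1 * (x.1 + 1)) z.1 ∧ IsCoprime (x.2 * (x.2 + 1)) z.2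

noncomputable def cnt (R : Type) [CommRing R] (μ : R) (z : R × R) : ℕ :=
  Nat.card {x : R × R // adm μ z x}

noncomputable def tot (R : Type) [CommRing R] (μ : R) : ℕ :=
  Nat.card {y : (R × R) × (R × R) // adm μ y.1 y.2}

lemma tot_eq_sum (R : Type) [CommRing R] [Fintype R] (μ : R) :
    tot R μ = ∑ q : R, ∑ r : R, cnt R μ (q, r) := by
  unfold tot cnt
  rw [Nat.card_congr (Equiv.subtypeProdEquivSigmaSubtype (fun z x => adm μ z x)), Nat.card_sigma,
    Fintype.sum_prod_type]

lemma isCoprime_prod {R S : Type} [CommRing R] [CommRing S] (x y : R × S) :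
    IsCoprime x y ↔ IsCoprime x.1 y.1 ∧ IsCoprime x.2 y.2 := by
  constructor
  · intro h
    exact ⟨h.map (RingHom.fst R S), h.map (RingHom.snd R S)⟩
  · rintro ⟨⟨a, b, h⟩, ⟨c, d, k⟩⟩
    exact ⟨(a, c), (b, d), Prod.ext h k⟩

lemma isCoprime_equiv {R S : Type} [CommRing R] [CommRing S] (e : R ≃+* S) (x y : R) :
    IsCoprime (e x) (e y) ↔ IsCoprime x y := by
  constructor
  · intro h
    simpa using h.map (e.symm : S →+* R)
  · intro h
    exact h.map (e : R →+* S)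

lemma adm_prod {R S : Type} [CommRing R] [CommRing S] (μ : R × S) (z x : (R × S) × (R × S)) :
    adm μ z x ↔ adm μ.1 (z.1.1, z.2.1) (x.1.1, x.2.1) ∧ adm μ.2 (z.1.2, z.2.2) (x.1.2, x.2.2) := by
  unfold adm
  rw [isCoprime_prod, isCoprime_prod, Prod.ext_iff]
  simp
  tauto

lemma adm_equiv {R S : Type} [CommRing R] [CommRing S] (e : R ≃+* S) (μ : R) (z x : R × R) :
    adm (e μ) (e z.1, e z.2) (e x.1, e x.2) ↔ adm μ z x := by
  unfold adm
  simp only [← map_mul, ← map_sub, ← map_one e, ← map_add, isCoprime_equiv, e.injective.eq_iff]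

lemma cnt_prod {R S : Type} [CommRing R] [CommRing S] (μ : R × S) (z : (R × S) × (R × S)) :
    cnt (R × S) μ z = cnt R μ.1 (z.1.1, z.2.1) * cnt S μ.2 (z.1.2, z.2.2) := by
  unfold cnt
  rw [← Nat.card_prod]
  refine Nat.card_congr ?_
  refine ((Equiv.prodProdProdComm R S R S).subtypeEquiv (fun x => ?_)).trans
    (Equiv.subtypeProdEquivProd (p := fun x => adm μ.1 (z.1.1, z.2.1) x)
      (q := fun x => adm μ.2 (z.1.2, z.2.2) x))
  exact adm_prod μ z x

lemma cnt_equiv {R S : Type} [CommRing R] [CommRing S] (e : R ≃+* S) (μ : R) (z : R × R) :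
    cnt R μ z = cnt S (e μ) (e z.1, e z.2) := by
  unfold cnt
  refine Nat.card_congr ((e.toEquiv.prodCongr e.toEquiv).subtypeEquiv fun x => ?_)
  exact (adm_equiv e μ z x).symm

lemma tot_prod {R S : Type} [CommRing R] [CommRing S] (μ : R × S) :
    tot (R × S) μ = tot R μ.1 * tot S μ.2 := by
  unfold tot
  rw [← Nat.card_prod]
  refine Nat.card_congr ?_
  refine ((((Equiv.prodProdProdComm R S R S).prodCongr (Equiv.prodProdProdComm R S R S)).trans
    (Equiv.prodProdProdComm (R × R) (S × S) (R × R) (S × S))).subtypeEquiv (fun x => ?_)).trans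
    (Equiv.subtypeProdEquivProd (p := fun y : (R × R) × (R × R) => adm μ.1 y.1 y.2)
      (q := fun y : (S × S) × (S × S) => adm μ.2 y.1 y.2))
  exact adm_prod μ x.1 x.2

lemma tot_equiv {R S : Type} [CommRing R] [CommRing S] (e : R ≃+* S) (μ : R) :
    tot R μ = tot S (e μ) := by
  unfold tot
  refine Nat.card_congr (((e.toEquiv.prodCongr e.toEquiv).prodCongr
    (e.toEquiv.prodCongr e.toEquiv)).subtypeEquiv fun x => ?_)
  exact (adm_equiv e μ x.1 x.2).symm

lemma cnt_mul {A B : ℕ} (h : A.Coprime B) (m q r : ℕ) :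
    cnt (ZMod (A * B)) m (q, r) = cnt (ZMod A) m (q, r) * cnt (ZMod B) m (q, r) := by
  rw [cnt_equiv (ZMod.chineseRemainder h), cnt_prod]
  simp

lemma tot_mul {A B : ℕ} (h : A.Coprime B) (m : ℕ) :
    tot (ZMod (A * B)) m = tot (ZMod A) m * tot (ZMod B) m := by
  rw [tot_equiv (ZMod.chineseRemainder h), tot_prod]
  simp

lemma tot_one (m : ℕ) : tot (ZMod 1) m = 1 := by
  unfold tot
  rw [Nat.card_eq_one_iff_unique]
  refine ⟨⟨fun a b => Subsingleton.elim _ _⟩, ⟨⟨0, ?_⟩⟩⟩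
  refine ⟨Subsingleton.elim _ _, ?_, ?_⟩ <;> exact ⟨0, 0, Subsingleton.elim _ _⟩

/-- number of coprime pairs -/
noncomputable def tot2 (R : Type) [CommRing R] : ℕ :=
  Nat.card {y : R × R // IsCoprime (y.1 * (y.1 + 1)) y.2}

lemma tot2_mul {A B : ℕ} (h : A.Coprime B) :
    tot2 (ZMod (A * B)) = tot2 (ZMod A) * tot2 (ZMod B) := by
  unfold tot2
  rw [← Nat.card_prod]
  have e := ZMod.chineseRemainder h
  refine Nat.card_congr ?_
  refine (((e.toEquiv.prodCongr e.toEquiv).trans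
    (Equiv.prodProdProdComm (ZMod A) (ZMod B) (ZMod A) (ZMod B))).subtypeEquiv (fun x => ?_)).trans
    (Equiv.subtypeProdEquivProd (p := fun y : ZMod A × ZMod A => IsCoprime (y.1 * (y.1 + 1)) y.2)
      (q := fun y : ZMod B × ZMod B => IsCoprime (y.1 * (y.1 + 1)) y.2))
  rw [← isCoprime_equiv e, isCoprime_prod]
  simp

lemma tot2_one : tot2 (ZMod 1) = 1 := by
  unfold tot2
  rw [Nat.card_eq_one_iff_unique]
  refine ⟨⟨fun a b => Subsingleton.elim _ _⟩, ⟨⟨0, ?_⟩⟩⟩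
  exact ⟨0, 0, Subsingleton.elim _ _⟩


lemma fib_card {R F : Type} [CommRing R] [Fintype R] [Field F] [DecidableEq F]
    (π : R →+* F) (hs : Function.Surjective π) (t : F) :
    (univ.filter (fun x => π x = t)).card = (univ.filter (fun x => π x = 0)).card := by
  obtain ⟨y, rfl⟩ := hs t
  refine card_nbij' (fun x => x - y) (fun x => x + y) ?_ ?_ ?_ ?_ <;> intro x <;> simp +contextual

lemma pre_card {R F : Type} [CommRing R] [Fintype R] [Field F] [DecidableEq F]
    (π : R →+* F) (hs : Function.Surjective π) (T : Finset F) :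
    (univ.filter (fun x => π x ∈ T)).card = T.card * (univ.filter (fun x => π x = 0)).card := by
  rw [card_eq_sum_card_fiberwise (f := π) (t := T) (by intro x; simp)]
  rw [← smul_eq_mul, ← sum_const]
  refine sum_congr rfl fun t ht => ?_
  rw [← fib_card π hs t, filter_filter]
  congr 1; ext x; simp; rintro rfl; exact ht

lemma isCoprime_loc {R F : Type} [CommRing R] [Field F]
    (π : R →+* F) (hu : ∀ x, π x ≠ 0 → IsUnit x) (x y : R) :
    IsCoprime x y ↔ π x ≠ 0 ∨ π y ≠ 0 := by
  constructor
  · intro h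
    by_contra! hc
    have := h.map π
    rw [hc.1, hc.2] at this
    obtain ⟨a, b, h⟩ := this
    simp at h
  · rintro (h | h)
    · obtain ⟨c, hc⟩ := (hu x h).exists_left_inv
      exact ⟨c, 0, by simp [hc]⟩
    · obtain ⟨c, hc⟩ := (hu y h).exists_left_inv
      exact ⟨0, c, by simp [hc]⟩

lemma cnt_swap {R : Type} [CommRing R] (μ q r : R) : cnt R μ (q, r) = cnt R (-μ) (r, q) := by
  unfold cnt
  refine Nat.card_congr ((Equiv.prodComm R R).subtypeEquiv fun x => ?_)
  unfold adm
  simp only [Equiv.prodComm_apply, Prod.fst_swap, Prod.snd_swap]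
  constructor
  · rintro ⟨h1, h2, h3⟩; exact ⟨by rw [← h1]; ring, h3, h2⟩
  · rintro ⟨h1, h2, h3⟩; exact ⟨by rw [← neg_neg μ, ← h1]; ring, h3, h2⟩

lemma cnt_unit {R : Type} [CommRing R] [Fintype R] (μ q r q1 : R) (hq : q1 * q = 1) :
    cnt R μ (q, r) = Nat.card {a : R // IsCoprime (((a * r - μ) * q1) * ((a * r - μ) * q1 + 1)) r} := by
  unfold cnt
  refine Nat.card_congr ⟨fun x => ⟨x.1.1, ?_⟩, fun a => ⟨(a.1, (a.1 * r - μ) * q1), ?_⟩, ?_, ?_⟩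
  · have h := x.2
    have : (x.1.1 * r - μ) * q1 = x.1.2 := by
      have h1 : x.1.1 * r - x.1.2 * q = μ := h.1
      linear_combination x.1.2 * hq + q1 * h1
    rw [this]; exact h.2.2
  · refine ⟨?_, ⟨0, q1, by simp [hq]⟩, a.2⟩
    calc a.1 * r - (a.1 * r - μ) * q1 * q = a.1 * r - (a.1 * r - μ) * (q1 * q) := by ring
      _ = _ := by rw [hq]; ring
  · intro x
    have h := x.2
    apply Subtype.ext
    refine Prod.ext rfl ?_
    show (x.1.1 * r - μ) * q1 = x.1.2
    have h1 : x.1.1 * r - x.1.2 * q = μ := h.1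
    linear_combination x.1.2 * hq + q1 * h1
  · intro a; rfl

lemma cnt_UU {R F : Type} [CommRing R] [Fintype R] [Field F]
    (π : R →+* F) (hu : ∀ x, π x ≠ 0 → IsUnit x) (μ q r : R) (hq : π q ≠ 0) (hr : π r ≠ 0) :
    cnt R μ (q, r) = Fintype.card R := by
  obtain ⟨c, hc⟩ := (hu q hq).exists_left_inv
  rw [cnt_unit μ q r c hc, ← Nat.card_eq_fintype_card]
  refine Nat.card_congr (Equiv.subtypeUnivEquiv fun a => ?_)
  rw [isCoprime_loc π hu]; right; exact hr

lemma cnt_UI {R F : Type} [CommRing R] [Fintype R] [Field F] [DecidableEq F]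
    (π : R →+* F) (hu : ∀ x, π x ≠ 0 → IsUnit x) (μ q r : R) (hq : π q ≠ 0) (hr : π r = 0) :
    cnt R μ (q, r) = if π μ ≠ 0 ∧ π q ≠ π μ then Fintype.card R else 0 := by
  obtain ⟨c, hc⟩ := (hu q hq).exists_left_inv
  rw [cnt_unit μ q r c hc]
  have hcq : π c * π q = 1 := by rw [← map_mul, hc, map_one]
  have hc0 : π c ≠ 0 := left_ne_zero_of_mul_eq_one hcq
  have key : ∀ a, IsCoprime (((a * r - μ) * c) * ((a * r - μ) * c + 1)) r ↔ π μ ≠ 0 ∧ π q ≠ π μ := by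
    intro a
    rw [isCoprime_loc π hu]
    simp only [hr, map_mul, map_sub, map_add, map_one, mul_zero, zero_sub, ne_eq, not_true, or_false,
      mul_eq_zero, neg_eq_zero, hc0, not_or]
    have : (-π μ * π c + 1 = 0) ↔ π q = π μ := by
      constructor
      · intro h
        have : π c * (π q - π μ) = 0 := by rw [mul_sub, hcq, ← h]; ring
        rcases mul_eq_zero.mp this with h | h
        · exact absurd h hc0
        · exact sub_eq_zero.mp h
      · intro h; rw [← h, neg_mul, mul_comm, hcq]; ring
    rw [this]
  split_ifs with h
  · rw [← Nat.card_eq_fintype_card]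
    exact Nat.card_congr (Equiv.subtypeUnivEquiv fun a => (key a).mpr h)
  · have : IsEmpty {a : R // IsCoprime (((a * r - μ) * c) * ((a * r - μ) * c + 1)) r} :=
      ⟨fun a => h ((key a.1).mp a.2)⟩
    exact Nat.card_of_isEmpty

lemma sum_II {R F : Type} [CommRing R] [Fintype R] [Field F] [DecidableEq F]
    (π : R →+* F) (hu : ∀ x, π x ≠ 0 → IsUnit x) (μ : R) :
    ∑ q ∈ univ.filter (fun x => π x = 0), ∑ r ∈ univ.filter (fun x => π x = 0), cnt R μ (q, r)
    = if π μ = 0 then (univ.filter (fun x => π x ≠ 0 ∧ π x ≠ -1)).card ^ 2 *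
        (univ.filter (fun x => π x = 0)).card else 0 := by
  classical
  set I := univ.filter (fun x => π x = 0) with hI
  set G := univ.filter (fun x => π x ≠ 0 ∧ π x ≠ -1) with hG
  have h1 : ∀ q ∈ I, ∀ r ∈ I, cnt R μ (q, r)
      = ∑ a ∈ G, ∑ b ∈ G, if a * r - b * q = μ then 1 else 0 := by
    intro q hq r hr
    simp only [hI, mem_filter, mem_univ, true_and] at hq hr
    unfold cnt
    rw [← sum_product', ← card_filter, Nat.card_eq_fintype_card, Fintype.card_subtype]
    congr 1
    ext x
    simp only [mem_filter, mem_univ, true_and, mem_product, hG]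
    unfold adm
    rw [isCoprime_loc π hu, isCoprime_loc π hu]
    simp only [hq, hr, map_mul, map_add, map_one, ne_eq, not_true, or_false, mul_eq_zero, not_or,
      add_eq_zero_iff_eq_neg]
    tauto
  rw [sum_congr rfl fun q hq => sum_congr rfl fun r hr => h1 q hq r hr]
  have h2 : ∑ q ∈ I, ∑ r ∈ I, ∑ a ∈ G, ∑ b ∈ G, (if a * r - b * q = μ then 1 else 0)
      = ∑ q ∈ I, ∑ a ∈ G, ∑ b ∈ G, ∑ r ∈ I, if a * r - b * q = μ then 1 else 0 := by
    refine sum_congr rfl fun q _ => ?_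
    rw [sum_comm]
    refine sum_congr rfl fun a _ => ?_
    rw [sum_comm]
  rw [h2]
  have h3 : ∀ q ∈ I, ∀ a ∈ G, ∀ b ∈ G, ∑ r ∈ I, (if a * r - b * q = μ then 1 else 0)
      = if π μ = 0 then 1 else 0 := by
    intro q hq a ha b hb
    simp only [hI, hG, mem_filter, mem_univ, true_and] at hq ha hb
    obtain ⟨c, hc⟩ := (hu a ha.1).exists_left_inv
    have hcq : π c * π a = 1 := by rw [← map_mul, hc, map_one]
    have hc0 : π c ≠ 0 := left_ne_zero_of_mul_eq_one hcq
    rw [← card_filter]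
    have e : ∀ r, a * r - b * q = μ ↔ r = c * (μ + b * q) := by
      intro r
      constructor
      · intro h; rw [← h]
        calc r = (c * a) * r := by rw [hc, one_mul]
          _ = _ := by ring
      · rintro rfl
        calc _ = (c * a) * (μ + b * q) - b * q := by ring
          _ = _ := by rw [hc]; ring
    simp only [e]
    split_ifs with h
    · rw [card_eq_one]
      refine ⟨c * (μ + b * q), ?_⟩
      ext r
      simp only [hI, mem_filter, mem_univ, true_and, mem_singleton]
      constructor
      · exact fun h => h.2
      · rintro rfl; exact ⟨by simp [hq, h], rfl⟩
    · rw [card_eq_zero]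
      ext r
      simp only [hI, mem_filter, mem_univ, true_and]
      constructor
      · rintro ⟨h1, rfl⟩
        simp [hq, hc0] at h1
        exact absurd h1 h
      · simp
  rw [sum_congr rfl fun q hq => sum_congr rfl fun a ha => sum_congr rfl fun b hb => h3 q hq a ha b hb]
  simp only [sum_const, smul_eq_mul]
  split_ifs
  · ring
  · simp

lemma tot_local {R F : Type} [CommRing R] [Fintype R] [Field F] [Fintype F] [DecidableEq F]
    (π : R →+* F) (hs : Function.Surjective π) (hu : ∀ x, π x ≠ 0 → IsUnit x) (μ : R) (p u : ℕ)
    (hp : Fintype.card F = p) (hI : (univ.filter (fun x => π x = 0)).card = u) :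
    tot R μ = (p * u) * ((p - 1) * u) ^ 2 + if π μ = 0 then (p - 2)^2 * u ^ 3
      else 2 * ((p - 2) * u ^ 2 * (p * u)) := by
  have hR : Fintype.card R = p * u := by
    have := pre_card π hs univ
    rw [hI, card_univ, hp] at this
    rw [← this]; simp
  have hU : (univ.filter (fun x => ¬ π x = 0)).card = (p - 1) * u := by
    have := pre_card π hs (univ.erase 0)
    rw [hI, card_erase_of_mem (mem_univ _), card_univ, hp] at this
    rw [← this]; congr 1; ext x; simp
  have hG : ∀ t : F, t ≠ 0 → (univ.filter (fun x => π x ≠ 0 ∧ π x ≠ t)).card = (p - 2) * u := by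
    intro t ht
    have := pre_card π hs ((univ.erase 0).erase t)
    rw [hI, card_erase_of_mem (by simp [ht]), card_erase_of_mem (mem_univ _), card_univ, hp] at this
    rw [show p - 2 = p - 1 - 1 by omega, ← this]; congr 1; ext x; simp; tauto
  rw [tot_eq_sum]
  have split : ∀ f : R → ℕ, ∑ q, f q = ∑ q ∈ univ.filter (fun x => ¬ π x = 0), f q
      + ∑ q ∈ univ.filter (fun x => π x = 0), f q := by
    intro f
    rw [add_comm, sum_filter_add_sum_filter_not]
  rw [split]
  rw [sum_congr rfl (fun q _ => split _), sum_congr (s₁ := univ.filter (fun x => π x = 0)) rfl (fun q _ => split _)]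
  rw [sum_add_distrib, sum_add_distrib, sum_II π hu μ, hG (-1) (by simp), hI]
  have hUU : ∑ q ∈ univ.filter (fun x => ¬ π x = 0), ∑ r ∈ univ.filter (fun x => ¬ π x = 0),
      cnt R μ (q, r) = (p * u) * ((p - 1) * u) ^ 2 := by
    rw [sum_congr rfl fun q hq => sum_congr rfl fun r hr => cnt_UU π hu μ q r
      (by simpa using hq) (by simpa using hr)]
    simp only [sum_const, hU, hR, smul_eq_mul]; ring
  have hUI : ∀ μ : R, ∑ q ∈ univ.filter (fun x => ¬ π x = 0), ∑ r ∈ univ.filter (fun x => π x = 0),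
      cnt R μ (q, r) = if π μ = 0 then 0 else (p - 2) * u ^ 2 * (p * u) := by
    intro μ
    rw [sum_congr rfl fun q hq => sum_congr rfl fun r hr => cnt_UI π hu μ q r
      (by simpa using hq) (by simpa using hr)]
    simp only [sum_const, hI, hR, smul_eq_mul]
    split_ifs with h
    · simp [h]
    · rw [← mul_sum, ← sum_filter, filter_filter]
      simp only [sum_const, smul_eq_mul]
      have : (univ.filter (fun x => ¬ π x = 0 ∧ π μ ≠ 0 ∧ π x ≠ π μ)).card = (p - 2) * u := by
        rw [← hG (π μ) h]; congr 1; ext x; simp [h]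
      rw [this]; ring
  have hIU : ∑ q ∈ univ.filter (fun x => π x = 0), ∑ r ∈ univ.filter (fun x => ¬ π x = 0),
      cnt R μ (q, r) = if π μ = 0 then 0 else (p - 2) * u ^ 2 * (p * u) := by
    rw [sum_comm]
    have := hUI (-μ)
    simp only [cnt_swap (-μ), neg_neg, map_neg, neg_eq_zero] at this
    exact this
  rw [hUU, hUI, hIU]
  split_ifs <;> ring

lemma tot2_local {R F : Type} [CommRing R] [Fintype R] [Field F] [Fintype F] [DecidableEq F]
    (π : R →+* F) (hs : Function.Surjective π) (hu : ∀ x, π x ≠ 0 → IsUnit x) (p u : ℕ)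
    (hp : Fintype.card F = p) (hI : (univ.filter (fun x => π x = 0)).card = u) :
    tot2 R + 2 * u * u = (p * u) ^ 2 := by
  classical
  have hR : Fintype.card R = p * u := by
    have := pre_card π hs univ
    rw [hI, card_univ, hp] at this
    rw [← this]; simp
  have hB : (univ.filter (fun x => π x = 0 ∨ π x = -1)).card = 2 * u := by
    have := pre_card π hs {0, -1}
    rw [hI, card_pair (by simp)] at this
    rw [← this]; congr 1; ext x; simp
  have h1 : tot2 R = (univ.filter (fun y : R × R => ¬ (π y.1 = 0 ∨ π y.1 = -1) ∨ ¬ π y.2 = 0)).card := by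
    unfold tot2
    rw [Nat.card_eq_fintype_card, Fintype.card_subtype]
    congr 1; ext y
    simp only [mem_filter, mem_univ, true_and]
    rw [isCoprime_loc π hu]
    simp only [map_mul, map_add, map_one, ne_eq, mul_eq_zero, add_eq_zero_iff_eq_neg]
  have h2 : (univ.filter (fun y : R × R => ¬ (¬ (π y.1 = 0 ∨ π y.1 = -1) ∨ ¬ π y.2 = 0))).card
      = 2 * u * u := by
    rw [← hB]
    nth_rw 1 [← hI]
    rw [← card_product]
    congr 1; ext y; simp; tauto
  rw [h1, ← h2, card_filter_add_card_filter_not, card_univ, Fintype.card_prod, hR]; ring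


/-- local density -/
noncomputable def locd (p m : ℕ) : ℝ :=
  if p ∣ m then (1 - 1 / (p:ℝ)) ^ 2 + ((p:ℝ) - 2) ^ 2 / (p:ℝ) ^ 3 else 1 - 3 / (p:ℝ) ^ 2

lemma zmod_pp_unit {p k : ℕ} (hp : p.Prime) (hk : k ≠ 0) (x : ZMod (p ^ k))
    (h : ZMod.castHom (dvd_pow_self p hk) (ZMod p) x ≠ 0) : IsUnit x := by
  have : NeZero (p ^ k) := ⟨pow_ne_zero _ hp.ne_zero⟩
  obtain ⟨n, rfl⟩ := ZMod.natCast_zmod_surjective x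
  rw [map_natCast] at h
  rw [ZMod.isUnit_iff_coprime]
  refine Nat.Coprime.pow_right _ ?_
  rw [Nat.coprime_comm, hp.coprime_iff_not_dvd]
  intro h2
  exact h ((ZMod.natCast_eq_zero_iff _ _).mpr h2)

lemma ker_card_pp {p k : ℕ} [hp : Fact p.Prime] [NeZero (p ^ k)] (hk : k ≠ 0) :
    (univ.filter (fun x => ZMod.castHom (dvd_pow_self p hk) (ZMod p) x = 0)).card = p ^ (k - 1) := by
  have := pre_card (ZMod.castHom (dvd_pow_self p hk) (ZMod p)) (ZMod.ringHom_surjective _) univ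
  simp only [mem_univ, filter_true, card_univ, ZMod.card] at this
  have h2 : p ^ k = p * p ^ (k - 1) := by
    rw [← pow_succ']; congr 1; omega
  exact (Nat.eq_of_mul_eq_mul_left hp.out.pos (h2.symm.trans this)).symm

lemma tot_pp {p k : ℕ} (hp : p.Prime) (hk : k ≠ 0) (m : ℕ) :
    (tot (ZMod (p ^ k)) (m : ZMod (p ^ k)) : ℝ) = locd p m * ((p ^ k : ℕ) : ℝ) ^ 3 := by
  have : Fact p.Prime := ⟨hp⟩
  have : NeZero (p ^ k) := ⟨pow_ne_zero _ hp.ne_zero⟩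
  have := tot_local (ZMod.castHom (dvd_pow_self p hk) (ZMod p)) (ZMod.ringHom_surjective _)
    (zmod_pp_unit hp hk) (m : ZMod (p ^ k)) p (p ^ (k - 1)) (ZMod.card p) (ker_card_pp hk)
  rw [this]
  simp only [map_natCast, ZMod.natCast_eq_zero_iff]
  have h2 : p ^ k = p * p ^ (k - 1) := by
    rw [← pow_succ']; congr 1; omega
  rw [h2]
  have hp0 : (p:ℝ) ≠ 0 := by exact_mod_cast hp.ne_zero
  unfold locd
  have h2p := hp.two_le
  have h1p : 1 ≤ p := by omega
  split_ifs
  · push_cast [Nat.cast_sub h2p, Nat.cast_sub h1p]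
    field_simp
  · push_cast [Nat.cast_sub h2p, Nat.cast_sub h1p]
    field_simp
    ring

lemma tot2_pp {p k : ℕ} (hp : p.Prime) (hk : k ≠ 0) :
    (tot2 (ZMod (p ^ k)) : ℝ) = (1 - 2 / (p:ℝ) ^ 2) * ((p ^ k : ℕ) : ℝ) ^ 2 := by
  have : Fact p.Prime := ⟨hp⟩
  have : NeZero (p ^ k) := ⟨pow_ne_zero _ hp.ne_zero⟩
  have := tot2_local (ZMod.castHom (dvd_pow_self p hk) (ZMod p)) (ZMod.ringHom_surjective _)
    (zmod_pp_unit hp hk) p (p ^ (k - 1)) (ZMod.card p) (ker_card_pp hk)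
  have h2 : p ^ k = p * p ^ (k - 1) := by
    rw [← pow_succ']; congr 1; omega
  have hp0 : (p:ℝ) ≠ 0 := by exact_mod_cast hp.ne_zero
  have h3 : (tot2 (ZMod (p ^ k)) : ℝ) = ((p:ℝ) * (p:ℝ) ^ (k-1)) ^ 2 - 2 * (p:ℝ) ^ (k-1) * (p:ℝ) ^ (k-1) := by
    rw [eq_sub_iff_add_eq]; exact_mod_cast this
  rw [h3, h2]
  push_cast
  field_simp

lemma tot_prime_prod (W : ℕ) (hW : W ≠ 0) (m : ℕ) :
    (tot (ZMod W) (m : ZMod W) : ℝ) / (W:ℝ) ^ 3 = ∏ p ∈ W.primeFactors, locd p m := by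
  have h := Nat.multiplicative_factorization (fun W : ℕ => (tot (ZMod W) (m : ZMod W) : ℝ) / (W:ℝ) ^ 3)
    (fun x y hxy => by
      rw [tot_mul hxy]; push_cast; rw [mul_pow, mul_div_mul_comm])
    (by rw [tot_one]; norm_num) hW
  rw [h, Finsupp.prod, Nat.support_factorization]
  refine prod_congr rfl fun p hp => ?_
  have hpp := Nat.prime_of_mem_primeFactors hp
  have hk : W.factorization p ≠ 0 := by
    rw [← Finsupp.mem_support_iff, Nat.support_factorization]; exact hp
  rw [tot_pp hpp hk, mul_div_assoc, div_self, mul_one]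
  have := hpp.ne_zero
  positivity

lemma tot2_prime_prod (W : ℕ) (hW : W ≠ 0) :
    (tot2 (ZMod W) : ℝ) / (W:ℝ) ^ 2 = ∏ p ∈ W.primeFactors, (1 - 2 / (p:ℝ) ^ 2) := by
  have h := Nat.multiplicative_factorization (fun W : ℕ => (tot2 (ZMod W) : ℝ) / (W:ℝ) ^ 2)
    (fun x y hxy => by
      rw [tot2_mul hxy]; push_cast; rw [mul_pow, mul_div_mul_comm])
    (by rw [tot2_one]; norm_num) hW
  rw [h, Finsupp.prod, Nat.support_factorization]
  refine prod_congr rfl fun p hp => ?_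
  have hpp := Nat.prime_of_mem_primeFactors hp
  have hk : W.factorization p ≠ 0 := by
    rw [← Finsupp.mem_support_iff, Nat.support_factorization]; exact hp
  rw [tot2_pp hpp hk, mul_div_assoc, div_self, mul_one]
  have := hpp.ne_zero
  positivity


lemma zsum {M : Type} [AddCommMonoid M] (L : ℕ) [NeZero L] (g : ZMod L → M) :
    ∑ x, g x = ∑ A ∈ range L, g (A : ZMod L) := by
  symm
  refine sum_bij (fun A _ => (A : ZMod L)) (fun _ _ => mem_univ _) ?_ ?_ (fun _ _ => rfl)
  · intro a ha b hb h
    rw [ZMod.natCast_eq_natCast_iff] at h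
    exact Nat.ModEq.eq_of_lt_of_lt h (mem_range.mp ha) (mem_range.mp hb)
  · intro b _
    exact ⟨b.val, mem_range.mpr (ZMod.val_lt b), ZMod.natCast_zmod_val b⟩

lemma zsum1 {M : Type} [AddCommMonoid M] (L : ℕ) [NeZero L] (g : ZMod L → M) :
    ∑ x, g x = ∑ A ∈ range L, g ((A + 1 : ℕ) : ZMod L) := by
  rw [← Equiv.sum_comp (Equiv.addRight (1 : ZMod L)) g, zsum]
  simp

lemma sum_range_mul' {M : Type} [AddCommMonoid M] (q N : ℕ) (f : ℕ → M) :
    ∑ A ∈ range (q * N), f A = ∑ s ∈ range N, ∑ a ∈ range q, f (a + q * s) := by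
  induction N with
  | zero => simp
  | succ n ih => 
    rw [Nat.mul_succ, sum_range_add, ih, sum_range_succ]
    simp [add_comm]

lemma isCoprime_zmod {L q : ℕ} [NeZero L] (hq : q ∣ L) (x : ℕ) :
    IsCoprime (x : ZMod L) (q : ZMod L) ↔ Nat.Coprime x q := by
  constructor
  · intro h
    have h2 := h.map (ZMod.castHom hq (ZMod q))
    rw [map_natCast, map_natCast, ZMod.natCast_self, isCoprime_zero_right] at h2
    exact (ZMod.isUnit_iff_coprime _ _).mp h2
  · intro h
    have := (Nat.isCoprime_iff_coprime.mpr h).map (Int.castRingHom (ZMod L))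
    simpa using this

open scoped Classical in
/-- the arithmetic weight -/
noncomputable def wt (m q r : ℕ) : ℕ :=
  ∑ a ∈ Icc 1 q, ∑ b ∈ Icc 1 r, if ((q * r : ℕ) : ℤ) ∣ (a:ℤ) * r - b * q - m ∧
    Nat.Coprime (a * (a + 1)) q ∧ Nat.Coprime (b * (b + 1)) r then 1 else 0

lemma count_T (n : ℕ) (hn : 0 < n) (e : ℤ) (q : ℕ) :
    ((range (n * q)).filter (fun t : ℕ => (n:ℤ) ∣ e - t)).card = q := by
  rw [card_filter, sum_range_mul']
  have h1 : ∀ s ∈ range q, ∑ a ∈ range n, (if (n:ℤ) ∣ e - ((a + n * s : ℕ):ℤ) then 1 else 0) = 1 := by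
    intro s _
    rw [← card_filter, card_eq_one]
    refine ⟨(e % n).toNat, ?_⟩
    ext a
    have hn' : (n:ℤ) ≠ 0 := by exact_mod_cast hn.ne'
    have e1 := Int.emod_nonneg e hn'
    have e2 := Int.emod_lt_of_pos e (by exact_mod_cast hn : (0:ℤ) < n)
    have h3 : (n:ℤ) ∣ e - ((a + n * s : ℕ):ℤ) ↔ (n:ℤ) ∣ e - a := by
      push_cast
      rw [← sub_sub, dvd_sub_left (Dvd.intro _ rfl)]
    simp only [mem_filter, mem_range, mem_singleton]
    rw [h3, ← Int.emod_emod_of_dvd e (dvd_refl (n:ℤ)), ← Int.modEq_iff_dvd]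
    constructor
    · rintro ⟨h4, h5⟩
      have h6 : (a:ℤ) % n = e % n := h5
      rw [Int.emod_eq_of_lt (by positivity) (by exact_mod_cast h4)] at h6
      rw [Int.emod_emod_of_dvd e (dvd_refl (n:ℤ)), ← h6]; simp
    · intro h
      rw [Int.emod_emod_of_dvd e (dvd_refl (n:ℤ))] at h
      constructor
      · omega
      · have : (a:ℤ) = e % n := by omega
        rw [this]; exact Int.mod_modEq e n
  rw [sum_congr rfl h1]; simp

lemma cnt_eq_wt (m q r L : ℕ) (hL : 0 < L) (h : q * r ∣ L) :
    cnt (ZMod L) (m : ZMod L) ((q : ZMod L), (r : ZMod L)) = L * wt m q r := by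
  classical
  have : NeZero L := ⟨hL.ne'⟩
  obtain ⟨T, rfl⟩ := h
  have hq : 0 < q := by by_contra! h; simp_all
  have hr : 0 < r := by by_contra! h; simp_all
  have hT : 0 < T := by by_contra! h; simp_all
  unfold cnt
  rw [Nat.card_eq_fintype_card, Fintype.card_subtype, card_filter, Fintype.sum_prod_type, zsum1]
  have h1 : ∀ A : ℕ, ∑ y : ZMod (q * r * T), (if adm (m : ZMod (q * r * T)) ((q : ZMod (q * r * T)), (r : ZMod (q * r * T))) (((A + 1 : ℕ) : ZMod (q * r * T)), y) then 1 else 0)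
    = ∑ t ∈ range (q * T), ∑ b ∈ range r, if ((q * r * T : ℕ) : ℤ) ∣ ((A + 1 : ℕ) : ℤ) * r - ((b + r * t + 1 : ℕ) : ℤ) * q - m ∧
      Nat.Coprime ((A + 1) * (A + 1 + 1)) q ∧ Nat.Coprime ((b + r * t + 1) * (b + r * t + 1 + 1)) r then 1 else 0 := by
    intro A
    rw [zsum1, show range (q * r * T) = range (r * (q * T)) by congr 1; ring, sum_range_mul']
    refine sum_congr rfl fun t _ => sum_congr rfl fun b _ => ?_
    congr 1
    rw [eq_iff_iff]
    unfold adm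
    refine and_congr ?_ (and_congr ?_ ?_)
    · rw [← ZMod.intCast_zmod_eq_zero_iff_dvd, Int.cast_sub, sub_eq_zero]
      simp
    · rw [← isCoprime_zmod (L := q * r * T) (q := q) ⟨r * T, by ring⟩]
      push_cast; rfl
    · rw [← isCoprime_zmod (L := q * r * T) (q := r) ⟨q * T, by ring⟩]
      push_cast; rfl
  rw [sum_congr rfl fun A _ => h1 A, show range (q * r * T) = range (q * (r * T)) by congr 1; ring,
    sum_range_mul', sum_comm]
  unfold wt
  have hI : ∀ n : ℕ, ∀ f : ℕ → ℕ, ∑ a ∈ Icc 1 n, f a = ∑ a ∈ range n, f (a + 1) := by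
    intro n f
    rw [range_eq_Ico, sum_Ico_add' f 0 n 1]; rfl
  rw [hI, mul_sum]
  refine sum_congr rfl fun a _ => ?_
  rw [hI, mul_sum]
  rw [sum_congr rfl fun s _ => sum_comm, sum_comm]
  refine sum_congr rfl fun b _ => ?_
  have hper : ∀ x y n : ℕ, Nat.Coprime ((x + n * y + 1) * (x + n * y + 1 + 1)) n ↔
      Nat.Coprime ((x + 1) * (x + 1 + 1)) n := by
    intro x y n
    rw [Nat.coprime_mul_iff_left, Nat.coprime_mul_iff_left,
      show x + n * y + 1 = x + 1 + n * y by ring, show x + 1 + n * y + 1 = x + 1 + 1 + n * y by ring,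
      Nat.coprime_add_mul_left_left, Nat.coprime_add_mul_left_left]
  simp only [hper]
  by_cases hc : Nat.Coprime ((a + 1) * (a + 1 + 1)) q ∧ Nat.Coprime ((b + 1) * (b + 1 + 1)) r
  swap
  · simp [hc]
  have hc2 : ∀ p : Prop, (p ∧ Nat.Coprime ((a + 1) * (a + 1 + 1)) q ∧ Nat.Coprime ((b + 1) * (b + 1 + 1)) r) ↔ p := fun p => and_iff_left hc
  simp only [hc2]
  by_cases hd : ((q * r : ℕ) : ℤ) ∣ ((a + 1 : ℕ) : ℤ) * r - ((b + 1 : ℕ) : ℤ) * q - m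
  swap
  · rw [if_neg hd, mul_zero]
    refine sum_eq_zero fun s _ => sum_eq_zero fun t _ => ?_
    rw [if_neg]
    intro h2
    apply hd
    have h3 : ((q * r : ℕ) : ℤ) ∣ ((a + q * s + 1 : ℕ) : ℤ) * r - ((b + r * t + 1 : ℕ) : ℤ) * q - m := by
      refine dvd_trans ?_ h2
      exact_mod_cast Dvd.intro _ rfl
    have h4 : ((a + 1 : ℕ) : ℤ) * r - ((b + 1 : ℕ) : ℤ) * q - m
      = (((a + q * s + 1 : ℕ) : ℤ) * r - ((b + r * t + 1 : ℕ) : ℤ) * q - m) - ((q * r : ℕ) : ℤ) * (s - t) := by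
      push_cast; ring
    rw [h4]
    exact dvd_sub h3 (Dvd.intro _ rfl)
  · rw [if_pos hd, mul_one]
    obtain ⟨e, he⟩ := hd
    have h5 : ∀ s ∈ range (r * T), ∑ t ∈ range (q * T), (if ((q * r * T : ℕ) : ℤ) ∣ ((a + q * s + 1 : ℕ) : ℤ) * r - ((b + r * t + 1 : ℕ) : ℤ) * q - m then 1 else 0) = q := by
      intro s _
      rw [← card_filter]
      refine Eq.trans ?_ (count_T T hT (e + s) q)
      rw [mul_comm T q]
      refine congrArg Finset.card (filter_congr fun t _ => ?_)
      have h4 : ((a + q * s + 1 : ℕ) : ℤ) * r - ((b + r * t + 1 : ℕ) : ℤ) * q - m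
         = ((q * r : ℕ) : ℤ) * (e + s - t) := by
        rw [mul_sub, mul_add, ← he]
        push_cast; ring
      rw [h4, Nat.cast_mul (q * r) T]
      refine mul_dvd_mul_iff_left ?_
      have := hq.ne'
      have := hr.ne'
      positivity
    rw [sum_congr rfl h5]
    simp
    ring


/-- the linear form -/
def linf (R : Type) [CommRing R] (q r : R) : R × R →+ R where
  toFun x := x.1 * r - x.2 * q
  map_zero' := by simp
  map_add' x y := by simp; ring

lemma ker_fiber {R : Type} [CommRing R] [Finite R] (q r μ : R) (h : ∃ x, linf R q r x = μ) :
    Nat.card {x : R × R // linf R q r x = μ} = Nat.card (linf R q r).ker := by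
  obtain ⟨x0, h0⟩ := h
  refine Nat.card_congr ((Equiv.subRight x0).subtypeEquiv fun x => ?_)
  rw [AddMonoidHom.mem_ker, Equiv.subRight_apply, map_sub, h0, sub_eq_zero]

lemma ker_range (L : ℕ) [NeZero L] (q r : ZMod L) :
    Nat.card (linf (ZMod L) q r).ker * Nat.card (linf (ZMod L) q r).range = L * L := by
  have := (linf (ZMod L) q r).ker.card_mul_index
  rw [AddSubgroup.index_ker, Nat.card_prod, Nat.card_zmod] at this
  exact this

lemma cnt_le (L m : ℕ) (hL : 0 < L) (hm : 0 < m) (q r : ZMod L) :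
    cnt (ZMod L) (m : ZMod L) (q, r) ≤ L * m := by
  have : NeZero L := ⟨hL.ne'⟩
  by_cases h : ∃ x, linf (ZMod L) q r x = (m : ZMod L)
  · have h1 : cnt (ZMod L) (m : ZMod L) (q, r) ≤ Nat.card {x : ZMod L × ZMod L // linf (ZMod L) q r x = (m : ZMod L)} := by
      unfold cnt
      refine Nat.card_le_card_of_injective (fun x => ⟨x.1, x.2.1⟩) ?_
      intro x y h
      simpa [Subtype.ext_iff] using h
    rw [ker_fiber q r _ h] at h1
    have h2 := ker_range L q r
    have h3 : addOrderOf (m : ZMod L) ≤ Nat.card (linf (ZMod L) q r).range := by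
      refine AddSubgroup.addOrderOf_le_card _ (Set.toFinite _) ?_
      exact h
    have h4 : L ≤ addOrderOf (m : ZMod L) * m := by
      refine Nat.le_of_dvd ?_ ?_
      · exact Nat.mul_pos (addOrderOf_pos _) hm
      · rw [← ZMod.natCast_eq_zero_iff]
        push_cast
        rw [← nsmul_eq_mul]
        exact addOrderOf_nsmul_eq_zero _
    set K := Nat.card (linf (ZMod L) q r).ker
    set S := Nat.card (linf (ZMod L) q r).range
    have h5 : L ≤ S * m := h4.trans (Nat.mul_le_mul_right _ h3)
    have h6 : K * L ≤ (L * m) * L := by nlinarith [Nat.mul_le_mul_left K h5]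
    exact h1.trans (Nat.le_of_mul_le_mul_right h6 hL)
  · have : cnt (ZMod L) (m : ZMod L) (q, r) = 0 := by
      unfold cnt
      rw [Nat.card_eq_zero]
      left
      constructor
      rintro ⟨x, hx⟩
      exact h ⟨x, hx.1⟩
    omega

lemma cnt_full (L m : ℕ) (hL : 0 < L) (q r : ZMod L) (h1 : IsCoprime q r)
    (h2 : IsCoprime ((m : ZMod L) * (m + r)) q) (h3 : IsCoprime ((m : ZMod L) * (m - q)) r) :
    cnt (ZMod L) (m : ZMod L) (q, r) = L := by
  have : NeZero L := ⟨hL.ne'⟩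
  have hs : Function.Surjective (linf (ZMod L) q r) := by
    intro y
    obtain ⟨a, b, hab⟩ := h1
    refine ⟨(b * y, - a * y), ?_⟩
    show b * y * r - (- a * y) * q = y
    linear_combination y * hab
  have e1 : cnt (ZMod L) (m : ZMod L) (q, r) = Nat.card {x : ZMod L × ZMod L // linf (ZMod L) q r x = (m : ZMod L)} := by
    unfold cnt
    refine Nat.card_congr (Equiv.subtypeEquivRight fun x => ?_)
    refine ⟨fun h => h.1, fun h => ⟨h, ?_, ?_⟩⟩
    · have h' : x.1 * r - x.2 * q = m := h
      have : IsCoprime (x.1 * (x.1 + 1) * (r * r)) q := by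
        have := h2.add_mul_left_left (x.2 * (2 * m + x.2 * q + r))
        convert this using 1
        have e : x.1 * r = m + x.2 * q := by linear_combination h'
        calc _ = (x.1 * r) * (x.1 * r + r) := by ring
          _ = _ := by rw [e]; ring
      exact this.of_mul_left_left
    · have h' : x.1 * r - x.2 * q = m := h
      have : IsCoprime (x.2 * (x.2 + 1) * (q * q)) r := by
        have := h3.add_mul_left_left (x.1 * (- 2 * m + x.1 * r + q))
        convert this using 1
        have e : x.2 * q = x.1 * r - m := by linear_combination - h'
        calc _ = (x.2 * q) * (x.2 * q + q) := by ring
          _ = _ := by rw [e]; ring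
      exact this.of_mul_left_left
  rw [e1, ker_fiber q r _ (hs _)]
  have h4 := ker_range L q r
  rw [AddMonoidHom.range_eq_top.mpr hs, AddSubgroup.card_top, Nat.card_zmod] at h4
  exact Nat.eq_of_mul_eq_mul_right hL h4

lemma isCoprime_zmod_of (L : ℕ) (x y : ℤ) (h : ∀ p : ℕ, p.Prime → p ∣ L → ¬ ((p:ℤ) ∣ x ∧ (p:ℤ) ∣ y)) :
    IsCoprime (x : ZMod L) (y : ZMod L) := by
  have h1 : Nat.Coprime (Int.gcd x y) L := by
    refine Nat.Coprime.symm (Nat.Coprime.symm (Nat.coprime_of_dvd fun p hp h1 h2 => ?_))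
    refine h p hp h2 ⟨?_, ?_⟩
    · exact (Int.natCast_dvd_natCast.mpr h1).trans (Int.gcd_dvd_left ..)
    · exact (Int.natCast_dvd_natCast.mpr h1).trans (Int.gcd_dvd_right ..)
  have h2 := (ZMod.isUnit_iff_coprime _ _).mpr h1
  obtain ⟨u, hu⟩ := h2.exists_left_inv
  have h3 := congrArg (Int.cast : ℤ → ZMod L) (Int.gcd_eq_gcd_ab x y)
  push_cast at h3
  refine ⟨u * (Int.gcdA x y : ZMod L), u * (Int.gcdB x y : ZMod L), ?_⟩
  rw [← hu, h3]; ring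

/-- good pairs -/
def good (z m q r : ℕ) : Prop :=
  (∀ p, p.Prime → p ≤ z → ¬ p ^ (z + 1) ∣ q ∧ ¬ p ^ (z + 1) ∣ r) ∧
  ∀ p, p.Prime → z < p → ¬ (p ∣ q ∧ p ∣ r) ∧ ¬ (p ∣ q ∧ p ∣ r + m) ∧ ¬ (p ∣ r ∧ (p : ℤ) ∣ q - m)

lemma good_eq (z m q r : ℕ) (hm : 0 < m) (hz : m ≤ z) (hq : 0 < q) (hr : 0 < r) (hg : good z m q r) :
    cnt (ZMod ((z.factorial) ^ (2 * z))) (m : ZMod _) ((q : ZMod _), (r : ZMod _))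
      = (z.factorial) ^ (2 * z) * wt m q r := by
  set W := (z.factorial) ^ (2 * z) with hWdef
  have hW : 0 < W := pow_pos z.factorial_pos _
  obtain ⟨L, hL⟩ := Nat.gcd_dvd_left (q * r) W
  have hqr : 0 < q * r := Nat.mul_pos hq hr
  have hL0 : 0 < L := by
    rcases Nat.eq_zero_or_pos L with h | h
    · rw [h, mul_zero] at hL; omega
    · exact h
  have hpz : ∀ p : ℕ, p.Prime → p ∣ W → p ≤ z := fun p hp h =>
    (hp.dvd_factorial).mp (hp.dvd_of_dvd_pow h)
  have hcop : W.Coprime L := by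
    refine Nat.coprime_of_dvd fun p hp h1 h2 => ?_
    have hple := hpz p hp h1
    obtain ⟨g1, g2⟩ := hg.1 p hp hple
    rw [hp.pow_dvd_iff_le_factorization hq.ne'] at g1
    rw [hp.pow_dvd_iff_le_factorization hr.ne'] at g2
    set v := (q * r).factorization p with hv
    have hvle : v ≤ 2 * z := by
      rw [hv, Nat.factorization_mul hq.ne' hr.ne', Finsupp.add_apply]; omega
    have d1 : p ^ v ∣ q * r := Nat.ordProj_dvd _ _
    have d2 : p ^ v ∣ W := (pow_dvd_pow p hvle).trans (pow_dvd_pow_of_dvd ((hp.dvd_factorial).mpr hple) _)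
    have d3 : p ^ v * p ∣ q * r := by
      conv_rhs => rw [hL]
      exact mul_dvd_mul (Nat.dvd_gcd d1 d2) h2
    rw [← pow_succ] at d3
    exact Nat.pow_succ_factorization_not_dvd hqr.ne' hp d3
  have hLp : ∀ p : ℕ, p.Prime → p ∣ L → z < p := by
    intro p hp h
    by_contra! h2
    rcases Nat.eq_zero_or_pos z with h0 | h0
    · have := hp.two_le; omega
    have : p ∣ W := dvd_pow ((hp.dvd_factorial).mpr h2) (by omega)
    exact Nat.not_coprime_of_dvd_of_dvd hp.one_lt this h hcop
  have hdiv : q * r ∣ W * L := by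
    conv_lhs => rw [hL]
    exact Nat.mul_dvd_mul_right (Nat.gcd_dvd_right _ _) L
  have e1 := cnt_eq_wt m q r (W * L) (Nat.mul_pos hW hL0) hdiv
  rw [cnt_mul hcop] at e1
  have hmp : ∀ p : ℕ, p.Prime → z < p → ¬ (p:ℤ) ∣ m := by
    intro p hp h1 h2
    have := Nat.le_of_dvd hm (Int.natCast_dvd_natCast.mp h2)
    omega
  have e2 : cnt (ZMod L) (m : ZMod L) ((q : ZMod L), (r : ZMod L)) = L := by
    refine cnt_full L m hL0 _ _ ?_ ?_ ?_
    · have := isCoprime_zmod_of L q r (fun p hp hpL h => (hg.2 p hp (hLp p hp hpL)).1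
        ⟨Int.natCast_dvd_natCast.mp h.1, Int.natCast_dvd_natCast.mp h.2⟩)
      simpa using this
    · have := isCoprime_zmod_of L (m * (m + r)) q (fun p hp hpL h => by
        have hz := hLp p hp hpL
        have hg := (hg.2 p hp hz).2.1
        rcases (Nat.prime_iff_prime_int.mp hp).dvd_or_dvd h.1 with h1 | h1
        · exact hmp p hp hz h1
        · refine hg ⟨Int.natCast_dvd_natCast.mp h.2, ?_⟩
          rw [add_comm]; exact_mod_cast h1)
      simpa using this
    · have := isCoprime_zmod_of L (m * (m - q)) r (fun p hp hpL h => by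
        have hz := hLp p hp hpL
        have hg := (hg.2 p hp hz).2.2
        rcases (Nat.prime_iff_prime_int.mp hp).dvd_or_dvd h.1 with h1 | h1
        · exact hmp p hp hz h1
        · exact hg ⟨Int.natCast_dvd_natCast.mp h.2, (dvd_sub_comm).mp h1⟩)
      simpa using this
  rw [e2] at e1
  refine Nat.eq_of_mul_eq_mul_right hL0 ?_
  rw [e1]; ring


open scoped Classical in
/-- indicator -/
noncomputable def ind (P : Prop) : ℝ := if P then 1 else 0

lemma ind_nonneg (P : Prop) : 0 ≤ ind P := by unfold ind; positivity
lemma ind_pos {P : Prop} (h : P) : ind P = 1 := if_pos h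
lemma ind_neg {P : Prop} (h : ¬ P) : ind P = 0 := if_neg h
lemma ind_iff {P P' : Prop} (h : P ↔ P') : ind P = ind P' := by rw [propext h]

lemma ind_sum {α : Type} (s : Finset α) (P : α → Prop) [DecidablePred P] :
    ∑ x ∈ s, ind (P x) = ((s.filter P).card : ℝ) := by
  rw [card_filter]
  push_cast
  refine sum_congr rfl fun x _ => ?_
  unfold ind
  split_ifs <;> rfl

open scoped Classical in
lemma cong_count (s : ℤ) (n Q : ℕ) (hn : 0 < n) (hnQ : n ≤ Q) :
    (((Icc 1 Q).filter (fun x : ℕ => (n:ℤ) ∣ x + s)).card : ℝ) ≤ 2 * Q / n := by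
  have h1 : ((Icc 1 Q).filter (fun x : ℕ => (n:ℤ) ∣ x + s)).card
      ≤ ((Ioc (0:ℤ) Q).filter (fun x => x ≡ -s [ZMOD n])).card := by
    refine card_le_card_of_injOn (fun x : ℕ => (x:ℤ)) ?_ ?_
    · intro x hx
      simp only [coe_filter, mem_Icc, Set.mem_ofPred_eq, mem_Ioc] at hx ⊢
      refine ⟨⟨by omega, by omega⟩, ?_⟩
      rw [Int.modEq_comm, Int.modEq_iff_dvd, sub_neg_eq_add]
      exact hx.2
    · intro x _ y _ h
      exact Nat.cast_injective h
  have h2 := Int.Ioc_filter_modEq_card (0:ℤ) Q (r := n) (by exact_mod_cast hn) (-s)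
  have hn' : (0:ℝ) < n := by exact_mod_cast hn
  have hnQ' : (n:ℝ) ≤ Q := by exact_mod_cast hnQ
  have h3 : (((Ioc (0:ℤ) Q).filter (fun x => x ≡ -s [ZMOD n])).card : ℝ) ≤ Q / n + 1 := by
    have : ((((Ioc (0:ℤ) Q).filter (fun x => x ≡ -s [ZMOD n])).card : ℤ) : ℝ) ≤ Q / n + 1 := by
      rw [h2]
      rw [Int.cast_max]
      refine max_le ?_ (by push_cast; positivity)
      push_cast
      have a1 := Int.floor_le (((Q:ℤ) - (-s : ℤ) : ℚ) / ((n:ℕ):ℤ) : ℚ)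
      have a2 := Int.lt_floor_add_one ((((0:ℤ):ℚ) - (-s : ℤ) : ℚ) / ((n:ℕ):ℤ) : ℚ)
      have hnq : (0:ℚ) < n := by exact_mod_cast hn
      have a3 : ((⌊(((Q:ℤ) - (-s : ℤ) : ℚ) / ((n:ℕ):ℤ) : ℚ)⌋ : ℚ) - (⌊((((0:ℤ):ℚ) - (-s : ℤ) : ℚ) / ((n:ℕ):ℤ) : ℚ)⌋ : ℚ)) ≤ Q / n + 1 := by
        have : (((Q:ℤ) - (-s : ℤ) : ℚ) / ((n:ℕ):ℤ) : ℚ) = Q / n + ((((0:ℤ):ℚ) - (-s : ℤ) : ℚ) / ((n:ℕ):ℤ) : ℚ) := by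
          push_cast; field_simp; ring
        linarith
      have := (Rat.cast_le (K := ℝ)).mpr a3
      push_cast at this
      simpa using this
    simpa using this
  have h4 : (1:ℝ) ≤ Q / n := by rw [le_div_iff₀ hn']; linarith
  have h1' : (((Icc 1 Q).filter (fun x : ℕ => (n:ℤ) ∣ x + s)).card : ℝ) ≤ (((Ioc (0:ℤ) Q).filter (fun x => x ≡ -s [ZMOD n])).card : ℝ) := by
    exact_mod_cast h1
  rw [mul_div_assoc]
  linarith

open scoped Classical in
lemma bigbad (s t : ℤ) (z Q : ℕ) (hz : 0 < z) :
    ∑ x ∈ Icc 1 Q, ∑ y ∈ Icc 1 Q, (ind (∃ n ∈ Ioc z Q, (n:ℤ) ∣ (x:ℤ) + s ∧ (n:ℤ) ∣ (y:ℤ) + t))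
      ≤ 4 / z * (Q:ℝ) ^ 2 := by
  have h1 : ∀ x y : ℕ, (ind (∃ n ∈ Ioc z Q, (n:ℤ) ∣ (x:ℤ) + s ∧ (n:ℤ) ∣ (y:ℤ) + t))
      ≤ ∑ n ∈ Ioc z Q, (ind ((n:ℤ) ∣ (x:ℤ) + s)) * (ind ((n:ℤ) ∣ (y:ℤ) + t)) := by
    intro x y
    have hnn : ∀ n ∈ Ioc z Q, 0 ≤ (ind ((n:ℤ) ∣ (x:ℤ) + s)) * (ind ((n:ℤ) ∣ (y:ℤ) + t)) := by
      intro n _; simp only [mul_nonneg, ind_nonneg]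
    by_cases h : ∃ n ∈ Ioc z Q, (n:ℤ) ∣ (x:ℤ) + s ∧ (n:ℤ) ∣ (y:ℤ) + t
    · rw [ind_pos h]
      obtain ⟨n, hn, h2, h3⟩ := h
      have := single_le_sum hnn hn
      rw [ind_pos h2, ind_pos h3] at this
      linarith
    · rw [ind_neg h]; exact sum_nonneg hnn
  calc _ ≤ ∑ x ∈ Icc 1 Q, ∑ y ∈ Icc 1 Q, ∑ n ∈ Ioc z Q, (ind ((n:ℤ) ∣ (x:ℤ) + s)) * (ind ((n:ℤ) ∣ (y:ℤ) + t)) :=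
        sum_le_sum fun x _ => sum_le_sum fun y _ => h1 x y
    _ = ∑ n ∈ Ioc z Q, (∑ x ∈ Icc 1 Q, (ind ((n:ℤ) ∣ (x:ℤ) + s))) * (∑ y ∈ Icc 1 Q, ind ((n:ℤ) ∣ (y:ℤ) + t)) := by
        rw [sum_congr rfl fun x _ => sum_comm, sum_comm]
        refine sum_congr rfl fun n _ => ?_
        rw [sum_mul_sum]
    _ ≤ ∑ n ∈ Ioc z Q, (2 * Q / n : ℝ) * (2 * Q / n) := by
        refine sum_le_sum fun n hn => ?_
        rw [mem_Ioc] at hn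
        have hc : ∀ s : ℤ, ∑ x ∈ Icc 1 Q, (ind ((n:ℤ) ∣ (x:ℤ) + s)) ≤ 2 * Q / n := by
          intro s
          have := cong_count s n Q (by omega) hn.2
          rwa [← ind_sum] at this
        exact mul_le_mul (hc s) (hc t) (sum_nonneg fun _ _ => ind_nonneg _) (by positivity)
    _ = 4 * (Q:ℝ) ^ 2 * ∑ n ∈ Ioc z Q, ((n:ℝ) ^ 2)⁻¹ := by
        rw [mul_sum]
        refine sum_congr rfl fun n hn => ?_
        field_simp; ring
    _ ≤ 4 * (Q:ℝ) ^ 2 * (z:ℝ)⁻¹ := by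
        refine mul_le_mul_of_nonneg_left ?_ (by positivity)
        rcases le_or_gt z Q with h | h
        · have := sum_Ioc_inv_sq_le_sub (α := ℝ) hz.ne' h
          have : (0:ℝ) ≤ (Q:ℝ)⁻¹ := by positivity
          linarith
        · rw [Ioc_eq_empty (by omega)]; simp
    _ = _ := by ring

open scoped Classical in
lemma smallbad (z Q : ℕ) :
    ∑ x ∈ Icc 1 Q, (ind (∃ p ∈ Icc 2 z, p ^ (z + 1) ∣ x)) ≤ z / 2 ^ z * Q := by
  have h1 : ∀ x : ℕ, (ind (∃ p ∈ Icc 2 z, p ^ (z + 1) ∣ x)) ≤ ∑ p ∈ Icc 2 z, ind (p ^ (z + 1) ∣ x) := by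
    intro x
    have hnn : ∀ p ∈ Icc 2 z, 0 ≤ ind (p ^ (z + 1) ∣ x) := by
      intro n _; simp only [mul_nonneg, ind_nonneg]
    by_cases h : ∃ p ∈ Icc 2 z, p ^ (z + 1) ∣ x
    · rw [ind_pos h]
      obtain ⟨n, hn, h2⟩ := h
      have := single_le_sum hnn hn
      rw [ind_pos h2] at this
      linarith
    · rw [ind_neg h]; exact sum_nonneg hnn
  calc _ ≤ ∑ x ∈ Icc 1 Q, ∑ p ∈ Icc 2 z, (ind (p ^ (z + 1) ∣ x)) := sum_le_sum fun x _ => h1 x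
    _ = ∑ p ∈ Icc 2 z, ∑ x ∈ Icc 1 Q, (ind (p ^ (z + 1) ∣ x)) := sum_comm
    _ ≤ ∑ p ∈ Icc 2 z, (Q:ℝ) / 2 ^ z := by
        refine sum_le_sum fun p hp => ?_
        rw [mem_Icc] at hp
        have : ∑ x ∈ Icc 1 Q, (ind (p ^ (z + 1) ∣ x)) = ((Q / p ^ (z + 1) : ℕ) : ℝ) := by
          rw [← Nat.Ioc_filter_dvd_card_eq_div, ind_sum]
          rfl
        rw [this]
        refine Nat.cast_div_le.trans ?_
        push_cast
        gcongr
        have h2 : (2:ℝ) ≤ p := by exact_mod_cast hp.1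
        calc (2:ℝ) ^ z ≤ 2 ^ (z + 1) := pow_le_pow_right₀ (by norm_num) (by omega)
          _ ≤ (p:ℝ) ^ (z + 1) := by gcongr
    _ ≤ z * ((Q:ℝ) / 2 ^ z) := by
        rw [sum_const, nsmul_eq_mul]
        gcongr
        simp
    _ = _ := by ring

open scoped Classical in
lemma badsum (z m Q : ℕ) (hz : 0 < z) :
    ∑ x ∈ Icc 1 Q, ∑ y ∈ Icc 1 Q, (ind (¬ good z m x y))
      ≤ (2 * (z / 2 ^ z) + 12 / z) * (Q:ℝ) ^ 2 := by
  have h1 : ∀ x ∈ Icc 1 Q, ∀ y ∈ Icc 1 Q, (ind (¬ good z m x y)) ≤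
      (ind (∃ p ∈ Icc 2 z, p ^ (z + 1) ∣ x)) + (ind (∃ p ∈ Icc 2 z, p ^ (z + 1) ∣ y))
      + (ind (∃ n ∈ Ioc z Q, (n:ℤ) ∣ (x:ℤ) + 0 ∧ (n:ℤ) ∣ (y:ℤ) + 0))
      + (ind (∃ n ∈ Ioc z Q, (n:ℤ) ∣ (x:ℤ) + 0 ∧ (n:ℤ) ∣ (y:ℤ) + m))
      + (ind (∃ n ∈ Ioc z Q, (n:ℤ) ∣ (x:ℤ) + (-m) ∧ (n:ℤ) ∣ (y:ℤ) + 0)) := by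
    intro x hx y hy
    rw [mem_Icc] at hx hy
    have np : ∀ P : Prop, (0:ℝ) ≤ ind (P) := ind_nonneg
    by_cases hg : good z m x y
    · rw [ind_neg (not_not.mpr hg)]
      have := np (∃ p ∈ Icc 2 z, p ^ (z + 1) ∣ x)
      have := np (∃ p ∈ Icc 2 z, p ^ (z + 1) ∣ y)
      have := np (∃ n ∈ Ioc z Q, (n:ℤ) ∣ (x:ℤ) + 0 ∧ (n:ℤ) ∣ (y:ℤ) + 0)
      have := np (∃ n ∈ Ioc z Q, (n:ℤ) ∣ (x:ℤ) + 0 ∧ (n:ℤ) ∣ (y:ℤ) + m)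
      have := np (∃ n ∈ Ioc z Q, (n:ℤ) ∣ (x:ℤ) + (-m) ∧ (n:ℤ) ∣ (y:ℤ) + 0)
      linarith
    · rw [ind_pos hg]
      by_contra! hlt
      have key : ∀ P : Prop, (ind (P)) < 1 → ¬ P := by
        intro P h hP; rw [ind_pos hP] at h; linarith
      have n1 := np (∃ p ∈ Icc 2 z, p ^ (z + 1) ∣ x)
      have n2 := np (∃ p ∈ Icc 2 z, p ^ (z + 1) ∣ y)
      have n3 := np (∃ n ∈ Ioc z Q, (n:ℤ) ∣ (x:ℤ) + 0 ∧ (n:ℤ) ∣ (y:ℤ) + 0)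
      have n4 := np (∃ n ∈ Ioc z Q, (n:ℤ) ∣ (x:ℤ) + 0 ∧ (n:ℤ) ∣ (y:ℤ) + m)
      have n5 := np (∃ n ∈ Ioc z Q, (n:ℤ) ∣ (x:ℤ) + (-m) ∧ (n:ℤ) ∣ (y:ℤ) + 0)
      have k1 := key (∃ p ∈ Icc 2 z, p ^ (z + 1) ∣ x) (by linarith)
      have k2 := key (∃ p ∈ Icc 2 z, p ^ (z + 1) ∣ y) (by linarith)
      have k3 := key (∃ n ∈ Ioc z Q, (n:ℤ) ∣ (x:ℤ) + 0 ∧ (n:ℤ) ∣ (y:ℤ) + 0) (by linarith)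
      have k4 := key (∃ n ∈ Ioc z Q, (n:ℤ) ∣ (x:ℤ) + 0 ∧ (n:ℤ) ∣ (y:ℤ) + m) (by linarith)
      have k5 := key (∃ n ∈ Ioc z Q, (n:ℤ) ∣ (x:ℤ) + (-m) ∧ (n:ℤ) ∣ (y:ℤ) + 0) (by linarith)
      apply hg
      refine ⟨fun p hp hpz => ⟨fun h => k1 ⟨p, mem_Icc.mpr ⟨hp.two_le, hpz⟩, h⟩,
        fun h => k2 ⟨p, mem_Icc.mpr ⟨hp.two_le, hpz⟩, h⟩⟩, fun p hp hpz => ⟨?_, ?_, ?_⟩⟩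
      · rintro ⟨a, b⟩
        refine k3 ⟨p, mem_Ioc.mpr ⟨hpz, (Nat.le_of_dvd (by omega) a).trans hx.2⟩, ?_, ?_⟩
        · rw [add_zero]; exact_mod_cast a
        · rw [add_zero]; exact_mod_cast b
      · rintro ⟨a, b⟩
        refine k4 ⟨p, mem_Ioc.mpr ⟨hpz, (Nat.le_of_dvd (by omega) a).trans hx.2⟩, ?_, ?_⟩
        · rw [add_zero]; exact_mod_cast a
        · exact_mod_cast b
      · rintro ⟨a, b⟩
        refine k5 ⟨p, mem_Ioc.mpr ⟨hpz, (Nat.le_of_dvd (by omega) a).trans hy.2⟩, ?_, ?_⟩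
        · rw [← sub_eq_add_neg]; exact_mod_cast b
        · rw [add_zero]; exact_mod_cast a
  refine (sum_le_sum fun x hx => sum_le_sum fun y hy => h1 x hx y hy).trans ?_
  simp only [sum_add_distrib]
  have b1 := bigbad 0 0 z Q hz
  have b2 := bigbad 0 m z Q hz
  have b3 := bigbad (-m) 0 z Q hz
  have s1 := smallbad z Q
  have hQ : (0:ℝ) ≤ Q := by positivity
  have e1 : ∑ x ∈ Icc 1 Q, ∑ _y ∈ Icc 1 Q, (ind (∃ p ∈ Icc 2 z, p ^ (z + 1) ∣ x)) ≤ z / 2 ^ z * (Q:ℝ) ^ 2 := by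
    rw [sum_comm, sum_const, nsmul_eq_mul, Nat.card_Icc, Nat.add_sub_cancel]
    nlinarith
  have e2 : ∑ _x ∈ Icc 1 Q, ∑ y ∈ Icc 1 Q, (ind (∃ p ∈ Icc 2 z, p ^ (z + 1) ∣ y)) ≤ z / 2 ^ z * (Q:ℝ) ^ 2 := by
    rw [sum_const, nsmul_eq_mul, Nat.card_Icc, Nat.add_sub_cancel]
    nlinarith
  have : (2 * (z / 2 ^ z) + 12 / z) * (Q:ℝ) ^ 2 = z / 2 ^ z * (Q:ℝ) ^ 2 + z / 2 ^ z * (Q:ℝ) ^ 2 + 4 / z * (Q:ℝ) ^ 2 + 4 / z * (Q:ℝ) ^ 2 + 4 / z * (Q:ℝ) ^ 2 := by ring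
  rw [this]
  gcongr


lemma prod_primes_tendsto (f : ℕ → ℝ) (h : Summable (fun n : ℕ => if n.Prime then f n - 1 else 0)) :
    Multipliable (fun n : ℕ => if n.Prime then f n else 1) ∧
    Tendsto (fun z => ∏ p ∈ Nat.primesBelow z, f p) atTop (nhds (∏' n : ℕ, if n.Prime then f n else 1)) := by
  have h1 := Real.multipliable_one_add_of_summable h
  have e : (fun n : ℕ => 1 + if n.Prime then f n - 1 else 0) = (fun n : ℕ => if n.Prime then f n else 1) := by
    ext n; split_ifs <;> ring
  rw [e] at h1
  refine ⟨h1, ?_⟩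
  have h2 := h1.hasProd.tendsto_prod_nat
  refine h2.congr fun z => ?_
  rw [Nat.primesBelow_eq_filter_range, prod_filter]

noncomputable def Cm (m : ℕ) : ℝ := ∏' n : ℕ, if n.Prime then locd n m else 1

lemma summable_c (c : ℝ) : Summable (fun n : ℕ => if n.Prime then - (c / (n:ℝ) ^ 2) else 0) := by
  have h : Summable (fun n : ℕ => |c| * (1 / (n:ℝ) ^ 2)) := by
    refine Summable.mul_left _ ?_
    exact Real.summable_one_div_nat_pow.mpr (by norm_num)
  refine Summable.of_norm_bounded h fun n => ?_
  split_ifs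
  · rw [norm_neg, norm_div, Real.norm_eq_abs, norm_pow, Real.norm_natCast]; apply le_of_eq; ring
  · simp; positivity

lemma Cm_tendsto (m : ℕ) (hm : 0 < m) :
    Tendsto (fun z => ∏ p ∈ Nat.primesBelow z, locd p m) atTop (nhds (Cm m)) := by
  refine (prod_primes_tendsto (fun p => locd p m) ?_).2
  refine (summable_c 3).congr_cofinite ?_
  rw [Nat.cofinite_eq_atTop]
  filter_upwards [eventually_gt_atTop m] with n hn
  by_cases hp : n.Prime
  · rw [if_pos hp, if_pos hp]
    unfold locd
    rw [if_neg]
    · ring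
    · intro h
      have := Nat.le_of_dvd hm h
      omega
  · rw [if_neg hp, if_neg hp]

lemma fP_Pxx (p : ℕ) (hp : p.Prime) : fP Pxx p = 2 := by
  unfold fP
  have : (Icc 1 p).filter (fun d : ℕ => (p : ℤ) ∣ Pxx.eval (d : ℤ)) = {p - 1, p} := by
    ext d
    have h2 := hp.two_le
    simp only [mem_filter, mem_Icc, mem_insert, mem_singleton, Pxx, Polynomial.eval_mul,
      Polynomial.eval_X, Polynomial.eval_add, Polynomial.eval_one]
    rw [show (d:ℤ) * (d + 1) = ((d * (d + 1) : ℕ) : ℤ) by push_cast; ring, Int.natCast_dvd_natCast,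
      hp.dvd_mul]
    constructor
    · rintro ⟨⟨h3, h4⟩, h5 | h5⟩
      · have := Nat.le_of_dvd (by omega) h5; omega
      · have := Nat.le_of_dvd (by omega) h5; omega
    · rintro (h | h)
      · refine ⟨by omega, Or.inr ?_⟩
        rw [h, Nat.sub_add_cancel (by omega)]
      · exact ⟨by omega, Or.inl (by rw [h])⟩
  rw [this, card_pair]
  have := hp.two_le
  omega

lemma betaP_eq : betaP Pxx = ∏' n : ℕ, if n.Prime then 1 - 2 / (n:ℝ) ^ 2 else 1 := by
  unfold betaP
  have h1 : ∀ p : Nat.Primes, (1 - (fP Pxx (p : ℕ) : ℝ) / ((p : ℕ) : ℝ) ^ 2) = 1 - 2 / ((p:ℕ):ℝ) ^ 2 := by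
    intro p; rw [fP_Pxx p p.2]; norm_num
  rw [tprod_congr h1]
  have := tprod_subtype {p : ℕ | p.Prime} (fun p : ℕ => 1 - 2 / (p:ℝ) ^ 2)
  refine this.trans (tprod_congr fun n => ?_)
  rw [Set.mulIndicator_apply]; rfl

lemma summable_two : Summable (fun n : ℕ => if n.Prime then (1 - 2 / (n:ℝ) ^ 2) - 1 else 0) := by
  refine (summable_c 2).congr fun n => ?_
  split_ifs <;> ring

lemma beta_tendsto :
    Tendsto (fun z => ∏ p ∈ Nat.primesBelow z, (1 - 2 / (p:ℝ) ^ 2)) atTop (nhds (betaP Pxx)) := by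
  rw [betaP_eq]
  exact (prod_primes_tendsto (fun p => 1 - 2 / (p:ℝ) ^ 2) summable_two).2

lemma beta_pos : 0 < betaP Pxx := by
  rw [betaP_eq]
  rw [← Real.rexp_tsum_eq_tprod]
  · exact Real.exp_pos _
  · intro n
    split_ifs with h
    · have : (2:ℝ) ≤ n := by exact_mod_cast h.two_le
      rw [sub_pos, div_lt_one (by positivity)]
      nlinarith
    · norm_num
  · refine (Real.summable_log_one_add_of_summable summable_two).congr fun n => ?_
    congr 1
    split_ifs <;> ring

lemma pf_W (z k : ℕ) (hk : k ≠ 0) : ((z.factorial) ^ k).primeFactors = Nat.primesBelow (z + 1) := by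
  rw [Nat.primeFactors_pow _ hk]
  ext p
  rw [Nat.mem_primesBelow, Nat.mem_primeFactors]
  constructor
  · rintro ⟨hp, h, _⟩
    have := (hp.dvd_factorial).mp h
    exact ⟨by omega, hp⟩
  · rintro ⟨h, hp⟩
    exact ⟨hp, (hp.dvd_factorial).mpr (by omega), z.factorial_ne_zero⟩

lemma delta_tendsto (m : ℝ) : Tendsto (fun z : ℕ => m * (2 * ((z:ℝ) / 2 ^ z) + 12 / z)) atTop (nhds 0) := by
  have h1 : Tendsto (fun z : ℕ => (z:ℝ) / 2 ^ z) atTop (nhds 0) := by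
    have := tendsto_pow_const_div_const_pow_of_one_lt 1 (r := (2:ℝ)) (by norm_num)
    simpa using this
  have h2 : Tendsto (fun z : ℕ => (12:ℝ) / z) atTop (nhds 0) := tendsto_const_div_atTop_nhds_zero_nat 12
  have := ((h1.const_mul 2).add h2).const_mul m
  simpa using this

lemma hw_wt (m : ℕ) (hm : 0 < m) :
    ∀ ε > 0, ∃ W : ℕ, 0 < W ∧ ∃ u : ℕ → ℕ → ℝ, (∀ x y, u (x + W) y = u x y) ∧
      (∀ x y, u x (y + W) = u x y) ∧
      |(∑ x ∈ range W, ∑ y ∈ range W, u x y) / (W:ℝ)^2 - Cm m| ≤ ε ∧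
      ∀ Q : ℕ, ∑ x ∈ Icc 1 Q, ∑ y ∈ Icc 1 Q, |(wt m x y : ℝ) - u x y| ≤ ε * (Q:ℝ)^2 := by
  intro ε hε
  have t1 := (Cm_tendsto m hm).comp (tendsto_add_atTop_nat 1)
  rw [Metric.tendsto_atTop'] at t1
  obtain ⟨z1, hz1⟩ := t1 ε hε
  have t2 := delta_tendsto m
  rw [Metric.tendsto_atTop'] at t2
  obtain ⟨z2, hz2⟩ := t2 ε hε
  set z := max (max (z1 + 1) (z2 + 1)) m with hz
  have hzm : m ≤ z := le_max_right _ _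
  have h1 := hz1 z (by omega)
  have h2 := hz2 z (by omega)
  set W := (z.factorial) ^ (2 * z) with hWd
  have hW : 0 < W := pow_pos z.factorial_pos _
  have hne : NeZero W := ⟨hW.ne'⟩
  have hWR : (0:ℝ) < W := by exact_mod_cast hW
  refine ⟨W, hW, fun x y => (cnt (ZMod W) (m : ZMod W) ((x : ZMod W), (y : ZMod W)) : ℝ) / W, ?_, ?_, ?_, ?_⟩
  · intro x y; simp
  · intro x y; simp
  · have e : (∑ x ∈ range W, ∑ y ∈ range W, (cnt (ZMod W) (m : ZMod W) ((x : ZMod W), (y : ZMod W)) : ℝ) / W) / (W:ℝ)^2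
        = (tot (ZMod W) (m : ZMod W) : ℝ) / (W:ℝ) ^ 3 := by
      rw [tot_eq_sum, zsum]
      simp_rw [zsum]
      push_cast
      simp_rw [← sum_div]
      field_simp
    rw [e, tot_prime_prod W hW.ne', hWd, pf_W _ _ (by omega)]
    rw [Real.dist_eq] at h1
    exact h1.le
  · intro Q
    have key : ∀ x ∈ Icc 1 Q, ∀ y ∈ Icc 1 Q,
        |(wt m x y : ℝ) - (cnt (ZMod W) (m : ZMod W) ((x : ZMod W), (y : ZMod W)) : ℝ) / W| ≤ m * ind (¬ good z m x y) := by
      intro x hx y hy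
      rw [mem_Icc] at hx hy
      by_cases hg : good z m x y
      · rw [good_eq z m x y hm hzm (by omega) (by omega) hg, ind_neg (not_not.mpr hg)]
        rw [← hWd]
        push_cast
        rw [mul_div_cancel_left₀ _ hWR.ne']
        simp
      · rw [ind_pos hg, mul_one]
        have a1 : (wt m x y : ℝ) ≤ m := by
          have hxy : 0 < x * y := Nat.mul_pos (by omega) (by omega)
          have b1 := cnt_le (x * y) m hxy hm x y
          rw [cnt_eq_wt m x y (x * y) hxy (dvd_refl _)] at b1
          exact_mod_cast Nat.le_of_mul_le_mul_left b1 hxy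
        have a2 : (cnt (ZMod W) (m : ZMod W) ((x : ZMod W), (y : ZMod W)) : ℝ) / W ≤ m := by
          rw [div_le_iff₀ hWR, mul_comm]
          exact_mod_cast cnt_le W m hW hm x y
        have a3 : (0:ℝ) ≤ wt m x y := by positivity
        have a4 : (0:ℝ) ≤ (cnt (ZMod W) (m : ZMod W) ((x : ZMod W), (y : ZMod W)) : ℝ) / W := by positivity
        rw [abs_le]; constructor <;> linarith
    refine (sum_le_sum fun x hx => sum_le_sum fun y hy => key x hx y hy).trans ?_
    simp_rw [← mul_sum]
    have b := badsum z m Q (by omega)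
    rw [Real.dist_eq, sub_zero] at h2
    have h3 := (le_abs_self _).trans h2.le
    calc _ ≤ (m:ℝ) * ((2 * (z / 2 ^ z) + 12 / z) * (Q:ℝ) ^ 2) := mul_le_mul_of_nonneg_left b (by positivity)
      _ = (m * (2 * (z / 2 ^ z) + 12 / z)) * (Q:ℝ) ^ 2 := by ring
      _ ≤ ε * (Q:ℝ) ^ 2 := mul_le_mul_of_nonneg_right h3 (by positivity)


lemma eval_Pxx (a q : ℕ) : Int.gcd (Pxx.eval (a : ℤ)) (q : ℤ) = 1 ↔ Nat.Coprime (a * (a + 1)) q := by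
  simp only [Pxx, Polynomial.eval_mul, Polynomial.eval_X, Polynomial.eval_add, Polynomial.eval_one]
  rw [show (a:ℤ) * (a + 1) = ((a * (a + 1) : ℕ) : ℤ) by push_cast; ring, Int.gcd_natCast_natCast]

lemma mem_fp (Q : ℕ) (x : ℕ × ℕ) : x ∈ fareyPairs Pxx Q ↔
    1 ≤ x.1 ∧ x.1 ≤ x.2 ∧ x.2 ≤ Q ∧ Nat.Coprime (x.1 * (x.1 + 1)) x.2 := by
  unfold fareyPairs
  simp only [mem_filter, mem_product, mem_Icc, eval_Pxx]
  constructor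
  · rintro ⟨⟨⟨h1, h2⟩, h3, h4⟩, h5, h6⟩; exact ⟨h1, h5, h4, h6⟩
  · rintro ⟨h1, h2, h3, h4⟩; exact ⟨⟨⟨h1, by omega⟩, by omega, h3⟩, h2, h4⟩

lemma fp_inj (Q : ℕ) : Set.InjOn (fun x : ℕ × ℕ => (x.1 : ℚ) / (x.2 : ℚ)) (fareyPairs Pxx Q) := by
  intro x hx y hy h
  rw [mem_coe, mem_fp] at hx hy
  have h2 : ((x.1 : ℤ) : ℚ) / ((x.2 : ℤ) : ℚ) = ((y.1 : ℤ) : ℚ) / ((y.2 : ℤ) : ℚ) := by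
    push_cast; exact h
  have := Rat.div_int_inj (by omega) (by omega) (by simpa using hx.2.2.2.coprime_mul_right)
    (by simpa using hy.2.2.2.coprime_mul_right) h2
  exact Prod.ext (by omega) (by omega)

lemma card_fs (Q : ℕ) : (fareySet Pxx Q).card = (fareyPairs Pxx Q).card :=
  card_image_of_injOn (fp_inj Q)

lemma card_fp (Q : ℕ) : ((fareyPairs Pxx Q).card : ℝ) =
    ∑ x ∈ Icc 1 Q, ∑ y ∈ Ioc (min Q (x - 1)) Q, ind (Nat.Coprime (x * (x + 1)) y) := by
  unfold fareyPairs
  rw [← ind_sum, sum_product]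
  refine sum_congr rfl fun x hx => ?_
  rw [mem_Icc] at hx
  have : Ioc (min Q (x - 1)) Q = (Icc 1 Q).filter (fun y => x ≤ y) := by
    ext y; simp only [mem_Ioc, mem_filter, mem_Icc]; omega
  rw [this, sum_filter]
  refine sum_congr rfl fun y _ => ?_
  by_cases h : x ≤ y
  · rw [if_pos h]; exact ind_iff (by simp only [h, true_and]; exact eval_Pxx x y)
  · rw [if_neg h, ind_neg (fun h2 => h h2.1)]

lemma hw_cop :
    ∀ ε > 0, ∃ W : ℕ, 0 < W ∧ ∃ u : ℕ → ℕ → ℝ, (∀ x y, u (x + W) y = u x y) ∧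
      (∀ x y, u x (y + W) = u x y) ∧
      |(∑ x ∈ range W, ∑ y ∈ range W, u x y) / (W:ℝ)^2 - betaP Pxx| ≤ ε ∧
      ∀ Q : ℕ, ∑ x ∈ Icc 1 Q, ∑ y ∈ Icc 1 Q, |ind (Nat.Coprime (x * (x + 1)) y) - u x y| ≤ ε * (Q:ℝ)^2 := by
  classical
  intro ε hε
  have t1 := beta_tendsto.comp (tendsto_add_atTop_nat 1)
  rw [Metric.tendsto_atTop'] at t1
  obtain ⟨z1, hz1⟩ := t1 ε hε
  have t2 : Tendsto (fun z : ℕ => (8:ℝ) / z) atTop (nhds 0) := tendsto_const_div_atTop_nhds_zero_nat 8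
  rw [Metric.tendsto_atTop'] at t2
  obtain ⟨z2, hz2⟩ := t2 ε hε
  set z := max (z1 + 1) (z2 + 1) with hz
  have h1 := hz1 z (by omega)
  have h2 := hz2 z (by omega)
  set W := (z.factorial) ^ 1 with hWd
  have hW : 0 < W := pow_pos z.factorial_pos _
  have hne : NeZero W := ⟨hW.ne'⟩
  have hWR : (0:ℝ) < W := by exact_mod_cast hW
  refine ⟨W, hW, fun x y => ind (IsCoprime ((x : ZMod W) * ((x : ZMod W) + 1)) (y : ZMod W)), ?_, ?_, ?_, ?_⟩
  · intro x y; simp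
  · intro x y; simp
  · have e : (∑ x ∈ range W, ∑ y ∈ range W, ind (IsCoprime ((x : ZMod W) * ((x : ZMod W) + 1)) (y : ZMod W)))
        = (tot2 (ZMod W) : ℝ) := by
      unfold tot2
      rw [Nat.card_eq_fintype_card, Fintype.card_subtype, ← ind_sum, Fintype.sum_prod_type, zsum]
      simp_rw [zsum]
    rw [e, tot2_prime_prod W hW.ne', hWd, pf_W _ _ (by omega)]
    rw [Real.dist_eq] at h1
    exact h1.le
  · intro Q
    have key : ∀ x ∈ Icc 1 Q, ∀ y ∈ Icc 1 Q,
        |ind (Nat.Coprime (x * (x + 1)) y) - ind (IsCoprime ((x : ZMod W) * ((x : ZMod W) + 1)) (y : ZMod W))|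
        ≤ ind (∃ n ∈ Ioc z Q, (n:ℤ) ∣ (x:ℤ) + 0 ∧ (n:ℤ) ∣ (y:ℤ) + 0) +
          ind (∃ n ∈ Ioc z Q, (n:ℤ) ∣ (x:ℤ) + 1 ∧ (n:ℤ) ∣ (y:ℤ) + 0) := by
      intro x hx y hy
      rw [mem_Icc] at hx hy
      have i1 := ind_nonneg (∃ n ∈ Ioc z Q, (n:ℤ) ∣ (x:ℤ) + 0 ∧ (n:ℤ) ∣ (y:ℤ) + 0)
      have i2 := ind_nonneg (∃ n ∈ Ioc z Q, (n:ℤ) ∣ (x:ℤ) + 1 ∧ (n:ℤ) ∣ (y:ℤ) + 0)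
      by_cases hc : Nat.Coprime (x * (x + 1)) y
      · have hc2 : IsCoprime ((x : ZMod W) * ((x : ZMod W) + 1)) (y : ZMod W) := by
          have := (Nat.isCoprime_iff_coprime.mpr hc).map (Int.castRingHom (ZMod W))
          simpa using this
        rw [ind_pos hc, ind_pos hc2, sub_self, abs_zero]
        linarith
      · by_cases hc2 : IsCoprime ((x : ZMod W) * ((x : ZMod W) + 1)) (y : ZMod W)
        swap
        · rw [ind_neg hc, ind_neg hc2, sub_self, abs_zero]
          linarith
        rw [ind_neg hc, ind_pos hc2, zero_sub, abs_neg, abs_one]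
        obtain ⟨p, hp, hp1, hp2⟩ := Nat.Prime.not_coprime_iff_dvd.mp hc
        have hpz : z < p := by
          by_contra! hle
          have hpW : p ∣ W := by rw [hWd, pow_one]; exact (hp.dvd_factorial).mpr hle
          have h3 := hc2.map (ZMod.castHom hpW (ZMod p))
          have f1 : ((x * (x + 1) : ℕ) : ZMod p) = 0 := (ZMod.natCast_eq_zero_iff _ _).mpr hp1
          have f2 : (y : ZMod p) = 0 := (ZMod.natCast_eq_zero_iff _ _).mpr hp2
          push_cast at f1
          rw [map_mul, map_add, map_one, map_natCast, map_natCast, f1, f2] at h3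
          have : Fact p.Prime := ⟨hp⟩
          exact not_isCoprime_zero_zero h3
        have hpQ : p ≤ Q := (Nat.le_of_dvd (by omega) hp2).trans hy.2
        have hpy : (p:ℤ) ∣ (y:ℤ) + 0 := by rw [add_zero]; exact_mod_cast hp2
        rcases (hp.dvd_mul).mp hp1 with h | h
        · rw [ind_pos (P := ∃ n ∈ Ioc z Q, (n:ℤ) ∣ (x:ℤ) + 0 ∧ (n:ℤ) ∣ (y:ℤ) + 0)
            ⟨p, mem_Ioc.mpr ⟨hpz, hpQ⟩, by rw [add_zero]; exact_mod_cast h, hpy⟩]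
          linarith
        · rw [ind_pos (P := ∃ n ∈ Ioc z Q, (n:ℤ) ∣ (x:ℤ) + 1 ∧ (n:ℤ) ∣ (y:ℤ) + 0)
            ⟨p, mem_Ioc.mpr ⟨hpz, hpQ⟩, by exact_mod_cast h, hpy⟩]
          linarith
    refine (sum_le_sum fun x hx => sum_le_sum fun y hy => key x hx y hy).trans ?_
    simp_rw [sum_add_distrib]
    have b1 := bigbad 0 0 z Q (by omega)
    have b2 := bigbad 1 0 z Q (by omega)
    rw [Real.dist_eq, sub_zero] at h2
    have h3 := (le_abs_self _).trans h2.le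
    calc _ ≤ 4 / (z:ℝ) * (Q:ℝ) ^ 2 + 4 / (z:ℝ) * (Q:ℝ) ^ 2 := add_le_add b1 b2
      _ = (8 / z) * (Q:ℝ) ^ 2 := by ring
      _ ≤ ε * (Q:ℝ) ^ 2 := mul_le_mul_of_nonneg_right h3 (by positivity)

lemma card_tendsto : Tendsto (fun Q : ℕ => ((fareySet Pxx Q).card : ℝ) / (Q:ℝ) ^ 2) atTop
    (nhds (betaP Pxx / 2)) := by
  have h := sieve_limit (fun x y => ind (Nat.Coprime (x * (x + 1)) y)) (betaP Pxx) hw_cop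
    (fun t => 1 - t) 1 (fun x y => by
      rw [one_mul, show 1 - x - (1 - y) = -(x - y) by ring, abs_neg]) (by fun_prop)
    (fun Q x => min Q (x - 1)) (fun Q x => min_le_left _ _) (fun Q => 1 / (Q:ℝ))
    tendsto_one_div_atTop_nhds_zero_nat ?_
  · have e : ∫ t in (0:ℝ)..1, (1 - t) = 1 / 2 := by
      rw [intervalIntegral.integral_sub (by simp) (by simp)]
      simp; norm_num
    rw [e] at h
    rw [show betaP Pxx / 2 = betaP Pxx * (1 / 2) by ring]
    refine h.congr fun Q => ?_
    rw [card_fs, card_fp]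
  · filter_upwards [eventually_gt_atTop 0] with Q hQ x hx
    rw [mem_Icc] at hx
    have hQR : (0:ℝ) < Q := by exact_mod_cast hQ
    rw [min_eq_right (by omega), Nat.cast_sub hx.1]
    have : (Q:ℝ) - ((x:ℝ) - (1:ℕ)) - Q * (1 - x / Q) = 1 := by
      field_simp; push_cast; ring
    rw [this, abs_one, one_div, inv_mul_cancel₀ hQR.ne']


lemma wt_real (m q r : ℕ) : (wt m q r : ℝ) = ∑ a ∈ Icc 1 q, ∑ b ∈ Icc 1 r,
    ind (Nat.Coprime (a * (a + 1)) q) * ind (Nat.Coprime (b * (b + 1)) r) *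
      ind (((q * r : ℕ) : ℤ) ∣ (a:ℤ) * r - b * q - m) := by
  unfold wt
  push_cast
  refine sum_congr rfl fun a _ => sum_congr rfl fun b _ => ?_
  unfold ind
  split_ifs <;> first | (exfalso; tauto) | simp

lemma sum_fp (Q : ℕ) (g : ℕ × ℕ → ℝ) : ∑ x ∈ fareyPairs Pxx Q, g x =
    ∑ q ∈ Icc 1 Q, ∑ a ∈ Icc 1 q, ind (Nat.Coprime (a * (a + 1)) q) * g (a, q) := by
  unfold fareyPairs
  rw [sum_filter, sum_product_right]
  refine sum_congr rfl fun q hq => ?_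
  rw [mem_Icc] at hq
  have : Icc 1 q = (Icc 1 Q).filter (fun a => a ≤ q) := by
    ext y; simp only [mem_filter, mem_Icc]; omega
  rw [this, sum_filter]
  refine sum_congr rfl fun a _ => ?_
  simp only [eval_Pxx]
  unfold ind
  split_ifs <;> first | (exfalso; tauto) | simp

lemma pair_ind (N Λ : ℝ) (M Q a q b r : ℕ) (hN : 0 < N) (hΛN : Λ ≤ N) (hM : Λ * (Q:ℝ) ^ 2 ≤ M * N) (hΛ : 0 < Λ)
    (hq : q ∈ Icc 1 Q) (hr : r ∈ Icc 1 Q) :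
    ind (((a:ℚ) / (q:ℚ)) ≠ ((b:ℚ) / (r:ℚ)) ∧ ∃ k : ℤ, ((((a:ℚ) / (q:ℚ) : ℚ) : ℝ) - (((b:ℚ) / (r:ℚ) : ℚ) : ℝ) - (k : ℝ)) * N ∈ Set.Ioo 0 Λ)
    = ∑ m ∈ Icc 1 M, ind ((m:ℝ) * N < Λ * (q * r)) * ind (((q * r : ℕ) : ℤ) ∣ (a:ℤ) * r - b * q - m) := by
  rw [mem_Icc] at hq hr
  have hqR : (0:ℝ) < q := by exact_mod_cast hq.1
  have hrR : (0:ℝ) < r := by exact_mod_cast hr.1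
  have hqrR : (0:ℝ) < q * r := by positivity
  have hqQ : (q:ℝ) ≤ Q := by exact_mod_cast hq.2
  have hrQ : (r:ℝ) ≤ Q := by exact_mod_cast hr.2
  have hval : ∀ k : ℤ, ((((a:ℚ) / (q:ℚ) : ℚ) : ℝ) - (((b:ℚ) / (r:ℚ) : ℚ) : ℝ) - (k : ℝ)) * N
      = (((a:ℤ) * r - b * q - k * (q * r) : ℤ) : ℝ) * N / (q * r) := by
    intro k; push_cast; field_simp
  have hsmall : ∀ n : ℤ, (n:ℝ) * N < Λ * (q * r) → n < (q * r : ℕ) := by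
    intro n hn
    have : (n:ℝ) * N < (q * r) * N := hn.trans_le (by nlinarith)
    have := lt_of_mul_lt_mul_right this hN.le
    exact_mod_cast this
  by_cases hc : ∃ m ∈ Icc 1 M, (m:ℝ) * N < Λ * (q * r) ∧ (((q * r : ℕ) : ℤ) ∣ (a:ℤ) * r - b * q - m)
  · obtain ⟨m, hm, h1, h2⟩ := hc
    rw [sum_eq_single_of_mem m hm]
    · rw [ind_pos h1, ind_pos h2, ind_pos, mul_one]
      rw [mem_Icc] at hm
      constructor
      · intro he
        have h3 : (a:ℤ) * r - b * q = 0 := by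
          have hq0 : (q:ℚ) ≠ 0 := by exact_mod_cast (by omega : q ≠ 0)
          have hr0 : (r:ℚ) ≠ 0 := by exact_mod_cast (by omega : r ≠ 0)
          rw [div_eq_div_iff hq0 hr0] at he
          have : (a:ℤ) * r = b * q := by exact_mod_cast he
          omega
        rw [h3, zero_sub, dvd_neg] at h2
        have h4 := hsmall m (by exact_mod_cast h1)
        have := Int.le_of_dvd (by omega) h2
        omega
      · obtain ⟨k, hk⟩ := h2
        refine ⟨k, ?_⟩
        rw [hval, show ((a:ℤ) * r - b * q - k * (q * r) : ℤ) = (m:ℤ) by push_cast at hk; linear_combination hk]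
        have : (0:ℝ) < m := by exact_mod_cast hm.1
        constructor
        · push_cast; positivity
        · rw [div_lt_iff₀ hqrR]; push_cast; exact h1
    · intro m' hm' hne
      by_cases h3 : (m':ℝ) * N < Λ * (q * r)
      · rw [ind_neg (P := ((q * r : ℕ) : ℤ) ∣ (a:ℤ) * r - b * q - m'), mul_zero]
        intro h4
        rw [mem_Icc] at hm hm'
        have h5 := dvd_sub h4 h2
        rw [show (a:ℤ) * r - b * q - m' - (a * r - b * q - m) = (m:ℤ) - m' by ring] at h5
        have b1 := hsmall m (by exact_mod_cast h1)
        have b2 := hsmall m' (by exact_mod_cast h3)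
        have := Int.eq_zero_of_abs_lt_dvd h5 (by rw [abs_lt]; constructor <;> omega)
        omega
      · rw [ind_neg h3, zero_mul]
  · rw [ind_neg, sum_eq_zero]
    · intro m hm
      by_cases h1 : (m:ℝ) * N < Λ * (q * r)
      · rw [ind_neg (P := ((q * r : ℕ) : ℤ) ∣ (a:ℤ) * r - b * q - m), mul_zero]
        intro h2
        exact hc ⟨m, hm, h1, h2⟩
      · rw [ind_neg h1, zero_mul]
    · rintro ⟨_, k, hk⟩
      apply hc
      rw [hval] at hk
      set n : ℤ := (a:ℤ) * r - b * q - k * (q * r) with hn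
      have p1 : (0:ℝ) < (n:ℝ) := by
        by_contra! hle
        have := hk.1
        have : (n:ℝ) * N / (q * r) ≤ 0 := div_nonpos_of_nonpos_of_nonneg (mul_nonpos_of_nonpos_of_nonneg hle hN.le) hqrR.le
        linarith
      have p2 : (0:ℤ) < n := by exact_mod_cast p1
      have p3 : (n:ℝ) * N < Λ * (q * r) := by
        have := hk.2
        rwa [div_lt_iff₀ hqrR] at this
      have p4 : (n.toNat : ℤ) = n := Int.toNat_of_nonneg p2.le
      have p5 : ((n.toNat : ℕ) : ℝ) = (n:ℝ) := by exact_mod_cast congrArg (Int.cast : ℤ → ℝ) p4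
      refine ⟨n.toNat, mem_Icc.mpr ⟨by omega, ?_⟩, ?_, ?_⟩
      · have : (n:ℝ) * N < M * N := p3.trans_le (le_trans (by gcongr; nlinarith) hM)
        have := lt_of_mul_lt_mul_right this hN.le
        rw [← p5] at this
        exact_mod_cast this.le
      · rw [p5]; exact p3
      · rw [p4, hn]
        exact ⟨k, by push_cast; ring⟩

lemma pc_formula (Q M : ℕ) (Λ : ℝ) (hΛ : 0 < Λ) (hN : 0 < ((fareySet Pxx Q).card : ℝ))
    (hΛN : Λ ≤ ((fareySet Pxx Q).card : ℝ)) (hM : Λ * (Q:ℝ) ^ 2 ≤ M * ((fareySet Pxx Q).card : ℝ)) :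
    pairCorr (fareySet Pxx Q) Λ = (∑ m ∈ Icc 1 M, ∑ x ∈ Icc 1 Q,
      ∑ y ∈ Ioc (min Q ⌊(m:ℝ) * ((fareySet Pxx Q).card : ℝ) / (Λ * x)⌋₊) Q, (wt m x y : ℝ)) /
      ((fareySet Pxx Q).card : ℝ) := by
  classical
  unfold pairCorr
  congr 1
  rw [← ind_sum]
  generalize ((fareySet Pxx Q).card : ℝ) = N at *
  rw [sum_product]
  unfold fareySet
  rw [sum_image (fp_inj Q), sum_congr rfl fun x _ => sum_image (fp_inj Q)]
  rw [sum_fp]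
  have step : ∀ q ∈ Icc 1 Q, ∀ a ∈ Icc 1 q, ∑ y ∈ fareyPairs Pxx Q,
      ind (((a:ℚ) / (q:ℚ)) ≠ ((y.1:ℚ) / (y.2:ℚ)) ∧ ∃ k : ℤ, ((((a:ℚ) / (q:ℚ) : ℚ) : ℝ) - (((y.1:ℚ) / (y.2:ℚ) : ℚ) : ℝ) - (k : ℝ)) * N ∈ Set.Ioo 0 Λ)
      = ∑ m ∈ Icc 1 M, ∑ r ∈ Icc 1 Q, ∑ b ∈ Icc 1 r, ind (Nat.Coprime (b * (b + 1)) r) *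
        (ind ((m:ℝ) * N < Λ * (q * r)) * ind (((q * r : ℕ) : ℤ) ∣ (a:ℤ) * r - b * q - m)) := by
    intro q hq a ha
    rw [sum_fp, sum_comm]
    refine sum_congr rfl fun r hr => ?_
    rw [sum_comm]
    refine sum_congr rfl fun b hb => ?_
    rw [pair_ind N Λ M Q a q b r hN hΛN hM hΛ hq hr, mul_sum]
  have step2 : ∑ q ∈ Icc 1 Q, ∑ a ∈ Icc 1 q, ind (Nat.Coprime (a * (a + 1)) q) *
      ∑ y ∈ fareyPairs Pxx Q, ind (((a:ℚ) / (q:ℚ)) ≠ ((y.1:ℚ) / (y.2:ℚ)) ∧ ∃ k : ℤ, ((((a:ℚ) / (q:ℚ) : ℚ) : ℝ) - (((y.1:ℚ) / (y.2:ℚ) : ℚ) : ℝ) - (k : ℝ)) * N ∈ Set.Ioo 0 Λ)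
      = ∑ q ∈ Icc 1 Q, ∑ m ∈ Icc 1 M, ∑ r ∈ Icc 1 Q, ind ((m:ℝ) * N < Λ * (q * r)) * wt m q r := by
    refine sum_congr rfl fun q hq => ?_
    rw [sum_congr rfl fun a ha => by rw [step q hq a ha, mul_sum], sum_comm]
    refine sum_congr rfl fun m _ => ?_
    rw [sum_congr rfl fun a _ => mul_sum _ _ _, sum_comm]
    refine sum_congr rfl fun r _ => ?_
    rw [wt_real, mul_sum]
    refine sum_congr rfl fun a _ => ?_
    rw [mul_sum, mul_sum]
    refine sum_congr rfl fun b _ => ?_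
    ring
  refine Eq.trans ?_ (step2.trans ?_)
  · rfl
  rw [sum_comm]
  refine sum_congr rfl fun m _ => sum_congr rfl fun q hq => ?_
  rw [mem_Icc] at hq
  have hqR : (0:ℝ) < q := by exact_mod_cast hq.1
  have : Ioc (min Q ⌊(m:ℝ) * N / (Λ * q)⌋₊) Q = (Icc 1 Q).filter (fun r : ℕ => (m:ℝ) * N < Λ * (q * r)) := by
    ext r
    simp only [mem_Ioc, mem_filter, mem_Icc]
    have e : (m:ℝ) * N < Λ * (q * r) ↔ ⌊(m:ℝ) * N / (Λ * q)⌋₊ < r := by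
      rw [Nat.floor_lt (by positivity), div_lt_iff₀ (by positivity)]
      rw [show (r:ℝ) * (Λ * q) = Λ * (q * r) by ring]
    rw [e]
    omega
  rw [this, sum_filter]
  refine sum_congr rfl fun r _ => ?_
  unfold ind
  split_ifs <;> simp


noncomputable def phic (c t : ℝ) : ℝ := 1 - c / max t c

lemma min_rho (Q B ρ : ℝ) (hQ : 0 ≤ Q) (hB : 0 ≤ B) (hρ : 0 ≤ ρ) :
    |min Q (ρ * B) - min Q B| ≤ |ρ - 1| * Q := by
  have m1 : min Q B ≤ Q := min_le_left _ _
  have m2 : min Q B ≤ B := min_le_right _ _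
  have m0 : 0 ≤ min Q B := le_min hQ hB
  rcases le_total 1 ρ with h | h
  · have a1 : min Q B ≤ min Q (ρ * B) := le_min m1 (by nlinarith)
    have a2 : min Q (ρ * B) ≤ ρ * min Q B := by
      rcases min_choice Q B with e | e <;> rw [e]
      · exact (min_le_left _ _).trans (by nlinarith)
      · exact min_le_right _ _
    rw [abs_of_nonneg (by linarith), abs_of_nonneg (by linarith)]
    nlinarith
  · have a1 : min Q (ρ * B) ≤ min Q B := min_le_min le_rfl (by nlinarith)
    have a2 : ρ * min Q B ≤ min Q (ρ * B) := le_min (by nlinarith) (by nlinarith)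
    rw [abs_of_nonpos (by linarith), abs_of_nonpos (by linarith)]
    nlinarith

lemma phic_lip (c : ℝ) (hc : 0 < c) (x y : ℝ) : |phic c x - phic c y| ≤ (1 / c) * |x - y| := by
  unfold phic
  have hx : c ≤ max x c := le_max_right _ _
  have hy : c ≤ max y c := le_max_right _ _
  have hx0 : 0 < max x c := by linarith
  have hy0 : 0 < max y c := by linarith
  have e : 1 - c / max x c - (1 - c / max y c) = c * (max x c - max y c) / (max x c * max y c) := by
    field_simp; ring
  rw [e, abs_div, abs_mul, abs_of_pos hc, abs_of_pos (mul_pos hx0 hy0), div_le_iff₀ (mul_pos hx0 hy0)]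
  have h1 : |max x c - max y c| ≤ |x - y| := abs_max_sub_max_le_abs x y c
  have h2 : c * c ≤ max x c * max y c := mul_le_mul hx hy hc.le hx0.le
  have h3 : c * |max x c - max y c| ≤ c * |x - y| := by gcongr
  refine h3.trans ?_
  rw [show (1 / c) * |x - y| * (max x c * max y c) = (max x c * max y c) * (|x - y| / c) by ring]
  refine le_trans ?_ (mul_le_mul_of_nonneg_right h2 (by positivity))
  rw [show c * c * (|x - y| / c) = c * |x - y| by field_simp]

lemma phic_cont (c : ℝ) (hc : 0 < c) : Continuous (phic c) := by
  unfold phic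
  refine continuous_const.sub (continuous_const.div (continuous_id.max continuous_const) ?_)
  intro x
  have : c ≤ max x c := le_max_right _ _
  exact ne_of_gt (lt_of_lt_of_le hc this)

lemma floor_min (Q : ℕ) (y : ℝ) (hy : 0 ≤ y) : |((min Q ⌊y⌋₊ : ℕ) : ℝ) - min (Q:ℝ) y| ≤ 1 := by
  have h1 := Nat.floor_le hy
  have h2 := Nat.lt_floor_add_one y
  push_cast
  rw [abs_le]
  constructor
  · have : min (Q:ℝ) y ≤ min (Q:ℝ) (⌊y⌋₊:ℝ) + 1 := by
      rw [← min_add_add_right]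
      exact min_le_min (by linarith) h2.le
    linarith
  · have : min (Q:ℝ) (⌊y⌋₊:ℝ) ≤ min (Q:ℝ) y := min_le_min le_rfl h1
    linarith

lemma each_m (Λ : ℝ) (hΛ : 0 < Λ) (m : ℕ) (hm : 0 < m) :
    Tendsto (fun Q : ℕ => (∑ x ∈ Icc 1 Q,
      ∑ y ∈ Ioc (min Q ⌊(m:ℝ) * ((fareySet Pxx Q).card : ℝ) / (Λ * x)⌋₊) Q, (wt m x y : ℝ)) / (Q:ℝ)^2) atTop
      (nhds (Cm m * ∫ t in (0:ℝ)..1, phic ((m:ℝ) * betaP Pxx / (2 * Λ)) t)) := by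
  have hβ := beta_pos
  have hmR : (0:ℝ) < m := by exact_mod_cast hm
  set β := betaP Pxx with hβd
  set c : ℝ := (m:ℝ) * β / (2 * Λ) with hcd
  have hc : 0 < c := by positivity
  set ρ : ℕ → ℝ := fun Q => (((fareySet Pxx Q).card:ℝ) / (Q:ℝ)^2) / (β / 2) with hρd
  have hρt : Tendsto ρ atTop (nhds 1) := by
    have := card_tendsto.div_const (β / 2)
    rwa [div_self (by positivity)] at this
  refine sieve_limit (fun x y => (wt m x y : ℝ)) (Cm m) (hw_wt m hm) (phic c) (1 / c) (phic_lip c hc) (phic_cont c hc)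
    (fun Q x => min Q ⌊(m:ℝ) * ((fareySet Pxx Q).card : ℝ) / (Λ * x)⌋₊) (fun Q x => min_le_left _ _)
    (fun Q => |ρ Q - 1| + 1 / (Q:ℝ)) ?_ ?_
  · have h1 : Tendsto (fun Q => |ρ Q - 1|) atTop (nhds 0) := by
      have := (hρt.sub_const 1).abs
      simpa using this
    have h2 : Tendsto (fun Q : ℕ => 1 / (Q:ℝ)) atTop (nhds 0) := tendsto_one_div_atTop_nhds_zero_nat
    simpa using h1.add h2
  · filter_upwards [eventually_ge_atTop 1] with Q hQ x hx
    rw [mem_Icc] at hx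
    have hQR : (0:ℝ) < Q := by exact_mod_cast hQ
    have hxR : (0:ℝ) < x := by exact_mod_cast hx.1
    have hB : 0 ≤ c * (Q:ℝ)^2 / x := by positivity
    have hρ0 : 0 ≤ ρ Q := by simp only [hρd]; positivity
    have e1 : (m:ℝ) * ((fareySet Pxx Q).card : ℝ) / (Λ * x) = ρ Q * (c * (Q:ℝ)^2 / x) := by
      simp only [hρd, hcd]; field_simp
    have e2 : (Q:ℝ) * phic c ((x:ℝ)/Q) = Q - min (Q:ℝ) (c * (Q:ℝ)^2 / x) := by
      unfold phic
      rcases le_total ((x:ℝ)/Q) c with h | h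
      · rw [max_eq_right h, min_eq_left]
        · field_simp; try ring
        · rw [le_div_iff₀ hxR]
          rw [div_le_iff₀ hQR] at h
          nlinarith
      · rw [max_eq_left h, min_eq_right]
        · field_simp
        · rw [div_le_iff₀ hxR]
          rw [le_div_iff₀ hQR] at h
          nlinarith
    rw [e1, e2]
    have f1 := floor_min Q (ρ Q * (c * (Q:ℝ)^2 / x)) (by positivity)
    have f2 := min_rho Q (c * (Q:ℝ)^2 / x) (ρ Q) hQR.le hB hρ0
    rw [add_mul, one_div, inv_mul_cancel₀ hQR.ne']
    set A := ((min Q ⌊ρ Q * (c * (Q:ℝ)^2 / x)⌋₊ : ℕ) : ℝ)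
    set B := min (Q:ℝ) (ρ Q * (c * (Q:ℝ)^2 / x))
    set D := min (Q:ℝ) (c * (Q:ℝ)^2 / x)
    rw [abs_le] at f1 f2 ⊢
    constructor <;> linarith [f1.1, f1.2, f2.1, f2.2]

lemma pc_limit (Λ : ℝ) (hΛ : 0 < Λ) (M : ℕ) (hM : 2 * Λ / betaP Pxx < M) :
    Tendsto (fun Q : ℕ => pairCorr (fareySet Pxx Q) Λ) atTop
      (nhds ((∑ m ∈ Icc 1 M, Cm m * ∫ t in (0:ℝ)..1, phic ((m:ℝ) * betaP Pxx / (2 * Λ)) t) / (betaP Pxx / 2))) := by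
  have hβ := beta_pos
  have h1 : Tendsto (fun Q : ℕ => ∑ m ∈ Icc 1 M, (∑ x ∈ Icc 1 Q,
      ∑ y ∈ Ioc (min Q ⌊(m:ℝ) * ((fareySet Pxx Q).card : ℝ) / (Λ * x)⌋₊) Q, (wt m x y : ℝ)) / (Q:ℝ)^2) atTop
      (nhds (∑ m ∈ Icc 1 M, Cm m * ∫ t in (0:ℝ)..1, phic ((m:ℝ) * betaP Pxx / (2 * Λ)) t)) :=
    tendsto_finsetSum _ fun m hm => each_m Λ hΛ m (mem_Icc.mp hm).1
  have h2 := h1.div card_tendsto (by positivity)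
  refine h2.congr' ?_
  have hlim : Λ / M < betaP Pxx / 2 := by
    have hM0 : (0:ℝ) < M := lt_of_le_of_lt (by positivity) hM
    rw [div_lt_iff₀ hβ] at hM
    rw [div_lt_iff₀ hM0]; linarith
  have hM0 : (0:ℝ) < M := lt_of_le_of_lt (by positivity) hM
  have ev1 := card_tendsto.eventually (lt_mem_nhds hlim)
  have ev2 : ∀ᶠ Q : ℕ in atTop, (M:ℝ) ≤ Q := tendsto_natCast_atTop_atTop.eventually_ge_atTop _
  filter_upwards [ev1, ev2, eventually_ge_atTop 1] with Q h h' hQ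
  have hQR : (1:ℝ) ≤ Q := by exact_mod_cast hQ
  have hQ2 : (0:ℝ) < (Q:ℝ)^2 := by positivity
  rw [lt_div_iff₀ hQ2, div_mul_eq_mul_div, div_lt_iff₀ hM0] at h
  have hN : 0 < ((fareySet Pxx Q).card : ℝ) := by
    by_contra! hle
    have : 0 < Λ * (Q:ℝ)^2 := by positivity
    nlinarith
  rw [pc_formula Q M Λ hΛ hN ?_ (by linarith)]
  · simp only [Pi.div_apply]
    rw [← sum_div, div_div_div_cancel_right₀ hQ2.ne']
  · have : Λ * M ≤ Λ * (Q:ℝ)^2 := by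
      have : (M:ℝ) ≤ (Q:ℝ)^2 := by nlinarith
      gcongr
    have : Λ * M < ((fareySet Pxx Q).card : ℝ) * M := by linarith
    exact (lt_of_mul_lt_mul_right this hM0.le).le


noncomputable def gk (κ l : ℝ) : ℝ := Real.log (max 1 (l / κ)) / (max l κ) ^ 2

lemma gk_cont (κ : ℝ) (hκ : 0 < κ) : Continuous (gk κ) := by
  unfold gk
  have h1 : Continuous fun l : ℝ => max 1 (l / κ) := continuous_const.max (continuous_id.div_const κ)
  have h2 : Continuous fun l : ℝ => (max l κ) ^ 2 := (continuous_id.max continuous_const).pow 2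
  refine (h1.log ?_).div h2 ?_
  · intro x
    have : (1:ℝ) ≤ max 1 (x / κ) := le_max_left _ _
    linarith
  · intro x
    have : κ ≤ max x κ := le_max_right _ _
    have : 0 < max x κ := by linarith
    positivity

lemma gk_zero (κ l : ℝ) (hκ : 0 < κ) (h : l ≤ κ) : gk κ l = 0 := by
  unfold gk
  rw [max_eq_left, Real.log_one, zero_div]
  rw [div_le_one hκ]; exact h

lemma gk_large (κ l : ℝ) (hκ : 0 < κ) (h : κ ≤ l) : gk κ l = Real.log (l / κ) / l ^ 2 := by
  unfold gk
  rw [max_eq_right, max_eq_left h]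
  rw [one_le_div hκ]; exact h

lemma int_phic_ge (c : ℝ) (hc : 1 ≤ c) : ∫ t in (0:ℝ)..1, phic c t = 0 := by
  rw [intervalIntegral.integral_congr (g := fun _ => (0:ℝ))]
  · simp
  · intro t ht
    rw [Set.uIcc_of_le zero_le_one] at ht
    unfold phic
    simp only
    rw [max_eq_right (ht.2.trans hc), div_self (by linarith), sub_self]

lemma int_phic_lt (c : ℝ) (hc0 : 0 < c) (hc : c < 1) : ∫ t in (0:ℝ)..1, phic c t = 1 - c + c * Real.log c := by
  have hi : ∀ a b, IntervalIntegrable (phic c) MeasureTheory.volume a b := fun a b => (phic_cont c hc0).intervalIntegrable a b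
  rw [← intervalIntegral.integral_add_adjacent_intervals (hi 0 c) (hi c 1)]
  have e1 : ∫ t in (0:ℝ)..c, phic c t = 0 := by
    rw [intervalIntegral.integral_congr (g := fun _ => (0:ℝ))]
    · simp
    · intro t ht
      rw [Set.uIcc_of_le hc0.le] at ht
      unfold phic
      simp only
      rw [max_eq_right ht.2, div_self hc0.ne', sub_self]
  have e2 : ∫ t in c..1, phic c t = ((1:ℝ) - c * Real.log 1) - (c - c * Real.log c) := by
    refine intervalIntegral.integral_eq_sub_of_hasDerivAt (f := fun t => t - c * Real.log t) ?_ (hi c 1)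
    intro t ht
    rw [Set.uIcc_of_le hc.le] at ht
    have ht0 : 0 < t := by linarith [ht.1]
    have := (hasDerivAt_id t).sub ((Real.hasDerivAt_log ht0.ne').const_mul c)
    refine this.congr_deriv ?_
    unfold phic
    rw [max_eq_left ht.1, div_eq_mul_inv]
  rw [e1, e2, Real.log_one]; ring

lemma int_gk (κ Λ : ℝ) (hκ : 0 < κ) (hΛ : 0 < Λ) :
    ∫ l in (0:ℝ)..Λ, gk κ l = (1 / κ) * ∫ t in (0:ℝ)..1, phic (κ / Λ) t := by
  rcases le_or_gt Λ κ with h | h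
  · rw [int_phic_ge _ (by rw [one_le_div hΛ]; exact h), mul_zero, intervalIntegral.integral_congr (g := fun _ => (0:ℝ))]
    · simp
    · intro t ht
      rw [Set.uIcc_of_le hΛ.le] at ht
      exact gk_zero κ t hκ (ht.2.trans h)
  · rw [int_phic_lt _ (by positivity) (by rw [div_lt_one hΛ]; exact h)]
    have hi : ∀ a b, IntervalIntegrable (gk κ) MeasureTheory.volume a b := fun a b => (gk_cont κ hκ).intervalIntegrable a b
    rw [← intervalIntegral.integral_add_adjacent_intervals (hi 0 κ) (hi κ Λ)]
    have e1 : ∫ t in (0:ℝ)..κ, gk κ t = 0 := by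
      rw [intervalIntegral.integral_congr (g := fun _ => (0:ℝ))]
      · simp
      · intro t ht
        rw [Set.uIcc_of_le hκ.le] at ht
        exact gk_zero κ t hκ ht.2
    have e2 : ∫ t in κ..Λ, gk κ t = -((1 + Real.log Λ - Real.log κ) / Λ) - -((1 + Real.log κ - Real.log κ) / κ) := by
      refine intervalIntegral.integral_eq_sub_of_hasDerivAt (f := fun t => -((1 + Real.log t - Real.log κ) / t)) ?_ (hi κ Λ)
      intro t ht
      rw [Set.uIcc_of_le h.le] at ht
      have ht0 : 0 < t := by linarith [ht.1]
      have := (((((Real.hasDerivAt_log ht0.ne').const_add 1).sub_const (Real.log κ)).div (hasDerivAt_id t) ht0.ne')).neg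
      refine this.congr_deriv ?_
      rw [gk_large κ t hκ ht.1, Real.log_div ht0.ne' hκ.ne']
      simp only [id]
      field_simp
      ring
    rw [e1, e2, Real.log_div hκ.ne' hΛ.ne']
    field_simp
    ring


def quads (m : ℕ) : Finset ((ℕ × ℕ) × (ℕ × ℕ)) :=
  ((Icc 1 m ×ˢ Icc 1 m) ×ˢ (Icc 1 m ×ˢ Icc 1 m)).filter (fun x => x.1.1 * x.1.2 * x.2.1 * x.2.2 = m)

lemma mem_quads (m : ℕ) (hm : 0 < m) (x) : x ∈ quads m ↔ x.1.1 * x.1.2 * x.2.1 * x.2.2 = m := by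
  unfold quads
  simp only [mem_filter, mem_product, mem_Icc, and_iff_right_iff_imp]
  intro h
  have key : ∀ d, d ∣ m → 1 ≤ d ∧ d ≤ m := fun d hd => ⟨Nat.pos_of_dvd_of_pos hd hm, Nat.le_of_dvd hm hd⟩
  refine ⟨⟨key _ ?_, key _ ?_⟩, key _ ?_, key _ ?_⟩
  · exact ⟨x.1.2 * x.2.1 * x.2.2, by rw [← h]; ring⟩
  · exact ⟨x.1.1 * x.2.1 * x.2.2, by rw [← h]; ring⟩
  · exact ⟨x.1.1 * x.1.2 * x.2.2, by rw [← h]; ring⟩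
  · exact ⟨x.1.1 * x.1.2 * x.2.1, by rw [← h]; ring⟩

lemma quads_dvd (m : ℕ) (hm : 0 < m) (x) (hx : x ∈ quads m) :
    x.1.1 ∣ m ∧ x.1.2 ∣ m ∧ x.2.1 ∣ m ∧ x.2.2 ∣ m := by
  rw [mem_quads m hm] at hx
  refine ⟨?_, ?_, ?_, ?_⟩
  · exact ⟨x.1.2 * x.2.1 * x.2.2, by rw [← hx]; ring⟩
  · exact ⟨x.1.1 * x.2.1 * x.2.2, by rw [← hx]; ring⟩
  · exact ⟨x.1.1 * x.1.2 * x.2.2, by rw [← hx]; ring⟩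
  · exact ⟨x.1.1 * x.1.2 * x.2.1, by rw [← hx]; ring⟩

def gq (A : ℕ) (x : (ℕ × ℕ) × (ℕ × ℕ)) : (ℕ × ℕ) × (ℕ × ℕ) :=
  ((Nat.gcd x.1.1 A, Nat.gcd x.1.2 A), (Nat.gcd x.2.1 A, Nat.gcd x.2.2 A))

lemma gq_mem (A B : ℕ) (hA : 0 < A) (hB : 0 < B) (hAB : Nat.Coprime A B) (x) (hx : x ∈ quads (A * B)) :
    gq A x ∈ quads A ∧ gq B x ∈ quads B ∧ gq A x * gq B x = x := by
  have hd := quads_dvd _ (by positivity) x hx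
  rw [mem_quads _ (by positivity)] at hx
  have hs : ∀ d, d ∣ A * B → Nat.gcd d A * Nat.gcd d B = d := fun d h => by
    rw [← Nat.Coprime.gcd_mul d hAB]; exact Nat.gcd_eq_left h
  have hprod : gq A x * gq B x = x := by
    unfold gq
    simp only [Prod.mk_mul_mk, hs _ hd.1, hs _ hd.2.1, hs _ hd.2.2.1, hs _ hd.2.2.2]
  set a := (gq A x).1.1 * (gq A x).1.2 * (gq A x).2.1 * (gq A x).2.2 with ha
  set b := (gq B x).1.1 * (gq B x).1.2 * (gq B x).2.1 * (gq B x).2.2 with hb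
  have hab : a * b = A * B := by
    conv_rhs => rw [← hx, ← hprod]
    simp only [Prod.fst_mul, Prod.snd_mul, ha, hb]; ring
  have cA : ∀ d, Nat.Coprime (Nat.gcd d A) B := fun d => Nat.Coprime.coprime_dvd_left (Nat.gcd_dvd_right _ _) hAB
  have cB : ∀ d, Nat.Coprime (Nat.gcd d B) A := fun d => Nat.Coprime.coprime_dvd_left (Nat.gcd_dvd_right _ _) hAB.symm
  have haB : Nat.Coprime a B := by
    rw [ha]; exact Nat.Coprime.mul_left (Nat.Coprime.mul_left (Nat.Coprime.mul_left (cA _) (cA _)) (cA _)) (cA _)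
  have hbA : Nat.Coprime b A := by
    rw [hb]; exact Nat.Coprime.mul_left (Nat.Coprime.mul_left (Nat.Coprime.mul_left (cB _) (cB _)) (cB _)) (cB _)
  have h1 : a ∣ A := haB.dvd_of_dvd_mul_right (Dvd.intro b hab)
  have h2 : A ∣ a := hbA.symm.dvd_of_dvd_mul_right (by rw [hab]; exact Dvd.intro _ rfl)
  have h3 : a = A := Nat.dvd_antisymm h1 h2
  have h4 : b = B := by
    rw [h3] at hab; exact Nat.eq_of_mul_eq_mul_left hA hab
  exact ⟨(mem_quads A hA _).mpr h3, (mem_quads B hB _).mpr h4, hprod⟩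

lemma quads_mul (A B : ℕ) (hA : 0 < A) (hB : 0 < B) (hAB : Nat.Coprime A B)
    (f : (ℕ × ℕ) × (ℕ × ℕ) → ℝ) :
    ∑ x ∈ quads (A * B), f x = ∑ y ∈ quads A, ∑ z ∈ quads B, f (y * z) := by
  rw [← sum_product']
  refine sum_bij' (fun x _ => (gq A x, gq B x)) (fun y _ => y.1 * y.2) ?_ ?_ ?_ ?_ ?_
  · intro x hx
    have := gq_mem A B hA hB hAB x hx
    exact mem_product.mpr ⟨this.1, this.2.1⟩
  · intro y hy
    rw [mem_product, mem_quads A hA, mem_quads B hB] at hy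
    rw [mem_quads _ (by positivity)]
    rw [← hy.1, ← hy.2]
    simp only [Prod.fst_mul, Prod.snd_mul]; ring
  · intro x hx
    exact (gq_mem A B hA hB hAB x hx).2.2
  · rintro ⟨y, z⟩ hy
    rw [mem_product] at hy
    have dy := quads_dvd A hA y hy.1
    have dz := quads_dvd B hB z hy.2
    have k1 : ∀ a b, a ∣ A → b ∣ B → Nat.gcd (a * b) A = a := fun a b h1 h2 => by
      rw [Nat.Coprime.gcd_mul_right_cancel a (Nat.Coprime.coprime_dvd_left h2 hAB.symm)]
      exact Nat.gcd_eq_left h1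
    have k2 : ∀ a b, a ∣ A → b ∣ B → Nat.gcd (a * b) B = b := fun a b h1 h2 => by
      rw [Nat.Coprime.gcd_mul_left_cancel b (Nat.Coprime.coprime_dvd_left h1 hAB)]
      exact Nat.gcd_eq_left h2
    unfold gq
    simp only [Prod.fst_mul, Prod.snd_mul, k1 _ _ dy.1 dz.1, k1 _ _ dy.2.1 dz.2.1, k1 _ _ dy.2.2.1 dz.2.2.1,
      k1 _ _ dy.2.2.2 dz.2.2.2, k2 _ _ dy.1 dz.1, k2 _ _ dy.2.1 dz.2.1, k2 _ _ dy.2.2.1 dz.2.2.1,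
      k2 _ _ dy.2.2.2 dz.2.2.2]
  · intro x hx
    rw [(gq_mem A B hA hB hAB x hx).2.2]

noncomputable def vp (p : ℕ) : ℝ := (1 + 1 / (p:ℝ))⁻¹
noncomputable def cp (p : ℕ) : ℝ := -1 / ((p:ℝ) * ((p:ℝ) - 1))
open scoped Classical in
noncomputable def wl (p : ℕ) (a : Prop) : ℝ := if a then (p:ℝ) else vp p
noncomputable def Lp (p : ℕ) (a b : Prop) : ℝ :=
  1 + cp p * wl p a + cp p * wl p b + cp p ^ 2 * wl p a * wl p b * ind (a ∨ b)

noncomputable def KS (S : Finset ℕ) (m : ℕ) : ℝ :=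
  ∑ x ∈ quads m, (x.1.1 : ℝ) * (ArithmeticFunction.moebius x.2.1 : ℝ) * (ArithmeticFunction.moebius x.2.2 : ℝ) *
    ∏ p ∈ S, Lp p (p ∣ x.2.1 ∨ p ∣ x.1.2) (p ∣ x.2.2 ∨ p ∣ x.1.2)

lemma KS_mul (p e m : ℕ) (S : Finset ℕ) (hp : p.Prime) (hS : ∀ q ∈ S, q.Prime) (hpS : p ∉ S) (hm : 0 < m) (hpm : ¬ p ∣ m) :
    KS (insert p S) (p ^ e * m) = KS {p} (p ^ e) * KS S m := by
  have hcop : Nat.Coprime (p ^ e) m := Nat.Coprime.pow_left e ((Nat.Prime.coprime_iff_not_dvd hp).mpr hpm)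
  have hpe : 0 < p ^ e := pow_pos hp.pos e
  unfold KS
  rw [quads_mul _ _ hpe hm hcop, sum_mul_sum]
  refine sum_congr rfl fun y hy => sum_congr rfl fun z hz => ?_
  have dy := quads_dvd _ hpe y hy
  have dz := quads_dvd _ hm z hz
  have mm : ∀ a b, a ∣ p ^ e → b ∣ m → (ArithmeticFunction.moebius (a * b) : ℝ) =
      (ArithmeticFunction.moebius a : ℝ) * (ArithmeticFunction.moebius b : ℝ) := fun a b h1 h2 => by
    rw [ArithmeticFunction.isMultiplicative_moebius.map_mul_of_coprime
      (Nat.Coprime.coprime_dvd_left h1 (Nat.Coprime.coprime_dvd_right h2 hcop))]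
    push_cast; rfl
  have d1 : ∀ a b, b ∣ m → (p ∣ a * b ↔ p ∣ a) := fun a b h => by
    rw [hp.dvd_mul, or_iff_left]; exact fun h' => hpm (h'.trans h)
  have d2 : ∀ q ∈ S, ∀ a b, a ∣ p ^ e → (q ∣ a * b ↔ q ∣ b) := fun q hq a b h => by
    rw [(hS q hq).dvd_mul, or_iff_right]
    intro h'
    have := (Nat.prime_dvd_prime_iff_eq (hS q hq) hp).mp ((hS q hq).dvd_of_dvd_pow (h'.trans h))
    exact hpS (this ▸ hq)
  simp only [Prod.fst_mul, Prod.snd_mul]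
  rw [prod_insert hpS, prod_singleton, mm _ _ dy.2.2.1 dz.2.2.1, mm _ _ dy.2.2.2 dz.2.2.2,
    d1 _ _ dz.2.1, d1 _ _ dz.2.2.1, d1 _ _ dz.2.2.2]
  have : ∏ q ∈ S, Lp q (q ∣ y.2.1 * z.2.1 ∨ q ∣ y.1.2 * z.1.2) (q ∣ y.2.2 * z.2.2 ∨ q ∣ y.1.2 * z.1.2) =
      ∏ q ∈ S, Lp q (q ∣ z.2.1 ∨ q ∣ z.1.2) (q ∣ z.2.2 ∨ q ∣ z.1.2) := by
    refine prod_congr rfl fun q hq => ?_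
    rw [d2 q hq _ _ dy.2.1, d2 q hq _ _ dy.2.2.1, d2 q hq _ _ dy.2.2.2]
  rw [this]
  push_cast
  ring


lemma quads_pp (p e : ℕ) (hp : p.Prime) (F : (ℕ × ℕ) × (ℕ × ℕ) → ℝ) :
    ∑ x ∈ quads (p ^ e), F x = ∑ c ∈ range (e + 1), ∑ f ∈ range (e + 1), ∑ b ∈ range (e + 1), ∑ a ∈ range (e + 1),
      if a + b + c + f = e then F ((p ^ a, p ^ b), (p ^ c, p ^ f)) else 0 := by
  have hinj := Nat.pow_right_injective hp.two_le
  have h1 : ∑ x ∈ quads (p ^ e), F x = ∑ y ∈ ((range (e + 1) ×ˢ range (e + 1)) ×ˢ (range (e + 1) ×ˢ range (e + 1))).filter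
      (fun y => y.2.2 + y.2.1 + y.1.1 + y.1.2 = e), F ((p ^ y.2.2, p ^ y.2.1), (p ^ y.1.1, p ^ y.1.2)) := by
    symm
    refine sum_bij (fun y _ => ((p ^ y.2.2, p ^ y.2.1), (p ^ y.1.1, p ^ y.1.2))) ?_ ?_ ?_ ?_
    · intro y hy
      rw [mem_filter] at hy
      rw [mem_quads _ (pow_pos hp.pos e)]
      simp only [← pow_add, hy.2]
    · rintro ⟨⟨c, f⟩, b, a⟩ _ ⟨⟨c', f'⟩, b', a'⟩ _ h
      simp only [Prod.mk.injEq] at h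
      obtain ⟨⟨ha, hb⟩, hc, hf⟩ := h
      simp only [hinj ha, hinj hb, hinj hc, hinj hf]
    · intro x hx
      have hd := quads_dvd _ (pow_pos hp.pos e) x hx
      rw [mem_quads _ (pow_pos hp.pos e)] at hx
      obtain ⟨⟨n, δ⟩, d1, d3⟩ := x
      simp only at hd hx
      obtain ⟨a, ha, ha'⟩ := (Nat.dvd_prime_pow hp).1 hd.1
      obtain ⟨b, hb, hb'⟩ := (Nat.dvd_prime_pow hp).1 hd.2.1
      obtain ⟨c, hc, hc'⟩ := (Nat.dvd_prime_pow hp).1 hd.2.2.1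
      obtain ⟨f, hf, hf'⟩ := (Nat.dvd_prime_pow hp).1 hd.2.2.2
      subst ha' hb' hc' hf'
      simp only [← pow_add] at hx
      have := hinj hx
      refine ⟨((c, f), b, a), ?_, rfl⟩
      simp only [mem_filter, mem_product, mem_range]
      omega
    · intro y _; rfl
  rw [h1, sum_filter, sum_product, sum_product]
  refine sum_congr rfl fun c _ => sum_congr rfl fun f _ => ?_
  rw [sum_product]

lemma mu_pp (p k : ℕ) (hp : p.Prime) (hk : 2 ≤ k) : ArithmeticFunction.moebius (p ^ k) = 0 := by
  rw [ArithmeticFunction.moebius_apply_prime_pow hp (by omega), if_neg (by omega)]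

lemma E_sum (e k : ℕ) (x : ℝ) : ∑ b ∈ range e, ∑ a ∈ range (e + 1), (if a + (b + 1) + k = e then x ^ a else 0)
    = ∑ a ∈ range (e - k), x ^ a := by
  rw [sum_comm]
  have h1 : range (e - k) = (range (e + 1)).filter (fun a => a + 1 + k ≤ e) := by
    ext a; simp only [mem_filter, mem_range]; omega
  rw [h1, sum_filter]
  refine sum_congr rfl fun a _ => ?_
  split_ifs with h
  · rw [sum_eq_single_of_mem (e - (a + 1 + k)) (mem_range.mpr (by omega))]
    · rw [if_pos (by omega)]
    · intro b _ hb; rw [if_neg (by omega)]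
  · refine sum_eq_zero fun b _ => ?_
    rw [if_neg (by omega)]

lemma z_sum (e k : ℕ) (x : ℝ) : ∑ a ∈ range (e + 1), (if a + k = e then x ^ a else 0) = if k ≤ e then x ^ (e - k) else 0 := by
  split_ifs with h
  · rw [sum_eq_single_of_mem (e - k) (mem_range.mpr (by omega))]
    · rw [if_pos (by omega)]
    · intro b _ hb; rw [if_neg (by omega)]
  · refine sum_eq_zero fun b _ => ?_
    rw [if_neg (by omega)]

lemma wl_pos {p : ℕ} {a : Prop} (h : a) : wl p a = p := by unfold wl; rw [if_pos h]
lemma wl_neg {p : ℕ} {a : Prop} (h : ¬ a) : wl p a = vp p := by unfold wl; rw [if_neg h]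

lemma KS_p_zero (p : ℕ) (hp : p.Prime) : (1 - 1 / (p:ℝ)^2) * KS {p} 1 = 1 - 3 / (p:ℝ)^2 := by
  have e : quads 1 = {((1, 1), (1, 1))} := by decide
  unfold KS
  rw [e]
  have h1 : ¬ (p ∣ 1 ∨ p ∣ 1) := by rw [Nat.dvd_one]; have := hp.one_lt; omega
  simp only [sum_singleton, prod_singleton]
  unfold Lp
  rw [wl_neg h1, ind_neg (by tauto)]
  have hp1 : (2:ℝ) ≤ p := by exact_mod_cast hp.two_le
  have a1 : (p:ℝ) - 1 ≠ 0 := by linarith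
  have a2 : (p:ℝ) + 1 ≠ 0 := by linarith
  have a3 : (p:ℝ) ≠ 0 := by linarith
  unfold vp cp
  simp only [ArithmeticFunction.moebius_apply_one]
  have a4 : 1 + 1 / (p:ℝ) = (p + 1) / p := by field_simp
  rw [a4]
  field_simp
  push_cast
  ring

lemma KS_p_pos (p e : ℕ) (hp : p.Prime) (he : 0 < e) :
    KS {p} (p ^ e) = (p:ℝ) ^ e * (Lp p False False + (Lp p True True - Lp p True False - Lp p False True) / p) := by
  have hp0 : (p:ℝ) ≠ 0 := by exact_mod_cast hp.ne_zero
  unfold KS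
  rw [quads_pp p e hp]
  simp only [prod_singleton]
  have sub2 : range 2 ⊆ range (e + 1) := range_subset_range.mpr (by omega)
  rw [← sum_subset sub2]
  swap
  · intro c _ hc
    refine sum_eq_zero fun f _ => sum_eq_zero fun b _ => sum_eq_zero fun a _ => ?_
    rw [mu_pp p c hp (by simp only [mem_range] at hc; omega)]
    simp
  rw [sum_congr rfl fun c _ => (sum_subset sub2 ?_).symm]
  swap
  · intro f _ hf
    refine sum_eq_zero fun b _ => sum_eq_zero fun a _ => ?_
    rw [mu_pp p f hp (by simp only [mem_range] at hf; omega)]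
    simp
  have dk : ∀ k, p ∣ p ^ (k + 1) := fun k => dvd_pow_self p (by omega)
  have d0 : ¬ p ∣ p ^ 0 := by rw [pow_zero, Nat.dvd_one]; exact hp.one_lt.ne'
  have mu1 : (ArithmeticFunction.moebius (p ^ 1) : ℝ) = -1 := by
    rw [pow_one, ArithmeticFunction.moebius_apply_prime hp]; simp
  have mu0 : (ArithmeticFunction.moebius (p ^ 0) : ℝ) = 1 := by
    rw [pow_zero, ArithmeticFunction.moebius_apply_one]; simp
  have inner : ∀ c f : ℕ, ∑ b ∈ range (e + 1), ∑ a ∈ range (e + 1), (if a + b + c + f = e then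
      ((p ^ a : ℕ) : ℝ) * (ArithmeticFunction.moebius (p ^ c) : ℝ) * (ArithmeticFunction.moebius (p ^ f) : ℝ) *
        Lp p (p ∣ p ^ c ∨ p ∣ p ^ b) (p ∣ p ^ f ∨ p ∣ p ^ b) else 0) =
      (ArithmeticFunction.moebius (p ^ c) : ℝ) * (ArithmeticFunction.moebius (p ^ f) : ℝ) *
      (Lp p True True * (∑ a ∈ range (e - (c + f)), (p:ℝ) ^ a) +
        Lp p (p ∣ p ^ c) (p ∣ p ^ f) * if c + f ≤ e then (p:ℝ) ^ (e - (c + f)) else 0) := by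
    intro c f
    rw [sum_range_succ', ← E_sum, ← z_sum, mul_add, mul_sum, mul_sum, mul_sum, mul_sum]
    congr 1
    · refine sum_congr rfl fun b _ => ?_
      rw [mul_sum, mul_sum]
      refine sum_congr rfl fun a _ => ?_
      simp only [dk, or_true]
      rw [add_assoc (a + (b + 1)) c f]
      split_ifs
      · push_cast; ring
      · simp
    · refine sum_congr rfl fun a _ => ?_
      simp only [d0, or_false, add_zero]
      rw [add_assoc a c f]
      split_ifs
      · push_cast; ring
      · simp
  rw [sum_congr rfl fun c _ => sum_congr rfl fun f _ => inner c f]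
  simp only [sum_range_succ, range_zero, sum_empty, zero_add, add_zero, mu0, mu1, d0, dk 0]
  obtain rfl | ⟨k, rfl⟩ : e = 1 ∨ ∃ k, e = k + 2 := by
    rcases e with _ | _ | k
    · omega
    · left; rfl
    · right; exact ⟨k, rfl⟩
  · norm_num
    field_simp
    ring
  · rw [show k + 2 - (1 + 1) = k by omega, show k + 2 - 0 = k + 2 by omega, show k + 2 - 1 = k + 1 by omega]
    rw [if_pos (by omega), if_pos (by omega), if_pos (by omega)]
    simp only [sum_range_succ]
    field_simp
    ring

lemma KS_p_loc (p e : ℕ) (hp : p.Prime) :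
    (1 - 1 / (p:ℝ)^2) * KS {p} (p ^ e) = (p:ℝ) ^ e * locd p (p ^ e) := by
  rcases Nat.eq_zero_or_pos e with rfl | he
  · rw [pow_zero, pow_zero, KS_p_zero p hp]
    unfold locd
    rw [if_neg (by rw [Nat.dvd_one]; exact hp.one_lt.ne'), one_mul]
  · rw [KS_p_pos p e hp he]
    unfold locd
    rw [if_pos (dvd_pow_self p (by omega)), mul_left_comm]
    congr 1
    unfold Lp
    rw [wl_pos (a := True) trivial, wl_neg (a := False) id, ind_neg (P := False ∨ False) (by tauto),
      ind_pos (P := True ∨ True) (by tauto), ind_pos (P := True ∨ False) (by tauto), ind_pos (P := False ∨ True) (by tauto)]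
    have hp1 : (2:ℝ) ≤ p := by exact_mod_cast hp.two_le
    have a1 : (p:ℝ) - 1 ≠ 0 := by linarith
    have a2 : (p:ℝ) + 1 ≠ 0 := by linarith
    have a3 : (p:ℝ) ≠ 0 := by linarith
    unfold vp cp
    have a4 : 1 + 1 / (p:ℝ) = (p + 1) / p := by field_simp
    rw [a4]
    field_simp
    ring

lemma locd_congr {p m n : ℕ} (h : p ∣ m ↔ p ∣ n) : locd p m = locd p n := by
  unfold locd; simp only [h]

lemma KS_prod (S : Finset ℕ) : ∀ m : ℕ, 0 < m → (∀ q ∈ S, q.Prime) → m.primeFactors ⊆ S →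
    (∏ p ∈ S, (1 - 1 / (p:ℝ)^2)) * KS S m = m * ∏ p ∈ S, locd p m := by
  induction S using Finset.induction_on with
  | empty =>
    intro m hm _ hS
    have : m = 1 := by
      have := Nat.primeFactors_eq_empty.mp (subset_empty.mp hS)
      omega
    subst this
    have e : quads 1 = {((1, 1), (1, 1))} := by decide
    unfold KS
    rw [e]
    simp
  | insert p S hpS ih =>
    intro m hm hS hsub
    have hp := hS p (mem_insert_self _ _)
    have hS' : ∀ q ∈ S, q.Prime := fun q hq => hS q (mem_insert_of_mem hq)
    obtain ⟨e, m', hpm, rfl⟩ := Nat.exists_eq_pow_mul_and_not_dvd hm.ne' p hp.ne_one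
    have hm' : 0 < m' := Nat.pos_of_ne_zero (by rintro rfl; simp at hpm)
    rw [KS_mul p e m' S hp hS' hpS hm' hpm, prod_insert hpS, prod_insert hpS]
    have i := ih m' hm' hS' (by
      intro q hq
      have hqp := Nat.prime_of_mem_primeFactors hq
      have hqd := Nat.dvd_of_mem_primeFactors hq
      have := hsub (Nat.mem_primeFactors.mpr ⟨hqp, hqd.mul_left _, by positivity⟩)
      rcases mem_insert.mp this with rfl | h
      · exact absurd hqd hpm
      · exact h)
    have l1 : locd p (p ^ e * m') = locd p (p ^ e) := by
      apply locd_congr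
      rw [hp.dvd_mul, or_iff_left hpm]
    have l2 : ∏ q ∈ S, locd q (p ^ e * m') = ∏ q ∈ S, locd q m' := by
      refine prod_congr rfl fun q hq => ?_
      apply locd_congr
      rw [(hS' q hq).dvd_mul, or_iff_right]
      intro h'
      have := (Nat.prime_dvd_prime_iff_eq (hS' q hq) hp).mp ((hS' q hq).dvd_of_dvd_pow h')
      exact hpS (this ▸ hq)
    rw [l1, l2]
    have := KS_p_loc p e hp
    push_cast
    calc _ = ((1 - 1 / (p:ℝ)^2) * KS {p} (p ^ e)) * ((∏ p ∈ S, (1 - 1 / (p:ℝ)^2)) * KS S m') := by ring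
      _ = _ := by rw [this, i]; ring


def gg (u δ k : ℕ) : ℕ := Nat.gcd u k * Nat.gcd δ (k / Nat.gcd u k)
def rr (u δ k : ℕ) : ℕ := k / gg u δ k
noncomputable def VV (n : ℕ) : ℝ := ∏ p ∈ n.primeFactors, (1 + 1 / (p:ℝ))⁻¹
noncomputable def aa (u δ k : ℕ) : ℝ := (gg u δ k : ℝ) * VV (rr u δ k)
noncomputable def FF (k l : ℕ) (x : (ℕ × ℕ) × (ℕ × ℕ)) : ℝ :=
  ind (Nat.Coprime (rr x.2.1 x.1.2 k) (rr x.2.2 x.1.2 l)) * aa x.2.1 x.1.2 k * aa x.2.2 x.1.2 l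
noncomputable def cc (d : ℕ) : ℝ := (ArithmeticFunction.moebius d : ℝ) / ((d:ℝ) * (Nat.totient d : ℝ))

lemma gg_dvd (u δ k : ℕ) : gg u δ k ∣ k := by
  unfold gg
  exact Nat.mul_dvd_of_dvd_div (Nat.gcd_dvd_right _ _) (Nat.gcd_dvd_right _ _)

lemma rr_dvd (u δ k : ℕ) : rr u δ k ∣ k := Nat.div_dvd_of_dvd (gg_dvd u δ k)

lemma gg_mul (u δ k l : ℕ) (h : Nat.Coprime k l) : gg u δ (k * l) = gg u δ k * gg u δ l := by
  unfold gg
  rw [Nat.Coprime.gcd_mul u h, ← Nat.div_mul_div_comm (Nat.gcd_dvd_right _ _) (Nat.gcd_dvd_right _ _),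
    Nat.Coprime.gcd_mul δ]
  · ring
  · exact Nat.Coprime.coprime_dvd_left (Nat.div_dvd_of_dvd (Nat.gcd_dvd_right _ _))
      (Nat.Coprime.coprime_dvd_right (Nat.div_dvd_of_dvd (Nat.gcd_dvd_right _ _)) h)

lemma rr_mul (u δ k l : ℕ) (h : Nat.Coprime k l) : rr u δ (k * l) = rr u δ k * rr u δ l := by
  unfold rr
  rw [gg_mul u δ k l h, Nat.div_mul_div_comm (gg_dvd _ _ _) (gg_dvd _ _ _)]

lemma gg_prime_pos (u δ p : ℕ) (hp : p.Prime) (h : p ∣ u ∨ p ∣ δ) : gg u δ p = p := by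
  unfold gg
  by_cases h1 : p ∣ u
  · rw [Nat.gcd_eq_right h1, Nat.div_self hp.pos, Nat.gcd_one_right, mul_one]
  · rw [((Nat.Prime.coprime_iff_not_dvd hp).mpr h1).symm.gcd_eq_one, Nat.div_one, one_mul, Nat.gcd_eq_right (h.resolve_left h1)]

lemma gg_prime_neg (u δ p : ℕ) (hp : p.Prime) (h : ¬ (p ∣ u ∨ p ∣ δ)) : gg u δ p = 1 := by
  push Not at h
  unfold gg
  rw [((Nat.Prime.coprime_iff_not_dvd hp).mpr h.1).symm.gcd_eq_one, Nat.div_one, one_mul,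
    ((Nat.Prime.coprime_iff_not_dvd hp).mpr h.2).symm.gcd_eq_one]

lemma rr_prime_pos (u δ p : ℕ) (hp : p.Prime) (h : p ∣ u ∨ p ∣ δ) : rr u δ p = 1 := by
  unfold rr; rw [gg_prime_pos u δ p hp h, Nat.div_self hp.pos]

lemma rr_prime_neg (u δ p : ℕ) (hp : p.Prime) (h : ¬ (p ∣ u ∨ p ∣ δ)) : rr u δ p = p := by
  unfold rr; rw [gg_prime_neg u δ p hp h, Nat.div_one]

lemma VV_mul (a b : ℕ) (h : Nat.Coprime a b) : VV (a * b) = VV a * VV b := by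
  unfold VV
  rw [h.primeFactors_mul, prod_union h.disjoint_primeFactors]

lemma aa_prime (u δ p : ℕ) (hp : p.Prime) : aa u δ p = wl p (p ∣ u ∨ p ∣ δ) := by
  unfold aa
  by_cases h : p ∣ u ∨ p ∣ δ
  · rw [gg_prime_pos u δ p hp h, rr_prime_pos u δ p hp h, wl_pos h]
    simp [VV]
  · rw [gg_prime_neg u δ p hp h, rr_prime_neg u δ p hp h, wl_neg h]
    unfold VV vp
    rw [hp.primeFactors]
    simp

lemma aa_mul (u δ k l : ℕ) (h : Nat.Coprime k l) : aa u δ (k * l) = aa u δ k * aa u δ l := by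
  unfold aa
  rw [gg_mul _ _ _ _ h, rr_mul _ _ _ _ h, VV_mul]
  · push_cast; ring
  · exact Nat.Coprime.coprime_dvd_left (rr_dvd _ _ _) (Nat.Coprime.coprime_dvd_right (rr_dvd _ _ _) h)

lemma cop_step (p a b : ℕ) (i j : ℕ) (hi : i = 1 ∨ i = p) (hj : j = 1 ∨ j = p) (ha : Nat.Coprime p a) (hb : Nat.Coprime p b) :
    Nat.Coprime (i * a) (j * b) ↔ Nat.Coprime i j ∧ Nat.Coprime a b := by
  have h1 : Nat.Coprime i b := by rcases hi with rfl | rfl; exact Nat.coprime_one_left _; exact hb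
  have h2 : Nat.Coprime a j := by rcases hj with rfl | rfl; exact Nat.coprime_one_right _; exact ha.symm
  rw [Nat.coprime_mul_iff_left, Nat.coprime_mul_iff_right, Nat.coprime_mul_iff_right]
  tauto

lemma rr_p_cases (u δ p : ℕ) (hp : p.Prime) : rr u δ p = 1 ∨ rr u δ p = p := (Nat.dvd_prime hp).1 (rr_dvd u δ p)

lemma rr_cop (u δ p k : ℕ) (h : Nat.Coprime p k) : Nat.Coprime p (rr u δ k) :=
  Nat.Coprime.coprime_dvd_right (rr_dvd _ _ _) h

lemma FF_left (p k l : ℕ) (x) (hp : p.Prime) (hk : Nat.Coprime p k) (hl : Nat.Coprime p l) :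
    FF (p * k) l x = wl p (p ∣ x.2.1 ∨ p ∣ x.1.2) * FF k l x := by
  unfold FF
  rw [aa_mul _ _ _ _ hk, aa_prime _ _ _ hp, rr_mul _ _ _ _ hk]
  have := cop_step p (rr x.2.1 x.1.2 k) (rr x.2.2 x.1.2 l) (rr x.2.1 x.1.2 p) 1 (rr_p_cases _ _ _ hp) (Or.inl rfl)
    (rr_cop _ _ _ _ hk) (rr_cop _ _ _ _ hl)
  rw [one_mul] at this
  rw [ind_iff (this.trans (and_iff_right (Nat.coprime_one_right _)))]
  ring

lemma FF_right (p k l : ℕ) (x) (hp : p.Prime) (hk : Nat.Coprime p k) (hl : Nat.Coprime p l) :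
    FF k (p * l) x = wl p (p ∣ x.2.2 ∨ p ∣ x.1.2) * FF k l x := by
  unfold FF
  rw [aa_mul _ _ _ _ hl, aa_prime _ _ _ hp, rr_mul _ _ _ _ hl]
  have := cop_step p (rr x.2.1 x.1.2 k) (rr x.2.2 x.1.2 l) 1 (rr x.2.2 x.1.2 p) (Or.inl rfl) (rr_p_cases _ _ _ hp)
    (rr_cop _ _ _ _ hk) (rr_cop _ _ _ _ hl)
  rw [one_mul] at this
  rw [ind_iff (this.trans (and_iff_right (Nat.coprime_one_left _)))]
  ring

lemma FF_both (p k l : ℕ) (x) (hp : p.Prime) (hk : Nat.Coprime p k) (hl : Nat.Coprime p l) :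
    FF (p * k) (p * l) x = wl p (p ∣ x.2.1 ∨ p ∣ x.1.2) * wl p (p ∣ x.2.2 ∨ p ∣ x.1.2) *
      ind ((p ∣ x.2.1 ∨ p ∣ x.1.2) ∨ (p ∣ x.2.2 ∨ p ∣ x.1.2)) * FF k l x := by
  unfold FF
  rw [aa_mul _ _ _ _ hl, aa_prime _ _ _ hp, rr_mul _ _ _ _ hl, aa_mul _ _ _ _ hk, aa_prime _ _ _ hp, rr_mul _ _ _ _ hk]
  have := cop_step p (rr x.2.1 x.1.2 k) (rr x.2.2 x.1.2 l) (rr x.2.1 x.1.2 p) (rr x.2.2 x.1.2 p)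
    (rr_p_cases _ _ _ hp) (rr_p_cases _ _ _ hp) (rr_cop _ _ _ _ hk) (rr_cop _ _ _ _ hl)
  rw [ind_iff this]
  by_cases h1 : p ∣ x.2.1 ∨ p ∣ x.1.2
  · rw [ind_pos (P := (p ∣ x.2.1 ∨ p ∣ x.1.2) ∨ (p ∣ x.2.2 ∨ p ∣ x.1.2)) (Or.inl h1), rr_prime_pos _ _ _ hp h1,
      ind_iff (and_iff_right (Nat.coprime_one_left _))]
    ring
  · by_cases h2 : p ∣ x.2.2 ∨ p ∣ x.1.2
    · rw [ind_pos (P := (p ∣ x.2.1 ∨ p ∣ x.1.2) ∨ (p ∣ x.2.2 ∨ p ∣ x.1.2)) (Or.inr h2), rr_prime_pos _ _ _ hp h2,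
        ind_iff (and_iff_right (Nat.coprime_one_right _))]
      ring
    · rw [ind_neg (P := (p ∣ x.2.1 ∨ p ∣ x.1.2) ∨ (p ∣ x.2.2 ∨ p ∣ x.1.2)) (by tauto), rr_prime_neg _ _ _ hp h1, rr_prime_neg _ _ _ hp h2,
        ind_neg]
      · ring
      · rw [Nat.coprime_self]; intro h; exact hp.ne_one h.1

lemma cc_mul (p k : ℕ) (hp : p.Prime) (hk : Nat.Coprime p k) : cc (p * k) = cp p * cc k := by
  unfold cc cp
  rw [ArithmeticFunction.isMultiplicative_moebius.map_mul_of_coprime hk, Nat.totient_mul hk,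
    ArithmeticFunction.moebius_apply_prime hp, Nat.totient_prime hp]
  have : ((p - 1 : ℕ) : ℝ) = (p:ℝ) - 1 := by rw [Nat.cast_sub hp.pos]; simp
  push_cast [this]
  rw [div_mul_div_comm]
  congr 1
  ring

lemma sum_FF (S : Finset ℕ) (x) : (∀ q ∈ S, q.Prime) →
    ∑ A ∈ S.powerset, ∑ B ∈ S.powerset, cc (∏ p ∈ A, p) * cc (∏ p ∈ B, p) * FF (∏ p ∈ A, p) (∏ p ∈ B, p) x
    = ∏ p ∈ S, Lp p (p ∣ x.2.1 ∨ p ∣ x.1.2) (p ∣ x.2.2 ∨ p ∣ x.1.2) := by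
  induction S using Finset.induction_on with
  | empty =>
    intro _
    simp [cc, FF, aa, VV, rr, gg, ind]
  | insert p S hpS ih =>
    intro hS
    have hp := hS p (mem_insert_self _ _)
    have hS' : ∀ q ∈ S, q.Prime := fun q hq => hS q (mem_insert_of_mem hq)
    have hcop : ∀ A ∈ S.powerset, Nat.Coprime p (∏ q ∈ A, q) := by
      intro A hA
      refine Nat.Coprime.prod_right fun q hq => ?_
      have hqS := mem_powerset.mp hA hq
      exact (Nat.coprime_primes hp (hS' q hqS)).mpr (by rintro rfl; exact hpS hqS)
    have hpA : ∀ A ∈ S.powerset, p ∉ A := fun A hA h => hpS (mem_powerset.mp hA h)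
    rw [prod_insert hpS, ← ih hS', sum_powerset_insert hpS, mul_sum, ← sum_add_distrib]
    refine sum_congr rfl fun A hA => ?_
    rw [sum_powerset_insert hpS, sum_powerset_insert hpS, mul_sum, ← sum_add_distrib, ← sum_add_distrib, ← sum_add_distrib]
    refine sum_congr rfl fun B hB => ?_
    rw [prod_insert (hpA A hA), prod_insert (hpA B hB), cc_mul _ _ hp (hcop A hA), cc_mul _ _ hp (hcop B hB),
      FF_both _ _ _ _ hp (hcop A hA) (hcop B hB), FF_left _ _ _ _ hp (hcop A hA) (hcop B hB),
      FF_right _ _ _ _ hp (hcop A hA) (hcop B hB)]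
    unfold Lp
    ring

lemma frakH_eq (k l m : ℕ) : frakH k l m = ∑ x ∈ quads m, (x.1.1 : ℝ) * (ArithmeticFunction.moebius x.2.1 : ℝ) *
    (ArithmeticFunction.moebius x.2.2 : ℝ) * FF k l x := by
  classical
  unfold frakH quads
  rw [sum_filter, sum_filter]
  refine sum_congr rfl fun x _ => ?_
  by_cases h : x.1.1 * x.1.2 * x.2.1 * x.2.2 = m
  · rw [if_pos h]
    by_cases h2 : Nat.Coprime (rr x.2.1 x.1.2 k) (rr x.2.2 x.1.2 l)
    · rw [if_pos ⟨h, h2⟩]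
      unfold FF
      rw [ind_pos h2]
      have e : (k * l) / (Nat.gcd x.2.1 k * Nat.gcd x.2.2 l * Nat.gcd x.1.2 (k / Nat.gcd x.2.1 k) *
          Nat.gcd x.1.2 (l / Nat.gcd x.2.2 l)) = rr x.2.1 x.1.2 k * rr x.2.2 x.1.2 l := by
        unfold rr
        rw [Nat.div_mul_div_comm (gg_dvd _ _ _) (gg_dvd _ _ _)]
        unfold gg
        congr 1
        ring
      rw [e]
      have := VV_mul _ _ h2
      change _ * VV _ = _
      rw [this]
      unfold aa gg
      push_cast
      ring
    · rw [if_neg (fun h' => h2 h'.2)]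
      unfold FF
      rw [ind_neg h2]; ring
  · rw [if_neg h, if_neg (fun h' => h h'.1)]

lemma sum_frakH (S : Finset ℕ) (m : ℕ) (hS : ∀ q ∈ S, q.Prime) :
    ∑ A ∈ S.powerset, ∑ B ∈ S.powerset, cc (∏ p ∈ A, p) * cc (∏ p ∈ B, p) * frakH (∏ p ∈ A, p) (∏ p ∈ B, p) m
    = KS S m := by
  unfold KS
  simp only [frakH_eq, mul_sum]
  rw [sum_congr rfl fun A _ => sum_comm, sum_comm]
  refine sum_congr rfl fun x _ => ?_
  rw [← sum_FF S x hS, mul_sum]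
  refine sum_congr rfl fun A _ => ?_
  rw [mul_sum]
  refine sum_congr rfl fun B _ => ?_
  ring

lemma VV_nonneg (n : ℕ) : 0 ≤ VV n := by unfold VV; exact prod_nonneg fun p _ => by positivity
lemma VV_le (n : ℕ) : VV n ≤ 1 := by
  unfold VV
  refine prod_le_one (fun p _ => by positivity) fun p _ => ?_
  apply inv_le_one_of_one_le₀
  have : (0:ℝ) ≤ 1 / p := by positivity
  linarith

lemma aa_bound (u δ k : ℕ) (hu : 0 < u) (hδ : 0 < δ) : 0 ≤ aa u δ k ∧ aa u δ k ≤ u * δ := by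
  unfold aa
  refine ⟨mul_nonneg (by positivity) (VV_nonneg _), ?_⟩
  have h1 : gg u δ k ≤ u * δ := Nat.mul_le_mul (Nat.gcd_le_left _ hu) (Nat.gcd_le_left _ hδ)
  have h2 : (gg u δ k : ℝ) ≤ u * δ := by exact_mod_cast h1
  calc (gg u δ k : ℝ) * VV (rr u δ k) ≤ gg u δ k * 1 := by gcongr; exact VV_le _
    _ ≤ _ := by rw [mul_one]; exact h2

lemma mu_abs (n : ℕ) : |(ArithmeticFunction.moebius n : ℝ)| ≤ 1 := by
  exact_mod_cast ArithmeticFunction.abs_moebius_le_one (n := n)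

lemma ind_le_one (P : Prop) : ind P ≤ 1 := by
  by_cases h : P
  · rw [ind_pos h]
  · rw [ind_neg h]; norm_num

lemma frakH_bound (m : ℕ) (hm : 0 < m) : ∃ C : ℝ, 0 ≤ C ∧ ∀ k l, |frakH k l m| ≤ C := by
  refine ⟨∑ x ∈ quads m, (x.1.1 : ℝ) * ((x.2.1 * x.1.2) * (x.2.2 * x.1.2)), sum_nonneg fun x _ => by positivity, fun k l => ?_⟩
  rw [frakH_eq]
  refine (abs_sum_le_sum_abs _ _).trans (sum_le_sum fun x hx => ?_)
  have hd := quads_dvd m hm x hx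
  have p2 := Nat.pos_of_dvd_of_pos hd.2.1 hm
  have p3 := Nat.pos_of_dvd_of_pos hd.2.2.1 hm
  have p4 := Nat.pos_of_dvd_of_pos hd.2.2.2 hm
  have b1 := aa_bound x.2.1 x.1.2 k p3 p2
  have b2 := aa_bound x.2.2 x.1.2 l p4 p2
  have b3 : |FF k l x| ≤ (x.2.1 * x.1.2) * (x.2.2 * x.1.2) := by
    unfold FF
    rw [abs_of_nonneg (mul_nonneg (mul_nonneg (ind_nonneg _) b1.1) b2.1)]
    have := ind_le_one (Nat.Coprime (rr x.2.1 x.1.2 k) (rr x.2.2 x.1.2 l))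
    calc _ ≤ 1 * aa x.2.1 x.1.2 k * aa x.2.2 x.1.2 l := by
          gcongr
          · exact b2.1
          · exact b1.1
      _ ≤ _ := by rw [one_mul]; exact mul_le_mul b1.2 b2.2 b2.1 (by positivity)
  rw [abs_mul, abs_mul, abs_mul, Nat.abs_cast]
  calc _ ≤ (x.1.1:ℝ) * 1 * 1 * ((x.2.1 * x.1.2) * (x.2.2 * x.1.2)) := by
        gcongr
        · exact mu_abs _
        · exact mu_abs _
    _ = _ := by ring


lemma zeta_tendsto : Tendsto (fun z => ∏ p ∈ Nat.primesBelow z, (1 - 1 / (p:ℝ) ^ 2)⁻¹) atTop (nhds (Real.pi ^ 2 / 6)) := by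
  have h := riemannZeta_eulerProduct (s := 2) (by norm_num)
  rw [riemannZeta_two] at h
  have h2 := (Complex.continuous_re.tendsto _).comp h
  have e : ((Real.pi : ℂ) ^ 2 / 6).re = Real.pi ^ 2 / 6 := by
    rw [show ((Real.pi : ℂ) ^ 2 / 6) = ((Real.pi ^ 2 / 6 : ℝ) : ℂ) by push_cast; rfl, Complex.ofReal_re]
  rw [e] at h2
  refine h2.congr fun z => ?_
  have : ∏ p ∈ Nat.primesBelow z, (1 - (p : ℂ) ^ (-2 : ℂ))⁻¹ = ((∏ p ∈ Nat.primesBelow z, (1 - 1 / (p:ℝ) ^ 2)⁻¹ : ℝ) : ℂ) := by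
    push_cast
    refine prod_congr rfl fun p _ => ?_
    rw [Complex.cpow_neg, one_div]
    norm_num
  simp only [Function.comp, this, Complex.ofReal_re]

def TT (z : ℕ) : Finset ℕ := (Nat.primesBelow z).powerset.image (fun A => ∏ p ∈ A, p)

lemma pb_prime (z : ℕ) : ∀ q ∈ Nat.primesBelow z, q.Prime := fun _ hq => Nat.prime_of_mem_primesBelow hq

lemma TT_sum (z : ℕ) (f : ℕ → ℝ) : ∑ d ∈ TT z, f d = ∑ A ∈ (Nat.primesBelow z).powerset, f (∏ p ∈ A, p) := by
  unfold TT
  rw [sum_image]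
  intro A hA B hB h
  have hA' : ∀ p ∈ A, p.Prime := fun p hp => pb_prime z p (mem_powerset.mp hA hp)
  have hB' : ∀ p ∈ B, p.Prime := fun p hp => pb_prime z p (mem_powerset.mp hB hp)
  rw [← Nat.primeFactors_prod hA', ← Nat.primeFactors_prod hB']
  simp only at h
  rw [h]

lemma cc_sqf (d : ℕ) (h : ¬ Squarefree d) : cc d = 0 := by
  unfold cc
  rw [ArithmeticFunction.moebius_eq_zero_of_not_squarefree h]; simp

lemma mem_TT (z d : ℕ) (hd : d < z) (h : Squarefree d) : d ∈ TT z := by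
  unfold TT
  rw [mem_image]
  refine ⟨d.primeFactors, ?_, Nat.prod_primeFactors_of_squarefree h⟩
  rw [mem_powerset]
  intro p hp
  rw [Nat.mem_primesBelow]
  exact ⟨(Nat.le_of_mem_primeFactors hp).trans_lt hd, Nat.prime_of_mem_primeFactors hp⟩

lemma TT_mono {z w : ℕ} (h : z ≤ w) : TT z ⊆ TT w := by
  unfold TT
  refine image_subset_image (powerset_mono.mpr ?_)
  intro p hp
  rw [Nat.mem_primesBelow] at *
  exact ⟨by omega, hp.2⟩

lemma cc_prod (A : Finset ℕ) : (∀ q ∈ A, q.Prime) → cc (∏ p ∈ A, p) = ∏ p ∈ A, cp p := by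
  induction A using Finset.induction_on with
  | empty => intro _; simp [cc]
  | insert p A hpA ih =>
    intro hS
    have hp := hS p (mem_insert_self _ _)
    have hS' : ∀ q ∈ A, q.Prime := fun q hq => hS q (mem_insert_of_mem hq)
    rw [prod_insert hpA, prod_insert hpA, cc_mul p _ hp, ih hS']
    refine Nat.Coprime.prod_right fun q hq => ?_
    exact (Nat.coprime_primes hp (hS' q hq)).mpr (by rintro rfl; exact hpA hq)

lemma cc_summable : Summable (fun d => |cc d|) := by
  have hs : Summable (fun n : ℕ => 2 / (n:ℝ) ^ 2) := by
    have := (Real.summable_one_div_nat_pow.mpr (by norm_num : 1 < 2)).mul_left 2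
    refine this.congr fun n => ?_
    rw [mul_one_div]
  refine summable_of_sum_le (c := Real.exp (∑' n : ℕ, 2 / (n:ℝ) ^ 2)) (fun d => abs_nonneg _) fun s => ?_
  set z := s.sup id + 1 with hz
  have h1 : ∑ d ∈ s, |cc d| ≤ ∑ d ∈ TT z, |cc d| := by
    classical
    have hfil : ∑ d ∈ s.filter (fun d => Squarefree d), |cc d| = ∑ d ∈ s, |cc d| := by
      refine sum_filter_of_ne fun d _ hne => ?_
      by_contra h
      rw [cc_sqf d h, abs_zero] at hne
      exact hne rfl
    rw [← hfil]
    refine sum_le_sum_of_subset_of_nonneg ?_ fun d _ _ => abs_nonneg _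
    intro d hd
    rw [mem_filter] at hd
    refine mem_TT z d ?_ hd.2
    have : d ≤ s.sup id := le_sup (f := id) hd.1
    omega
  refine h1.trans ?_
  rw [TT_sum]
  have h2 : ∑ A ∈ (Nat.primesBelow z).powerset, |cc (∏ p ∈ A, p)| = ∏ p ∈ Nat.primesBelow z, (1 + |cp p|) := by
    rw [prod_one_add]
    refine sum_congr rfl fun A hA => ?_
    rw [cc_prod A fun p hp => pb_prime z p (mem_powerset.mp hA hp), abs_prod]
  rw [h2]
  refine (Real.prod_one_add_le_exp_sum _ fun p => abs_nonneg _).trans ?_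
  apply Real.exp_le_exp.mpr
  refine le_trans (sum_le_sum fun p hp => ?_) (hs.sum_le_tsum (Nat.primesBelow z) fun n _ => by positivity)
  have hp1 : (2:ℝ) ≤ p := by exact_mod_cast (pb_prime z p hp).two_le
  unfold cp
  rw [abs_div, abs_neg, abs_one, abs_of_pos (by nlinarith), div_le_div_iff₀ (by nlinarith) (by positivity)]
  nlinarith

noncomputable def ff (m : ℕ) (x : ℕ × ℕ) : ℝ := cc x.1 * cc x.2 * frakH x.1 x.2 m

lemma ff_summable (m : ℕ) (hm : 0 < m) : Summable (ff m) := by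
  obtain ⟨C, hC, hb⟩ := frakH_bound m hm
  have h1 : Summable (fun x : ℕ × ℕ => |cc x.1| * |cc x.2|) :=
    cc_summable.mul_of_nonneg cc_summable (fun _ => abs_nonneg _) (fun _ => abs_nonneg _)
  refine Summable.of_norm_bounded (h1.mul_right C) fun x => ?_
  unfold ff
  rw [Real.norm_eq_abs, abs_mul, abs_mul]
  gcongr
  exact hb _ _

lemma KS_tendsto (m : ℕ) (hm : 0 < m) : Tendsto (fun z => KS (Nat.primesBelow z) m) atTop
    (nhds (Real.pi ^ 2 / 6 * (m * Cm m))) := by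
  refine (zeta_tendsto.mul ((Cm_tendsto m hm).const_mul (m:ℝ))).congr' ?_
  filter_upwards [eventually_gt_atTop m] with z hz
  have h := KS_prod (Nat.primesBelow z) m hm (pb_prime z) (by
    intro p hp
    rw [Nat.mem_primesBelow]
    exact ⟨(Nat.le_of_mem_primeFactors hp).trans_lt hz, Nat.prime_of_mem_primeFactors hp⟩)
  rw [← h, prod_inv_distrib, inv_mul_cancel_left₀]
  refine prod_ne_zero_iff.mpr fun p hp => ?_
  have hp1 : (2:ℝ) ≤ p := by exact_mod_cast (pb_prime z p hp).two_le
  have : 1 / (p:ℝ) ^ 2 < 1 := by rw [div_lt_one (by positivity)]; nlinarith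
  linarith

lemma ff_hasSum (m : ℕ) (hm : 0 < m) : HasSum (ff m) (Real.pi ^ 2 / 6 * (m * Cm m)) := by
  classical
  have hs := (ff_summable m hm).hasSum
  set U : ℕ → Finset ℕ := fun z => TT z ∪ (range z).filter (fun d => ¬ Squarefree d) with hU
  have hmono : Monotone fun z => U z ×ˢ U z := by
    intro z w h
    have : U z ⊆ U w := by
      refine union_subset_union (TT_mono h) (filter_subset_filter _ (range_subset_range.mpr h))
    exact product_subset_product this this
  have hex : ∀ d, ∀ z, d < z → d ∈ U z := by
    intro d z h
    simp only [hU, mem_union, mem_filter, mem_range]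
    by_cases hd : Squarefree d
    · exact Or.inl (mem_TT z d h hd)
    · exact Or.inr ⟨h, hd⟩
  have ht := tendsto_atTop_finset_of_monotone hmono (fun x => ⟨max x.1 x.2 + 1, mem_product.mpr
    ⟨hex _ _ (by omega), hex _ _ (by omega)⟩⟩)
  have h1 : Tendsto (fun z => ∑ x ∈ U z ×ˢ U z, ff m x) atTop (nhds (∑' x, ff m x)) := hs.comp ht
  have h2 : ∀ z, ∑ x ∈ U z ×ˢ U z, ff m x = KS (Nat.primesBelow z) m := by
    intro z
    have : ∑ x ∈ U z ×ˢ U z, ff m x = ∑ x ∈ TT z ×ˢ TT z, ff m x := by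
      symm
      refine sum_subset (product_subset_product subset_union_left subset_union_left) ?_
      rintro ⟨a, b⟩ hx hn
      unfold ff
      simp only [mem_product, hU, mem_union, mem_filter] at hx hn
      by_cases ha : Squarefree a
      · by_cases hb : Squarefree b
        · exfalso; tauto
        · simp only [cc_sqf b hb]; ring
      · simp only [cc_sqf a ha]; ring
    rw [this, sum_product, TT_sum, ← sum_frakH _ _ (pb_prime z)]
    refine sum_congr rfl fun A _ => ?_
    rw [TT_sum]
    rfl
  simp only [h2] at h1
  rwa [tendsto_nhds_unique h1 (KS_tendsto m hm)] at hs

lemma ff_pnat (m : ℕ) (hm : 0 < m) : HasSum (fun x : ℕ+ × ℕ+ => ff m ((x.1 : ℕ), (x.2 : ℕ))) (Real.pi ^ 2 / 6 * (m * Cm m)) := by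
  have hinj : Function.Injective (fun x : ℕ+ × ℕ+ => (((x.1 : ℕ), (x.2 : ℕ)) : ℕ × ℕ)) := by
    rintro ⟨a, b⟩ ⟨c, d⟩ h
    simp only [Prod.mk.injEq, PNat.coe_inj] at h
    rw [h.1, h.2]
  refine (hinj.hasSum_iff (f := ff m) ?_).mpr (ff_hasSum m hm)
  rintro ⟨a, b⟩ hx
  have c0 : cc 0 = 0 := by simp [cc]
  unfold ff
  rcases Nat.eq_zero_or_pos a with rfl | ha
  · simp only [c0]; ring
  · rcases Nat.eq_zero_or_pos b with rfl | hb
    · simp only [c0]; ring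
    · exact absurd ⟨(⟨a, ha⟩, ⟨b, hb⟩), rfl⟩ hx

lemma gTwo_eq (l : ℝ) (hl : 0 < l) (M : ℕ) (hM : 2 * l / betaP Pxx < M) :
    gTwo l = ∑ m ∈ Icc 1 M, (m * Cm m) * gk (m * betaP Pxx / 2) l := by
  classical
  have hβ := beta_pos
  set F := (Icc 1 (Nat.floor (2 * l / betaP Pxx))).filter (fun m : ℕ => (m : ℝ) < 2 * l / betaP Pxx) with hF
  have hFm : ∀ m ∈ F, 1 ≤ m := fun m hm => (mem_Icc.mp (mem_filter.mp hm).1).1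
  have hsum : HasSum (fun x : ℕ+ × ℕ+ => ∑ m ∈ F, ff m ((x.1 : ℕ), (x.2 : ℕ)) * Real.log (2 * l / ((m:ℝ) * betaP Pxx)))
      (∑ m ∈ F, Real.pi ^ 2 / 6 * (m * Cm m) * Real.log (2 * l / ((m:ℝ) * betaP Pxx))) :=
    hasSum_sum fun m hm => (ff_pnat m (hFm m hm)).mul_right _
  have h1 : ∑' d₂ : ℕ+, ∑' d₄ : ℕ+,
      ((ArithmeticFunction.moebius (d₂ : ℕ) : ℝ) * (ArithmeticFunction.moebius (d₄ : ℕ) : ℝ) /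
          (((d₂ : ℕ) : ℝ) * ((d₄ : ℕ) : ℝ) * (Nat.totient (d₂ : ℕ) : ℝ) *
            (Nat.totient (d₄ : ℕ) : ℝ))) *
        ∑ m ∈ F, frakH (d₂ : ℕ) (d₄ : ℕ) m * Real.log (2 * l / ((m : ℝ) * betaP Pxx)) =
      ∑ m ∈ F, Real.pi ^ 2 / 6 * (m * Cm m) * Real.log (2 * l / ((m:ℝ) * betaP Pxx)) := by
    rw [← hsum.tsum_eq, hsum.summable.tsum_prod]
    refine tsum_congr fun a => tsum_congr fun b => ?_
    rw [mul_sum]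
    refine sum_congr rfl fun m _ => ?_
    unfold ff cc
    rw [div_mul_div_comm, show ((a:ℕ):ℝ) * ((b:ℕ):ℝ) * (Nat.totient (a:ℕ) : ℝ) * (Nat.totient (b:ℕ) : ℝ) =
      ((a:ℕ):ℝ) * (Nat.totient (a:ℕ) : ℝ) * (((b:ℕ):ℝ) * (Nat.totient (b:ℕ) : ℝ)) by ring]
    ring
  unfold gTwo
  have h2 : F ⊆ Icc 1 M := by
    intro m hm
    have := (mem_filter.mp hm).2.trans hM
    exact mem_Icc.mpr ⟨hFm m hm, by exact_mod_cast this.le⟩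
  rw [← sum_subset h2]
  · refine Eq.trans (congrArg _ h1) ?_
    rw [mul_sum]
    refine sum_congr rfl fun m hm => ?_
    have hm0 : (0:ℝ) < m := by exact_mod_cast hFm m hm
    have hlt := (mem_filter.mp hm).2
    rw [lt_div_iff₀ hβ] at hlt
    rw [gk_large _ _ (by positivity) (by linarith)]
    rw [show l / ((m:ℝ) * betaP Pxx / 2) = 2 * l / ((m:ℝ) * betaP Pxx) by field_simp]
    have := Real.pi_pos
    field_simp
  · intro m hm hn
    have hm1 := (mem_Icc.mp hm).1
    have hm0 : (0:ℝ) < m := by exact_mod_cast hm1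
    rw [gk_zero, mul_zero]
    · positivity
    · by_contra! hlt
      apply hn
      have h3 : (m:ℝ) < 2 * l / betaP Pxx := by rw [lt_div_iff₀ hβ]; linarith
      exact mem_filter.mpr ⟨mem_Icc.mpr ⟨hm1, Nat.le_floor h3.le⟩, h3⟩

lemma int_gTwo (Λ : ℝ) (hΛ : 0 < Λ) (M : ℕ) (hM : 2 * Λ / betaP Pxx < M) :
    ∫ l in (0:ℝ)..Λ, gTwo l = (∑ m ∈ Icc 1 M, Cm m * ∫ t in (0:ℝ)..1, phic ((m:ℝ) * betaP Pxx / (2 * Λ)) t) / (betaP Pxx / 2) := by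
  have hβ := beta_pos
  have e : ∫ l in (0:ℝ)..Λ, gTwo l = ∫ l in (0:ℝ)..Λ, ∑ m ∈ Icc 1 M, (m * Cm m) * gk (m * betaP Pxx / 2) l := by
    rw [intervalIntegral.integral_of_le hΛ.le, intervalIntegral.integral_of_le hΛ.le]
    refine MeasureTheory.setIntegral_congr_fun measurableSet_Ioc fun l hl => ?_
    refine gTwo_eq l hl.1 M (lt_of_le_of_lt ?_ hM)
    have := hl.2
    gcongr
  rw [e, intervalIntegral.integral_finsetSum, sum_div]
  · refine sum_congr rfl fun m hm => ?_
    have hm0 : (0:ℝ) < m := by exact_mod_cast (mem_Icc.mp hm).1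
    rw [intervalIntegral.integral_const_mul, int_gk _ _ (by positivity) hΛ]
    rw [show (m:ℝ) * betaP Pxx / 2 / Λ = (m:ℝ) * betaP Pxx / (2 * Λ) by rw [div_div]]
    field_simp
  · intro m hm
    have hm0 : (0:ℝ) < m := by exact_mod_cast (mem_Icc.mp hm).1
    exact ((gk_cont _ (by positivity)).const_mul _).intervalIntegrable _ _

theorem pairCorr_Pxx :
    (∀ Λ : ℝ, 0 < Λ →
      Tendsto (fun Q : ℕ => pairCorr (fareySet Pxx Q) Λ) atTop
        (nhds (∫ lam in (0 : ℝ)..Λ, gTwo lam))) ∧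
    ∃ Λ : ℝ, 0 < Λ ∧ (∫ lam in (0 : ℝ)..Λ, gTwo lam) ≠ Λ := by
  have hβ := beta_pos
  refine ⟨fun Λ hΛ => ?_, betaP Pxx / 2, by positivity, ?_⟩
  · obtain ⟨M, hM⟩ := exists_nat_gt (2 * Λ / betaP Pxx)
    rw [int_gTwo Λ hΛ M hM]
    exact pc_limit Λ hΛ M hM
  · rw [int_gTwo (betaP Pxx / 2) (by positivity) 2 (by
      rw [show 2 * (betaP Pxx / 2) / betaP Pxx = 1 by field_simp]; norm_num), sum_eq_zero, zero_div]
    · positivity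
    · intro m hm
      have hm0 : (1:ℝ) ≤ m := by exact_mod_cast (mem_Icc.mp hm).1
      rw [int_phic_ge, mul_zero]
      rw [show 2 * (betaP Pxx / 2) = betaP Pxx by ring, mul_div_assoc, div_self hβ.ne', mul_one]
      exact hm0
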